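/- arXiv:2011.11903 — 2 statements merged into one kernel-verified Lean document; each statement's English description precedes it below -/
import Mathlib

section
/- For site percolation on the triangular torus: if p < 1/2 then ℙ_p(A^△) → 0 as N → ∞, and if p > 1/2 then ℙ_p(S^△) → 1 as N → ∞. -/
/-!
Site percolation on the triangular torus.  A configuration assigns open/closed to
each vertex of `(ℤ/Nℤ)²`, where two vertices are adjacent when they differ by
`±(1,0)`, `±(0,1)` or `±(1,1)` modulo `N`.  A configuration lifts `N`-periodically
to the triangular lattice on `ℤ²`, and the giant-cycle event `A^△` asks for two
distinct points of `ℤ²`, congruent mod `N`, joined by a path of consecutively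
adjacent open vertices of the periodic lift.
-/

namespace TriSite

/-- A site configuration on the triangular torus. -/
abbrev Config (N : ℕ) := (Fin 2 → ZMod N) → Bool

/-- Reduction of a point of `ℤ²` modulo `N`. -/
def proj (N : ℕ) (x : Fin 2 → ℤ) : Fin 2 → ZMod N := fun i => (x i : ZMod N)

/-- Adjacency in the triangular lattice on `ℤ²`. -/
def adj (x y : Fin 2 → ℤ) : Prop :=
  y - x = ![1, 0] ∨ y - x = ![-1, 0] ∨ y - x = ![0, 1] ∨ y - x = ![0, -1] ∨
    y - x = ![1, 1] ∨ y - x = ![-1, -1]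

/-- The point `x` of `ℤ²` is open in the periodic lift. -/
def siteOpen (N : ℕ) (ω : Config N) (x : Fin 2 → ℤ) : Prop := ω (proj N x) = true

/-- One step between adjacent open vertices of the periodic lift. -/
def step (N : ℕ) (ω : Config N) (x y : Fin 2 → ℤ) : Prop :=
  adj x y ∧ siteOpen N ω x ∧ siteOpen N ω y

/-- Connectivity by paths of consecutively adjacent open vertices of the lift. -/
def connected (N : ℕ) (ω : Config N) : (Fin 2 → ℤ) → (Fin 2 → ℤ) → Prop :=
  Relation.ReflTransGen (step N ω)

/-- The giant-cycle event `A^△`. -/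
def giantEvent (N : ℕ) : Set (Config N) :=
  {ω | ∃ x y : Fin 2 → ℤ, x ≠ y ∧ proj N x = proj N y ∧ connected N ω x y}

/-- The set of winding vectors realized by a configuration. -/
def winding (N : ℕ) (ω : Config N) : Set (Fin 2 → ℤ) :=
  {w | ∃ x : Fin 2 → ℤ, connected N ω x (x + (N : ℤ) • w)}

/-- The spanning event `S^△`: the realized winding vectors span `ℚ²`. -/
def spanEvent (N : ℕ) : Set (Config N) :=
  {ω | Submodule.span ℚ
    ((fun w : Fin 2 → ℤ => fun i => (w i : ℚ)) '' winding N ω) = ⊤}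

/-- The probability of an event under Bernoulli(`p`) site percolation:
each site is open independently with probability `p`. -/
noncomputable def prob (N : ℕ) (p : ℝ) (S : Set (Config N)) : ℝ :=
  ∑ᶠ ω ∈ S, ∏ᶠ v : Fin 2 → ZMod N, (if ω v then p else 1 - p)

end TriSite
set_option linter.unusedSectionVars false
set_option linter.unusedVariables false

namespace TriSite

section Cube

open Finset

variable {V : Type*} [Fintype V] [DecidableEq V]

/-- Product weight. -/
noncomputable def wt (p : ℝ) (ω : V → Bool) : ℝ := ∏ v, (if ω v then p else 1 - p)

/-- Expectation. -/
noncomputable def Ex (p : ℝ) (f : (V → Bool) → ℝ) : ℝ := ∑ ω, wt p ω * f ω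

/-- Averaging over one coordinate. -/
noncomputable def Av (p : ℝ) (v : V) (f : (V → Bool) → ℝ) : (V → Bool) → ℝ :=
  fun ω => p * f (Function.update ω v true) + (1 - p) * f (Function.update ω v false)

/-- Discrete derivative. -/
def Dv (v : V) (f : (V → Bool) → ℝ) : (V → Bool) → ℝ :=
  fun ω => f (Function.update ω v true) - f (Function.update ω v false)

/-- Flip a coordinate. -/
def flip (v : V) (ω : V → Bool) : V → Bool := Function.update ω v (!(ω v))

lemma flip_flip (v : V) (ω : V → Bool) : flip v (flip v ω) = ω := by
  ext u; by_cases h : u = v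
  · subst h; simp [flip]
  · simp [flip, h]

lemma sum_flip (v : V) (f : (V → Bool) → ℝ) : ∑ ω, f (flip v ω) = ∑ ω, f ω :=
  Fintype.sum_equiv ⟨flip v, flip v, flip_flip v, flip_flip v⟩ _ _ (fun _ => rfl)

lemma sum_pair (v : V) (f g : (V → Bool) → ℝ)
    (h : ∀ ω, ω v = true → f ω + f (flip v ω) = g ω + g (flip v ω)) :
    ∑ ω, f ω = ∑ ω, g ω := by
  have h' : ∀ ω, f ω + f (flip v ω) = g ω + g (flip v ω) := by
    intro ω
    cases hv : ω v with
    | true => exact h ω hv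
    | false =>
      have := h (flip v ω) (by simp [flip, hv])
      rw [flip_flip] at this
      linarith
  have h1 : ∑ ω, (f ω + f (flip v ω)) = ∑ ω, (g ω + g (flip v ω)) :=
    Finset.sum_congr rfl (fun ω _ => h' ω)
  rw [Finset.sum_add_distrib, Finset.sum_add_distrib, sum_flip, sum_flip] at h1
  linarith

lemma wt_split (p : ℝ) (v : V) (ω : V → Bool) :
    wt p ω = (if ω v then p else 1 - p) * ∏ u ∈ univ.erase v, (if ω u then p else 1 - p) := by
  rw [wt, ← Finset.mul_prod_erase univ _ (Finset.mem_univ v)]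

lemma erase_flip (p : ℝ) (v : V) (ω : V → Bool) :
    ∏ u ∈ univ.erase v, (if flip v ω u then p else 1 - p) =
      ∏ u ∈ univ.erase v, (if ω u then p else 1 - p) := by
  apply Finset.prod_congr rfl
  intro u hu
  have : u ≠ v := Finset.ne_of_mem_erase hu
  simp [flip, this]

lemma flip_of_true {v : V} {ω : V → Bool} (h : ω v = true) :
    flip v ω = Function.update ω v false := by simp [flip, h]

lemma update_of {v : V} {ω : V → Bool} {b : Bool} (h : ω v = b) :
    Function.update ω v b = ω := by subst h; simp

lemma Ex_Av (p : ℝ) (v : V) (f : (V → Bool) → ℝ) : Ex p (Av p v f) = Ex p f := by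
  unfold Ex
  apply sum_pair v
  intro ω h
  rw [wt_split p v ω, wt_split p v (flip v ω), erase_flip, flip_of_true h]
  simp only [Av, Function.update_idem, Function.update_self, h, update_of h]
  simp
  ring

lemma Ex_score (p : ℝ) (v : V) (f : (V → Bool) → ℝ) :
    ∑ ω, ((∏ u ∈ univ.erase v, (if ω u then p else 1 - p)) * (if ω v then 1 else -1)) * f ω
      = Ex p (Dv v f) := by
  unfold Ex
  apply sum_pair v
  intro ω h
  rw [wt_split p v ω, wt_split p v (flip v ω), erase_flip, flip_of_true h]
  simp only [Dv, Function.update_idem, Function.update_self, h, update_of h]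
  simp
  ring

lemma wt_nonneg {p : ℝ} (h0 : 0 ≤ p) (h1 : p ≤ 1) (ω : V → Bool) : 0 ≤ wt p ω := by
  apply Finset.prod_nonneg
  intro v _
  split_ifs <;> linarith

lemma Ex_mono {p : ℝ} (h0 : 0 ≤ p) (h1 : p ≤ 1) {f g : (V → Bool) → ℝ} (h : ∀ ω, f ω ≤ g ω) :
    Ex p f ≤ Ex p g :=
  Finset.sum_le_sum (fun ω _ => mul_le_mul_of_nonneg_left (h ω) (wt_nonneg h0 h1 ω))

lemma Ex_add (p : ℝ) (f g : (V → Bool) → ℝ) : Ex p (fun ω => f ω + g ω) = Ex p f + Ex p g := by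
  simp [Ex, mul_add, Finset.sum_add_distrib]

lemma Ex_sub (p : ℝ) (f g : (V → Bool) → ℝ) : Ex p (fun ω => f ω - g ω) = Ex p f - Ex p g := by
  simp [Ex, mul_sub, Finset.sum_sub_distrib]

lemma Ex_smul (p c : ℝ) (f : (V → Bool) → ℝ) : Ex p (fun ω => c * f ω) = c * Ex p f := by
  simp only [Ex, Finset.mul_sum]
  exact Finset.sum_congr rfl (fun _ _ => by ring)

lemma sum_wt (p : ℝ) : ∑ ω : V → Bool, wt p ω = 1 := by
  have := Finset.prod_univ_sum (fun _ : V => (Finset.univ : Finset Bool))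
    (fun _ b => if b then p else 1 - p)
  simp only [Fintype.piFinset_univ] at this
  simp only [wt]
  rw [← this]
  simp

lemma Ex_const (p c : ℝ) : Ex (V := V) p (fun _ => c) = c := by
  simp [Ex, ← Finset.sum_mul, sum_wt]

/-- Iterated averaging along a list. -/
noncomputable def AvL (p : ℝ) : List V → ((V → Bool) → ℝ) → ((V → Bool) → ℝ)
  | [], f => f
  | v :: L, f => AvL p L (Av p v f)

lemma Ex_AvL (p : ℝ) (L : List V) (f : (V → Bool) → ℝ) : Ex p (AvL p L f) = Ex p f := by
  induction L generalizing f with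
  | nil => rfl
  | cons v L ih => rw [AvL, ih, Ex_Av]

lemma Av_inv (p : ℝ) (u v : V) (f : (V → Bool) → ℝ)
    (h : u = v ∨ ∀ ω b, f (Function.update ω v b) = f ω) (ω : V → Bool) (b : Bool) :
    Av p u f (Function.update ω v b) = Av p u f ω := by
  by_cases huv : u = v
  · subst huv; simp [Av]
  · have h := h.resolve_left huv
    simp only [Av]
    rw [Function.update_comm (Ne.symm huv), h, Function.update_comm (Ne.symm huv), h]

lemma AvL_inv (p : ℝ) (L : List V) (v : V) (f : (V → Bool) → ℝ)
    (h : v ∈ L ∨ ∀ ω b, f (Function.update ω v b) = f ω) :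
    ∀ ω b, AvL p L f (Function.update ω v b) = AvL p L f ω := by
  induction L generalizing f with
  | nil => simpa [AvL] using h
  | cons u L ih =>
    apply ih
    rcases h with h | h
    · rcases List.mem_cons.1 h with h | h
      · right; exact Av_inv p u v f (Or.inl h.symm)
      · left; exact h
    · right; exact Av_inv p u v f (Or.inr h)

lemma const_of_inv (f : (V → Bool) → ℝ) (h : ∀ v ω b, f (Function.update ω v b) = f ω)
    (ω ω' : V → Bool) : f ω = f ω' := by
  have key : ∀ S : Finset V, f (S.piecewise ω ω') = f ω' := by
    intro S
    induction S using Finset.induction_on with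
    | empty => simp
    | insert a s ha ih => rw [Finset.piecewise_insert, h, ih]
  simpa using key Finset.univ

lemma AvL_univ (p : ℝ) (f : (V → Bool) → ℝ) (ω : V → Bool) :
    AvL p Finset.univ.toList f ω = Ex p f := by
  have hc := const_of_inv (AvL p Finset.univ.toList f)
    (fun v => AvL_inv p _ v f (Or.inl (by simp)))
  rw [← Ex_AvL p Finset.univ.toList f]
  have : AvL p Finset.univ.toList f = fun _ => AvL p Finset.univ.toList f ω := by
    ext ω'; exact hc ω' ω
  conv_rhs => rw [this]
  rw [Ex_const]

/-- `x log x`. -/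
noncomputable def phi (x : ℝ) : ℝ := x * Real.log x

lemma phi_le {x m : ℝ} (hx : 0 ≤ x) (hm : 0 < m) :
    phi x ≤ phi m + (Real.log m + 1) * (x - m) + (x - m) ^ 2 / m := by
  unfold phi
  rcases hx.eq_or_lt with rfl | hx
  · have : (0 - m) ^ 2 / m = m := by field_simp; ring
    rw [this]; simp; nlinarith
  · have h1 : Real.log (x / m) ≤ x / m - 1 := Real.log_le_sub_one_of_pos (by positivity)
    rw [Real.log_div hx.ne' hm.ne'] at h1
    have h2 := mul_le_mul_of_nonneg_left h1 hx.le
    have : (x - m) ^ 2 / m = x * (x / m - 1) - (x - m) := by field_simp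
    rw [this]; nlinarith

lemma two_point {p : ℝ} (h0 : 0 ≤ p) (h1 : p ≤ 1) (a b : ℝ) :
    p * phi (a ^ 2) + (1 - p) * phi (b ^ 2) - phi (p * a ^ 2 + (1 - p) * b ^ 2)
      ≤ 2 * (a - b) ^ 2 := by
  have hq : 0 ≤ 1 - p := by linarith
  have hm0 : 0 ≤ p * a ^ 2 + (1 - p) * b ^ 2 := by positivity
  rcases hm0.eq_or_lt with hm | hm
  · have e1 : p * a ^ 2 = 0 := by nlinarith [mul_nonneg h0 (sq_nonneg a), mul_nonneg hq (sq_nonneg b)]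
    have e2 : (1 - p) * b ^ 2 = 0 := by nlinarith
    have e3 : p * phi (a ^ 2) = 0 := by unfold phi; rw [← mul_assoc, e1]; simp
    have e4 : (1 - p) * phi (b ^ 2) = 0 := by unfold phi; rw [← mul_assoc, e2]; simp
    rw [e3, e4, ← hm]; simp [phi]; positivity
  · set m := p * a ^ 2 + (1 - p) * b ^ 2 with hmd
    have ha := mul_le_mul_of_nonneg_left (phi_le (sq_nonneg a) hm) h0
    have hb := mul_le_mul_of_nonneg_left (phi_le (sq_nonneg b) hm) hq
    have key : p * ((a ^ 2 - m) ^ 2 / m) + (1 - p) * ((b ^ 2 - m) ^ 2 / m) ≤ 2 * (a - b) ^ 2 := by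
      have : p * ((a ^ 2 - m) ^ 2 / m) + (1 - p) * ((b ^ 2 - m) ^ 2 / m)
        = (p * (1 - p) * (a + b) ^ 2) * (a - b) ^ 2 / m := by
        rw [hmd]; field_simp; ring
      rw [this, div_le_iff₀ hm]
      have h5 : p * (1 - p) * (a + b) ^ 2 ≤ 2 * m := by
        rw [hmd]
        nlinarith [mul_nonneg (mul_nonneg h0 hq) (sq_nonneg (a - b)),
          mul_nonneg (mul_nonneg h0 h0) (sq_nonneg a), mul_nonneg (mul_nonneg hq hq) (sq_nonneg b)]
      nlinarith [sq_nonneg (a - b)]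
    have e : p * ((Real.log m + 1) * (a ^ 2 - m)) + (1 - p) * ((Real.log m + 1) * (b ^ 2 - m)) = 0 := by
      have : p * ((Real.log m + 1) * (a ^ 2 - m)) + (1 - p) * ((Real.log m + 1) * (b ^ 2 - m))
        = (Real.log m + 1) * (p * a ^ 2 + (1 - p) * b ^ 2 - m) := by ring
      rw [this, ← hmd]; simp
    nlinarith

lemma mink {p : ℝ} (h0 : 0 ≤ p) (h1 : p ≤ 1) (a b c d : ℝ) :
    (√(p * a ^ 2 + (1 - p) * b ^ 2) - √(p * c ^ 2 + (1 - p) * d ^ 2)) ^ 2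
      ≤ p * (a - c) ^ 2 + (1 - p) * (b - d) ^ 2 := by
  have hq : 0 ≤ 1 - p := by linarith
  have hX : 0 ≤ p * a ^ 2 + (1 - p) * b ^ 2 := by positivity
  have hY : 0 ≤ p * c ^ 2 + (1 - p) * d ^ 2 := by positivity
  have e1 := Real.sq_sqrt hX
  have e2 := Real.sq_sqrt hY
  have e3 : p * a * c + (1 - p) * b * d ≤
      √(p * a ^ 2 + (1 - p) * b ^ 2) * √(p * c ^ 2 + (1 - p) * d ^ 2) := by
    rw [← Real.sqrt_mul hX]
    apply Real.le_sqrt_of_sq_le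
    nlinarith [mul_nonneg (mul_nonneg h0 hq) (sq_nonneg (a * d - b * c))]
  nlinarith

lemma Dv_Av_self (p : ℝ) (v : V) (f : (V → Bool) → ℝ) (ω : V → Bool) :
    Dv v (Av p v f) ω = 0 := by
  simp [Dv, Av]

lemma Dv_Av_ne (p : ℝ) {u v : V} (h : u ≠ v) (f : (V → Bool) → ℝ) (ω : V → Bool) :
    Dv u (Av p v f) ω = Av p v (Dv u f) ω := by
  simp only [Dv, Av]
  rw [Function.update_comm h, Function.update_comm h, Function.update_comm h,
    Function.update_comm h]
  ring

/-- Log-Sobolev along a list. -/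
lemma logSob {p : ℝ} (h0 : 0 ≤ p) (h1 : p ≤ 1) (L : List V) (hL : L.Nodup)
    (g : (V → Bool) → ℝ) :
    Ex p (fun ω => phi (g ω ^ 2)) - Ex p (fun ω => phi (AvL p L (fun ω => g ω ^ 2) ω))
      ≤ 2 * (L.map (fun i => Ex p (fun ω => Dv i g ω ^ 2))).sum := by
  have hq : 0 ≤ 1 - p := by linarith
  induction L generalizing g with
  | nil => simp [AvL]
  | cons v L ih =>
    have hn := List.nodup_cons.1 hL
    set G : (V → Bool) → ℝ := fun ω => √(Av p v (fun ω => g ω ^ 2) ω) with hG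
    have hG2 : (fun ω => G ω ^ 2) = Av p v (fun ω => g ω ^ 2) := by
      ext ω
      apply Real.sq_sqrt
      simp only [Av]; positivity
    have hI := ih hn.2 G
    rw [hG2] at hI
    have hstep : Ex p (fun ω => phi (g ω ^ 2)) - Ex p (fun ω => phi (G ω ^ 2))
        ≤ 2 * Ex p (fun ω => Dv v g ω ^ 2) := by
      rw [← Ex_Av p v (fun ω => phi (g ω ^ 2)), ← Ex_sub, ← Ex_smul]
      apply Ex_mono h0 h1
      intro ω
      rw [congrFun hG2 ω]
      simp only [Av, Dv]
      exact two_point h0 h1 _ _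
    have hrest : (L.map (fun i => Ex p (fun ω => Dv i G ω ^ 2))).sum ≤
        (L.map (fun i => Ex p (fun ω => Dv i g ω ^ 2))).sum := by
      apply List.sum_le_sum
      intro i hi
      have hiv : i ≠ v := fun e => hn.1 (e ▸ hi)
      rw [← Ex_Av p v (fun ω => Dv i g ω ^ 2)]
      apply Ex_mono h0 h1
      intro ω
      simp only [hG, Dv, Av]
      rw [Function.update_comm hiv, Function.update_comm hiv, Function.update_comm hiv,
        Function.update_comm hiv]
      exact mink h0 h1 _ _ _ _
    simp only [List.map_cons, List.sum_cons, AvL]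
    have e := congrArg (fun F : (V → Bool) → ℝ => Ex p (fun ω => phi (F ω))) hG2
    rw [e] at hstep
    linarith

lemma logSob_univ {p : ℝ} (h0 : 0 ≤ p) (h1 : p ≤ 1) (g : (V → Bool) → ℝ) :
    Ex p (fun ω => phi (g ω ^ 2)) - phi (Ex p (fun ω => g ω ^ 2))
      ≤ 2 * ∑ i, Ex p (fun ω => Dv i g ω ^ 2) := by
  have := logSob h0 h1 Finset.univ.toList (Finset.nodup_toList _) g
  simp only [AvL_univ, Ex_const] at this
  simpa [Finset.sum_map_toList] using this

lemma Ex_nonneg {p : ℝ} (h0 : 0 ≤ p) (h1 : p ≤ 1) {f : (V → Bool) → ℝ} (h : ∀ ω, 0 ≤ f ω) :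
    0 ≤ Ex p f := by
  have := Ex_mono h0 h1 (f := fun _ => 0) (g := f) h
  rwa [Ex_const] at this

/-- Lower bound on the entropy of `d^2`. -/
lemma ent_lower {p : ℝ} (h0 : 0 ≤ p) (h1 : p ≤ 1) (d : (V → Bool) → ℝ) {I l : ℝ} (hI : 0 < I)
    (hl : 0 < l) (hd : Ex p (fun ω => |d ω|) ≤ I) :
    Ex p (fun ω => d ω ^ 2) * Real.log (l / I ^ 2) + Ex p (fun ω => d ω ^ 2) - l
      ≤ Ex p (fun ω => phi (d ω ^ 2)) - phi (Ex p (fun ω => d ω ^ 2)) := by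
  set t := Ex p (fun ω => d ω ^ 2) with ht
  have ht0 : 0 ≤ t := Ex_nonneg h0 h1 (fun ω => sq_nonneg _)
  rcases ht0.eq_or_lt with h | h
  · rw [← h]
    have hz : ∀ ω, wt p ω * d ω ^ 2 = 0 := by
      have hs : ∑ ω, wt p ω * d ω ^ 2 = 0 := by rw [h, ht]; rfl
      rw [Finset.sum_eq_zero_iff_of_nonneg
        (fun ω _ => mul_nonneg (wt_nonneg h0 h1 ω) (sq_nonneg _))] at hs
      exact fun ω => hs ω (Finset.mem_univ ω)
    have : Ex p (fun ω => phi (d ω ^ 2)) = 0 := by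
      apply Finset.sum_eq_zero
      intro ω _
      simp only [phi]; rw [← mul_assoc, hz]; simp
    rw [this]; simp [phi]; linarith
  · -- pointwise: phi (d^2) ≥ 2 * (d^2 * log (t / I) + d^2 - |d| * t / I)
    have hp : ∀ ω, 2 * Real.log (t / I) * d ω ^ 2 + 2 * d ω ^ 2 - 2 * (t / I) * |d ω|
        ≤ phi (d ω ^ 2) := by
      intro ω
      by_cases hz : d ω = 0
      · simp [hz, phi]
      · have ha : 0 < |d ω| := abs_pos.2 hz
        have hy : 0 < |d ω| * I / t := by positivity
        have h2 := Real.one_sub_inv_le_log_of_pos hy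
        have h3 : Real.log (|d ω| * I / t) = Real.log |d ω| - Real.log (t / I) := by
          rw [Real.log_div (by positivity) h.ne', Real.log_mul ha.ne' hI.ne',
            Real.log_div h.ne' hI.ne']
          ring
        rw [h3] at h2
        have h4 := mul_le_mul_of_nonneg_left h2 (sq_nonneg |d ω|)
        have h5 : |d ω| ^ 2 * (1 - (|d ω| * I / t)⁻¹) = |d ω| ^ 2 - t / I * |d ω| := by
          field_simp
        rw [h5] at h4
        have h6 : phi (d ω ^ 2) = 2 * (|d ω| ^ 2 * Real.log |d ω|) := by
          unfold phi
          rw [← sq_abs (d ω), Real.log_pow]; push_cast; ring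
        rw [h6, ← sq_abs (d ω)]
        nlinarith
    have hE := Ex_mono h0 h1 hp
    rw [Ex_sub, Ex_add, Ex_smul, Ex_smul, Ex_smul, ← ht] at hE
    have h7 : t / I * Ex p (fun ω => |d ω|) ≤ t := by
      calc t / I * Ex p (fun ω => |d ω|) ≤ t / I * I := by gcongr
        _ = t := by field_simp
    have h8 : Real.log (t / I) = Real.log t - Real.log I := Real.log_div h.ne' hI.ne'
    have h9 : Real.log (l / I ^ 2) = Real.log l - 2 * Real.log I := by
      rw [Real.log_div hl.ne' (by positivity), Real.log_pow]; push_cast; ring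
    have h10 := Real.log_le_sub_one_of_pos (show 0 < l / t by positivity)
    rw [Real.log_div hl.ne' h.ne'] at h10
    have h11 := mul_le_mul_of_nonneg_left h10 h.le
    have h12 : t * (l / t - 1) = l - t := by field_simp
    rw [h12] at h11
    unfold phi at hE ⊢
    rw [h9]
    rw [h8] at hE
    nlinarith

lemma orth (p : ℝ) (v : V) (f : (V → Bool) → ℝ) :
    Ex p (fun ω => (f ω - Av p v f ω) ^ 2) + Ex p (fun ω => Av p v f ω ^ 2)
      = Ex p (fun ω => f ω ^ 2) := by
  rw [← Ex_Av p v (fun ω => f ω ^ 2), ← Ex_Av p v (fun ω => (f ω - Av p v f ω) ^ 2), ← Ex_add]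
  congr 1
  ext ω
  simp only [Av, Function.update_idem]
  ring

lemma abs_Av_le {p : ℝ} (h0 : 0 ≤ p) (h1 : p ≤ 1) (u v : V) (f : (V → Bool) → ℝ) :
    Ex p (fun ω => |Dv u (Av p v f) ω|) ≤ Ex p (fun ω => |Dv u f ω|) := by
  have hq : 0 ≤ 1 - p := by linarith
  by_cases h : u = v
  · subst h
    simp only [Dv_Av_self, abs_zero]
    rw [Ex_const]
    exact Ex_nonneg h0 h1 (fun ω => abs_nonneg _)
  · rw [← Ex_Av p v (fun ω => |Dv u f ω|)]
    apply Ex_mono h0 h1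
    intro ω
    rw [Dv_Av_ne p h]
    simp only [Av]
    refine (abs_add_le _ _).trans ?_
    rw [abs_mul, abs_mul, abs_of_nonneg h0, abs_of_nonneg hq]

lemma abs_sub_Av {p : ℝ} (h0 : 0 ≤ p) (h1 : p ≤ 1) (v : V) (f : (V → Bool) → ℝ) :
    Ex p (fun ω => |f ω - Av p v f ω|) ≤ Ex p (fun ω => |Dv v f ω|) := by
  have hq : 0 ≤ 1 - p := by linarith
  apply Ex_mono h0 h1
  intro ω
  cases hv : ω v with
  | true =>
    simp only [Av, Dv, update_of hv]
    have : f ω - (p * f ω + (1 - p) * f (Function.update ω v false))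
      = (1 - p) * (f ω - f (Function.update ω v false)) := by ring
    rw [this, abs_mul, abs_of_nonneg hq]
    exact mul_le_of_le_one_left (abs_nonneg _) (by linarith)
  | false =>
    simp only [Av, Dv, update_of hv]
    have : f ω - (p * f (Function.update ω v true) + (1 - p) * f ω)
      = - (p * (f (Function.update ω v true) - f ω)) := by ring
    rw [this, abs_neg, abs_mul, abs_of_nonneg h0]
    exact mul_le_of_le_one_left (abs_nonneg _) h1

lemma Dv_orth {p : ℝ} (i v : V) (f : (V → Bool) → ℝ) :
    Ex p (fun ω => Dv i (fun ω => f ω - Av p v f ω) ω ^ 2) + Ex p (fun ω => Dv i (Av p v f) ω ^ 2)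
      = Ex p (fun ω => Dv i f ω ^ 2) := by
  have hs : ∀ ω, Dv i (fun ω => f ω - Av p v f ω) ω = Dv i f ω - Dv i (Av p v f) ω := by
    intro ω; simp only [Dv]; ring
  simp only [hs]
  by_cases h : i = v
  · subst h
    simp [Dv_Av_self, Ex_const]
  · simp only [Dv_Av_ne p h]
    exact orth p v (Dv i f)

/-- Falik-Samorodnitsky type inequality. -/
lemma falik {p : ℝ} (h0 : 0 ≤ p) (h1 : p ≤ 1) {I l : ℝ} (hI : 0 < I) (hl : 0 < l) (L : List V)
    (f : (V → Bool) → ℝ) (hf : ∀ v, Ex p (fun ω => |Dv v f ω|) ≤ I) :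
    (Ex p (fun ω => f ω ^ 2) - Ex p (fun ω => AvL p L f ω ^ 2)) * (Real.log (l / I ^ 2) + 1)
      - l * L.length ≤ 2 * ∑ i, Ex p (fun ω => Dv i f ω ^ 2) := by
  induction L generalizing f with
  | nil =>
    simp only [AvL, sub_self, zero_mul, List.length_nil, Nat.cast_zero, mul_zero]
    have : 0 ≤ ∑ i, Ex p (fun ω => Dv i f ω ^ 2) :=
      Finset.sum_nonneg (fun i _ => Ex_nonneg h0 h1 (fun ω => sq_nonneg _))
    linarith
  | cons v L ih =>
    have hA := ih (Av p v f) (fun u => (abs_Av_le h0 h1 u v f).trans (hf u))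
    have hd := ent_lower h0 h1 (fun ω => f ω - Av p v f ω) hI hl
      ((abs_sub_Av h0 h1 v f).trans (hf v))
    have hls := logSob_univ h0 h1 (fun ω => f ω - Av p v f ω)
    have ho := orth p v f
    have hsum : ∑ i, Ex p (fun ω => Dv i (fun ω => f ω - Av p v f ω) ω ^ 2)
        + ∑ i, Ex p (fun ω => Dv i (Av p v f) ω ^ 2) = ∑ i, Ex p (fun ω => Dv i f ω ^ 2) := by
      rw [← Finset.sum_add_distrib]
      exact Finset.sum_congr rfl (fun i _ => Dv_orth i v f)
    simp only [AvL, List.length_cons, Nat.cast_add, Nat.cast_one]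
    rw [← ho, ← hsum]
    linarith

lemma russo (f : (V → Bool) → ℝ) (p : ℝ) :
    HasDerivAt (fun p => Ex p f) (∑ v, Ex p (Dv v f)) p := by
  have hw : ∀ ω : V → Bool, HasDerivAt (fun p => wt p ω)
      (∑ v, (∏ u ∈ univ.erase v, (if ω u then p else 1 - p)) * (if ω v then 1 else -1)) p := by
    intro ω
    unfold wt
    have := HasDerivAt.fun_finsetProd (u := (univ : Finset V)) (x := p)
      (f := fun v p => (if ω v then p else 1 - p)) (f' := fun v => if ω v then (1:ℝ) else -1)
      (fun v _ => by
        by_cases h : ω v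
        · simp only [h, if_true]; exact hasDerivAt_id p
        · simp only [h]; simpa using (hasDerivAt_id p).const_sub 1)
    simpa [smul_eq_mul] using this
  have h2 := HasDerivAt.fun_sum (u := (univ : Finset (V → Bool))) (x := p)
    (fun ω _ => (hw ω).mul_const (f ω))
  have e : ∑ ω, (∑ v, (∏ u ∈ univ.erase v, (if ω u then p else 1 - p)) *
      (if ω v then 1 else -1)) * f ω = ∑ v, Ex p (Dv v f) := by
    simp only [Finset.sum_mul]
    rw [Finset.sum_comm]
    exact Finset.sum_congr rfl (fun v _ => Ex_score p v f)
  rw [e] at h2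
  exact h2

end Cube

end TriSite
set_option linter.unusedSectionVars false

namespace TriSite

section Sharp

open Finset

variable {V : Type*} [Fintype V] [DecidableEq V]

lemma Dv_nonneg {f : (V → Bool) → ℝ} (hm : Monotone f) (v : V) (ω : V → Bool) : 0 ≤ Dv v f ω := by
  have : Function.update ω v false ≤ Function.update ω v true := by
    intro u
    by_cases h : u = v
    · subst h; simp
    · simp [h]
  have := hm this
  simp only [Dv]; linarith

lemma Dv_sq {f : (V → Bool) → ℝ} (hm : Monotone f) (h01 : ∀ ω, f ω = 0 ∨ f ω = 1) (v : V)
    (ω : V → Bool) : Dv v f ω ^ 2 = Dv v f ω := by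
  have h := Dv_nonneg hm v ω
  simp only [Dv] at *
  rcases h01 (Function.update ω v true) with h1 | h1 <;>
  rcases h01 (Function.update ω v false) with h2 | h2 <;>
  rw [h1, h2] at h ⊢ <;> first | (exfalso; linarith) | norm_num

lemma Ex_le_of_le {f : (V → Bool) → ℝ} (hm : Monotone f) {a b : ℝ} (ha : 0 ≤ a) (hab : a ≤ b)
    (hb : b ≤ 1) : Ex a f ≤ Ex b f := by
  have : MonotoneOn (fun p => Ex p f) (Set.Icc 0 1) := by
    apply monotoneOn_of_deriv_nonneg (convex_Icc 0 1)
    · exact fun x _ => (russo f x).continuousAt.continuousWithinAt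
    · exact fun x _ => (russo f x).differentiableAt.differentiableWithinAt
    · intro x hx
      rw [interior_Icc] at hx
      rw [(russo f x).deriv]
      exact Finset.sum_nonneg (fun v _ => Ex_nonneg hx.1.le hx.2.le (Dv_nonneg hm v))
  exact this ⟨ha, hab.trans hb⟩ ⟨ha.trans hab, hb⟩ hab

/-- Sharp threshold for transitive monotone events. -/
theorem sharp (ε δ : ℝ) (hε : 0 < ε) (hδ : 0 < δ) : ∃ n0 : ℕ, ∀ (V : Type) [Fintype V]
    [DecidableEq V], n0 ≤ Fintype.card V → ∀ f : (V → Bool) → ℝ, Monotone f →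
    (∀ ω, f ω = 0 ∨ f ω = 1) → (∀ p u v, Ex p (Dv u f) = Ex p (Dv v f)) →
    1 / 2 ≤ Ex (1 / 2) f → ∀ p, 1 / 2 + δ ≤ p → p ≤ 1 → 1 - ε ≤ Ex p f := by
  set K : ℝ := 1 / (2 * δ) with hK
  have hKpos : 0 < K := by positivity
  set M : ℝ := 4 * K / ε + 1 with hM
  obtain ⟨n0, hn0⟩ := exists_nat_ge (Real.exp M * K ^ 2 / (ε / 2))
  refine ⟨n0 + 1, ?_⟩
  intro V _ _ hcard f hm h01 hsym hhalf p hp hp1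
  by_contra hcon
  push Not at hcon
  obtain ⟨c, hc, hder⟩ := exists_hasDerivAt_eq_slope (fun p => Ex p f)
    (fun p => ∑ v, Ex p (Dv v f)) (show (1:ℝ) / 2 < p by linarith)
    (fun x _ => (russo f x).continuousAt.continuousWithinAt) (fun x _ => russo f x)
  have hc0 : 0 ≤ c := by linarith [hc.1]
  have hc1 : c ≤ 1 := by linarith [hc.2]
  have hT : ∑ v, Ex c (Dv v f) ≤ K := by
    rw [hder, hK, div_le_div_iff₀ (by linarith) (by positivity)]
    have h1 : Ex p f - Ex (1 / 2) f ≤ 1 / 2 := by linarith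
    nlinarith
  set n : ℝ := (Fintype.card V : ℝ) with hn
  have hnge : (n0 : ℝ) + 1 ≤ n := by rw [hn]; exact_mod_cast hcard
  have hnpos : 0 < n := by have : (0:ℝ) ≤ n0 := Nat.cast_nonneg _; linarith
  have hF1 : 1 / 2 ≤ Ex c f := hhalf.trans (Ex_le_of_le hm (by norm_num) hc.1.le hc1)
  have hF2 : Ex c f < 1 - ε := (Ex_le_of_le hm hc0 hc.2.le hp1).trans_lt hcon
  have hinf : ∀ v, Ex c (fun ω => |Dv v f ω|) ≤ K / n := by
    intro v
    have e : (fun ω => |Dv v f ω|) = Dv v f := by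
      ext ω; exact abs_of_nonneg (Dv_nonneg hm v ω)
    rw [e, le_div_iff₀ hnpos]
    have : ∑ u, Ex c (Dv u f) = n * Ex c (Dv v f) := by
      rw [Finset.sum_congr rfl (fun u _ => hsym c u v)]
      simp [hn]
    linarith
  have key := falik hc0 hc1 (I := K / n) (l := (ε / 2) / n) (by positivity) (by positivity)
    Finset.univ.toList f hinf
  have e1 : ∀ i, (fun ω => Dv i f ω ^ 2) = Dv i f := fun i => funext (fun ω => Dv_sq hm h01 i ω)
  have e2 : (fun ω => f ω ^ 2) = f := by
    ext ω; rcases h01 ω with h | h <;> rw [h] <;> norm_num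
  simp only [AvL_univ, e1, e2, Ex_const, Finset.length_toList, Finset.card_univ] at key
  rw [← hn] at key
  have e3 : ε / 2 / n / (K / n) ^ 2 = (ε / 2) * n / K ^ 2 := by field_simp
  have e4 : ε / 2 / n * n = ε / 2 := by field_simp
  rw [e3, e4] at key
  have hlog : M ≤ Real.log (ε / 2 * n / K ^ 2) := by
    rw [Real.le_log_iff_exp_le (by positivity), le_div_iff₀ (by positivity)]
    have : Real.exp M * K ^ 2 / (ε / 2) ≤ n := by linarith
    rw [div_le_iff₀ (by positivity)] at this
    linarith
  have hMpos : 0 < M := by positivity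
  have hV : ε / 2 ≤ Ex c f - Ex c f ^ 2 := by nlinarith
  have h5 : ε / 2 * (M + 1) ≤ (Ex c f - Ex c f ^ 2) * (Real.log (ε / 2 * n / K ^ 2) + 1) := by
    apply mul_le_mul hV (by linarith) (by positivity) (by linarith)
  have h6 : ε / 2 * (M + 1) - ε / 2 = 2 * K + ε / 2 := by rw [hM]; field_simp; ring
  linarith

/-- Harris for increasing 0-1 functions. -/
lemma harris {p : ℝ} (h0 : 0 ≤ p) (h1 : p ≤ 1) (f g : (V → Bool) → ℝ) (hf0 : ∀ ω, 0 ≤ f ω)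
    (hg0 : ∀ ω, 0 ≤ g ω) (hf : Monotone f) (hg : Monotone g) :
    Ex p f * Ex p g ≤ Ex p (fun ω => f ω * g ω) := by
  have := fkg (μ := wt (V := V) p) (f := f) (g := g) (fun ω => wt_nonneg h0 h1 ω) hf0 hg0 hf hg
    (fun a b => by
      unfold wt
      rw [← Finset.prod_mul_distrib, ← Finset.prod_mul_distrib]
      apply le_of_eq
      apply Finset.prod_congr rfl
      intro v _
      simp only [Pi.inf_apply, Pi.sup_apply]
      rcases Bool.eq_false_or_eq_true (a v) with ha | ha <;>
      rcases Bool.eq_false_or_eq_true (b v) with hb | hb <;> simp [ha, hb, mul_comm])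
  rw [sum_wt, one_mul] at this
  exact this

/-- Symmetry of the expectation. -/
lemma Ex_equiv (p : ℝ) (τ : V ≃ V) (f : (V → Bool) → ℝ) :
    Ex p (fun ω => f (fun v => ω (τ v))) = Ex p f := by
  unfold Ex
  refine Fintype.sum_equiv (τ.symm.arrowCongr (Equiv.refl Bool)) _ _ ?_
  intro ω
  have e : (τ.symm.arrowCongr (Equiv.refl Bool)) ω = fun v => ω (τ v) := by
    ext v; simp [Equiv.arrowCongr]
  rw [e]
  congr 1
  unfold wt
  exact (Equiv.prod_comp τ (fun v => if ω v then p else 1 - p)).symm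

lemma Ex_compl (p : ℝ) (f : (V → Bool) → ℝ) :
    Ex p (fun ω => f (fun v => !(ω v))) = Ex (1 - p) f := by
  unfold Ex
  refine Fintype.sum_equiv ⟨fun ω v => !(ω v), fun ω v => !(ω v), fun ω => by simp,
    fun ω => by simp⟩ _ _ ?_
  intro ω
  simp only [Equiv.coe_fn_mk]
  congr 1
  unfold wt
  apply Finset.prod_congr rfl
  intro v _
  rcases Bool.eq_false_or_eq_true (ω v) with ha | ha <;> simp [ha]

lemma Dv_equiv (p : ℝ) (τ : V ≃ V) (f : (V → Bool) → ℝ)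
    (hf : ∀ ω, f (fun v => ω (τ v)) = f ω) (v : V) : Ex p (Dv v f) = Ex p (Dv (τ v) f) := by
  rw [← Ex_equiv p τ (Dv v f)]
  congr 1
  ext ω
  have e : ∀ b, Function.update (fun u => ω (τ u)) v b
      = fun u => (Function.update ω (τ v) b) (τ u) := by
    intro b; ext u
    by_cases h : u = v
    · subst h; simp
    · simp [h]
  simp only [Dv, e, hf]

end Sharp

end TriSite
namespace TriSite

section Topology

lemma adj_iff (x y : Fin 2 → ℤ) : adj x y ↔
    (y 0 - x 0 = 1 ∧ y 1 - x 1 = 0) ∨ (y 0 - x 0 = -1 ∧ y 1 - x 1 = 0) ∨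
    (y 0 - x 0 = 0 ∧ y 1 - x 1 = 1) ∨ (y 0 - x 0 = 0 ∧ y 1 - x 1 = -1) ∨
    (y 0 - x 0 = 1 ∧ y 1 - x 1 = 1) ∨ (y 0 - x 0 = -1 ∧ y 1 - x 1 = -1) := by
  simp [adj, funext_iff, Fin.forall_fin_two]

lemma adj_symm {x y : Fin 2 → ℤ} (h : adj x y) : adj y x := by
  rw [adj_iff] at *; omega

lemma step_symm {N : ℕ} {ω : Config N} {x y : Fin 2 → ℤ} (h : step N ω x y) : step N ω y x :=
  ⟨adj_symm h.1, h.2.2, h.2.1⟩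

lemma connected_symm {N : ℕ} {ω : Config N} {x y : Fin 2 → ℤ} (h : connected N ω x y) :
    connected N ω y x := by
  induction h with
  | refl => exact Relation.ReflTransGen.refl
  | tail _ hs ih => exact Relation.ReflTransGen.head (step_symm hs) ih

lemma connected_refl {N : ℕ} {ω : Config N} (x : Fin 2 → ℤ) : connected N ω x x :=
  Relation.ReflTransGen.refl

lemma connected_trans {N : ℕ} {ω : Config N} {x y z : Fin 2 → ℤ} (h : connected N ω x y)
    (h' : connected N ω y z) : connected N ω x z := Relation.ReflTransGen.trans h h'

lemma connected_single {N : ℕ} {ω : Config N} {x y : Fin 2 → ℤ} (h : step N ω x y) :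
    connected N ω x y := Relation.ReflTransGen.single h

lemma proj_shift (N : ℕ) (x z : Fin 2 → ℤ) : proj N (x + (N : ℤ) • z) = proj N x := by
  ext i; simp [proj]

lemma step_map {N : ℕ} {ω ω' : Config N} (σ : (Fin 2 → ℤ) → (Fin 2 → ℤ))
    (hσ : ∀ x y, adj x y → adj (σ x) (σ y))
    (ho : ∀ x, siteOpen N ω x → siteOpen N ω' (σ x)) {x y : Fin 2 → ℤ}
    (h : connected N ω x y) : connected N ω' (σ x) (σ y) :=
  by
  induction h with
  | refl => exact Relation.ReflTransGen.refl
  | tail _ hs ih =>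
    exact Relation.ReflTransGen.tail ih ⟨hσ _ _ hs.1, ho _ hs.2.1, ho _ hs.2.2⟩

lemma connected_shift {N : ℕ} {ω : Config N} (z : Fin 2 → ℤ) {x y : Fin 2 → ℤ}
    (h : connected N ω x y) : connected N ω (x + (N : ℤ) • z) (y + (N : ℤ) • z) := by
  refine step_map (fun x => x + (N : ℤ) • z) ?_ ?_ h
  · intro x y h; simpa [adj] using h
  · intro x h; unfold siteOpen at *; rw [proj_shift]; exact h

/-- A height function constant on clusters with prescribed periods. -/
lemma exists_height (N : ℕ) (ω : Config N) (l : Fin 2 → ℤ)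
    (hl : ∀ w ∈ winding N ω, l 0 * w 0 + l 1 * w 1 = 0) :
    ∃ H : (Fin 2 → ℤ) → ℤ, (∀ x z, H (x + (N : ℤ) • z) = H x + (l 0 * z 0 + l 1 * z 1)) ∧
      ∀ x y, step N ω x y → H x = H y := by
  classical
  let S : Setoid (Fin 2 → ℤ) :=
    { r := fun x y => ∃ z : Fin 2 → ℤ, connected N ω x (y + (N : ℤ) • z)
      iseqv := by
        refine ⟨fun x => ⟨0, by simpa using connected_refl x⟩, ?_, ?_⟩
        · rintro x y ⟨z, h⟩
          refine ⟨-z, ?_⟩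
          have := connected_symm (connected_shift (-z) h)
          simpa [add_assoc] using this
        · rintro x y t ⟨z, h⟩ ⟨z', h'⟩
          refine ⟨z' + z, ?_⟩
          have := connected_trans h (connected_shift z h')
          simpa [add_assoc, smul_add] using this }
  let r : (Fin 2 → ℤ) → (Fin 2 → ℤ) := fun x => (Quotient.mk S x).out
  have hr : ∀ x, ∃ z : Fin 2 → ℤ, connected N ω x (r x + (N : ℤ) • z) := fun x =>
    S.symm (Quotient.mk_out (s := S) x)
  choose Z hZ using hr
  have uniq : ∀ x z, connected N ω x (r x + (N : ℤ) • z) →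
      l 0 * z 0 + l 1 * z 1 = l 0 * Z x 0 + l 1 * Z x 1 := by
    intro x z h
    have h1 := connected_trans (connected_symm (hZ x)) h
    have h2 := hl (z - Z x) ⟨r x + (N : ℤ) • Z x, by simpa [add_assoc, smul_sub] using h1⟩
    simp only [Pi.sub_apply] at h2
    linarith
  have req : ∀ x y, S.r x y → r x = r y := by
    intro x y h
    have : (Quotient.mk S x) = Quotient.mk S y := Quotient.sound h
    simp only [r, this]
  refine ⟨fun x => l 0 * Z x 0 + l 1 * Z x 1, ?_, ?_⟩
  · intro x z
    have e : r (x + (N : ℤ) • z) = r x := req _ _ ⟨z, Relation.ReflTransGen.refl⟩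
    have h1 := connected_shift z (hZ x)
    have := uniq (x + (N : ℤ) • z) (Z x + z) (by
      rw [e]; simpa [add_assoc, smul_add] using h1)
    simp only [Pi.add_apply] at this
    linarith
  · intro x y h
    have e : r x = r y := req _ _ ⟨0, by simpa using connected_single h⟩
    exact (uniq x (Z y) (by
      rw [e]; exact Relation.ReflTransGen.head h (hZ y))).symm

lemma vec_eq (x : Fin 2 → ℤ) : x = ![x 0, x 1] := by
  ext i; fin_cases i <;> rfl

/-- Discrete Stokes on the torus. -/
lemma stokes (N : ℕ) (l1 l2 m1 m2 : ℤ) (H G C : ℤ → ℤ → ℤ)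
    (hH1 : ∀ i j, H (i + N) j = H i j + l1) (hH2 : ∀ i j, H i (j + N) = H i j + l2)
    (hG1 : ∀ i j, G (i + N) j = G i j + m1) (hG2 : ∀ i j, G i (j + N) = G i j + m2)
    (hC1 : ∀ i j, C (i + N) j = C i j) (hC2 : ∀ i j, C i (j + N) = C i j)
    (T : ∀ i j, 
      let W := fun (a b : ℤ × ℤ) => H a.1 a.2 * G b.1 b.2 - H b.1 b.2 * G a.1 a.2
        - (C a.1 a.2 - C b.1 b.2) * (H a.1 a.2 - H b.1 b.2) * (G a.1 a.2 - G b.1 b.2)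
      W (i, j) (i+1, j) + W (i+1, j) (i+1, j+1) + W (i+1, j+1) (i, j) = 0 ∧
      W (i, j) (i+1, j+1) + W (i+1, j+1) (i, j+1) + W (i, j+1) (i, j) = 0) :
    l1 * m2 - l2 * m1 = 0 := by
  set W := fun (a b : ℤ × ℤ) => H a.1 a.2 * G b.1 b.2 - H b.1 b.2 * G a.1 a.2
        - (C a.1 a.2 - C b.1 b.2) * (H a.1 a.2 - H b.1 b.2) * (G a.1 a.2 - G b.1 b.2) with hW
  have anti : ∀ a b, W a b = - W b a := by intro a b; simp only [hW]; ring
  have sq : ∀ i j : ℤ, (W (i, j) (i+1, j) - W (i, j+1) (i+1, j+1))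
      + (W (i+1, j) (i+1, j+1) - W (i, j) (i, j+1)) = 0 := by
    intro i j
    have h := T i j
    simp only at h
    have h1 := h.1
    have h2 := h.2
    have e1 := anti (i+1, j+1) (i, j)
    have e2 := anti (i+1, j+1) (i, j+1)
    have e3 := anti (i, j+1) (i, j)
    simp only [hW] at *
    linarith
  have tot : ∑ i ∈ Finset.range N, ∑ j ∈ Finset.range N,
      ((W ((i:ℤ), (j:ℤ)) (i+1, j) - W (i, j+1) (i+1, j+1))
      + (W (i+1, j) (i+1, j+1) - W (i, j) (i, j+1))) = 0 :=
    Finset.sum_eq_zero (fun i _ => Finset.sum_eq_zero (fun j _ => sq i j))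
  simp only [Finset.sum_add_distrib] at tot
  have t1 : ∀ i : ℤ, ∑ j ∈ Finset.range N, (W (i, (j:ℤ)) (i+1, j) - W (i, j+1) (i+1, j+1))
      = m2 * (H (i+1) 0 - H i 0) - l2 * (G (i+1) 0 - G i 0) := by
    intro i
    have := Finset.sum_range_sub' (fun j : ℕ => W (i, (j:ℤ)) (i+1, j)) N
    push_cast at this
    rw [this]
    have a1 := hH2 i 0
    have a2 := hH2 (i+1) 0
    have a3 := hG2 i 0
    have a4 := hG2 (i+1) 0
    have a5 := hC2 i 0
    have a6 := hC2 (i+1) 0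
    rw [zero_add] at a1 a2 a3 a4 a5 a6
    simp only [hW, a1, a2, a3, a4, a5, a6]
    ring
  have t2 : ∀ j : ℤ, ∑ i ∈ Finset.range N, (W ((i:ℤ)+1, j) (i+1, j+1) - W (i, j) (i, j+1))
      = l1 * (G 0 (j+1) - G 0 j) - m1 * (H 0 (j+1) - H 0 j) := by
    intro j
    have := Finset.sum_range_sub (fun i : ℕ => W ((i:ℤ), j) (i, j+1)) N
    push_cast at this
    rw [this]
    have a1 := hH1 0 j
    have a2 := hH1 0 (j+1)
    have a3 := hG1 0 j
    have a4 := hG1 0 (j+1)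
    have a5 := hC1 0 j
    have a6 := hC1 0 (j+1)
    rw [zero_add] at a1 a2 a3 a4 a5 a6
    simp only [hW, a1, a2, a3, a4, a5, a6]
    ring
  rw [Finset.sum_comm (f := fun i j : ℕ => (W ((i:ℤ)+1, (j:ℤ)) (i+1, j+1) - W (i, j) (i, j+1)))]
    at tot
  simp only [t1, t2, Finset.sum_sub_distrib, ← Finset.mul_sum] at tot
  have s1 := Finset.sum_range_sub (fun i : ℕ => H (i:ℤ) 0) N
  have s2 := Finset.sum_range_sub (fun i : ℕ => G (i:ℤ) 0) N
  have s3 := Finset.sum_range_sub (fun j : ℕ => G 0 (j:ℤ)) N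
  have s4 := Finset.sum_range_sub (fun j : ℕ => H 0 (j:ℤ)) N
  push_cast at s1 s2 s3 s4
  have b1 := hH1 0 0
  have b2 := hG1 0 0
  have b3 := hG2 0 0
  have b4 := hH2 0 0
  rw [zero_add] at b1 b2 b3 b4
  rw [Finset.sum_sub_distrib] at s1 s2 s3 s4
  rw [s1, s2, s3, s4, b1, b2, b3, b4] at tot
  linarith

lemma tri_open_closed (ha hb hc ga gb gc : ℤ) (a b c : Bool)
    (Hab : a = b → ha = hb) (Hbc : b = c → hb = hc) (Hca : c = a → hc = ha)
    (Gab : a = false → b = false → ga = gb) (Gbc : b = false → c = false → gb = gc)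
    (Gca : c = false → a = false → gc = ga) :
    let χ := fun b : Bool => if b then (1:ℤ) else 0
    (ha * gb - hb * ga - (χ a - χ b) * (ha - hb) * (ga - gb))
    + (hb * gc - hc * gb - (χ b - χ c) * (hb - hc) * (gb - gc))
    + (hc * ga - ha * gc - (χ c - χ a) * (hc - ha) * (gc - ga)) = 0 := by
  cases a <;> cases b <;> cases c <;> simp at * <;> subst_vars <;> ring

/-- Complement configuration. -/
def cc {N : ℕ} (ω : Config N) : Config N := fun v => !(ω v)

/-- If closed sites have no giant cycle then a functional killing all open windings is zero. -/
lemma dual1 (N : ℕ) (hN : 0 < N) (ω : Config N) (hA : cc ω ∉ giantEvent N) (l m : Fin 2 → ℤ)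
    (hl : ∀ w ∈ winding N ω, l 0 * w 0 + l 1 * w 1 = 0) : l 0 * m 1 - l 1 * m 0 = 0 := by
  have hNz : (N : ℤ) ≠ 0 := by exact_mod_cast hN.ne'
  have hcw : ∀ w ∈ winding N (cc ω), w = 0 := by
    rintro w ⟨x, hx⟩
    by_contra hw
    apply hA
    refine ⟨x, x + (N : ℤ) • w, ?_, (proj_shift N x w).symm, hx⟩
    intro h
    apply hw
    have : (N : ℤ) • w = 0 := by simpa using h
    exact (smul_eq_zero.1 this).resolve_left hNz
  have h00 : ∀ w ∈ winding N (fun _ => false), w = 0 := by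
    rintro w ⟨x, hx⟩
    rcases Relation.ReflTransGen.cases_head hx with h | ⟨y, h, _⟩
    · have : (N : ℤ) • w = 0 := by simpa using h
      exact (smul_eq_zero.1 this).resolve_left hNz
    · simp [step, siteOpen] at h
  obtain ⟨H1, H1p, H1c⟩ := exists_height N ω l hl
  obtain ⟨H2, H2p, H2c⟩ := exists_height N (cc ω) l (by intro w hw; simp [hcw w hw])
  obtain ⟨G1, G1p, -⟩ := exists_height N (fun _ => false) m (by intro w hw; simp [h00 w hw])
  obtain ⟨G2, G2p, G2c⟩ := exists_height N (cc ω) m (by intro w hw; simp [hcw w hw])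
  let o : (Fin 2 → ℤ) → Bool := fun x => ω (proj N x)
  have op : ∀ x z, o (x + (N : ℤ) • z) = o x := by intro x z; simp only [o, proj_shift]
  let H : (Fin 2 → ℤ) → ℤ := fun x => if o x then H1 x else H2 x
  let G : (Fin 2 → ℤ) → ℤ := fun x => if o x then G1 x else G2 x
  have Hp : ∀ x z, H (x + (N : ℤ) • z) = H x + (l 0 * z 0 + l 1 * z 1) := by
    intro x z; simp only [H, op, H1p, H2p]; split_ifs <;> rfl
  have Gp : ∀ x z, G (x + (N : ℤ) • z) = G x + (m 0 * z 0 + m 1 * z 1) := by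
    intro x z; simp only [G, op, G1p, G2p]; split_ifs <;> rfl
  have Hc : ∀ x y, adj x y → o x = o y → H x = H y := by
    intro x y h hxy
    simp only [H, hxy]
    cases hy : o y
    · simp only [Bool.false_eq_true, if_false]
      rw [hy] at hxy
      exact H2c x y ⟨h, by simpa [siteOpen, cc] using hxy, by simpa [siteOpen, cc] using hy⟩
    · simp only [if_true]
      rw [hy] at hxy
      exact H1c x y ⟨h, hxy, hy⟩
  have Gc : ∀ x y, adj x y → o x = false → o y = false → G x = G y := by
    intro x y h hx hy
    simp only [G, hx, hy, Bool.false_eq_true, if_false]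
    exact G2c x y ⟨h, by simpa [siteOpen, cc] using hx, by simpa [siteOpen, cc] using hy⟩
  have sh1 : ∀ i j : ℤ, ![i + N, j] = ![i, j] + (N : ℤ) • ![1, 0] := by
    intro i j; ext k; fin_cases k <;> simp
  have sh2 : ∀ i j : ℤ, ![i, j + N] = ![i, j] + (N : ℤ) • ![0, 1] := by
    intro i j; ext k; fin_cases k <;> simp
  refine stokes N (l 0) (l 1) (m 0) (m 1) (fun i j => H ![i, j]) (fun i j => G ![i, j])
    (fun i j => if o ![i, j] then 1 else 0) ?_ ?_ ?_ ?_ ?_ ?_ ?_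
  · intro i j; rw [sh1, Hp]; simp
  · intro i j; rw [sh2, Hp]; simp
  · intro i j; rw [sh1, Gp]; simp
  · intro i j; rw [sh2, Gp]; simp
  · intro i j; rw [sh1, op]
  · intro i j; rw [sh2, op]
  · intro i j
    have key : ∀ a b c : Fin 2 → ℤ, adj a b → adj b c → adj c a → _ := fun a b c h1 h2 h3 =>
      tri_open_closed (H a) (H b) (H c) (G a) (G b) (G c) (o a) (o b) (o c)
        (Hc a b h1) (Hc b c h2) (Hc c a h3) (Gc a b h1) (Gc b c h2) (Gc c a h3)
    refine ⟨key ![i, j] ![i+1, j] ![i+1, j+1] ?_ ?_ ?_,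
      key ![i, j] ![i+1, j+1] ![i, j+1] ?_ ?_ ?_⟩ <;> rw [adj_iff] <;> simp

end Topology

end TriSite
namespace TriSite

section Crossing

/-- Signed crossing number of the edge `(a,b) → (c,d)` with the ray just below the positive
horizontal axis. -/
def cr (a b c d : ℤ) : ℤ :=
  if b < 0 ∧ 0 ≤ d ∧ 1 ≤ c then 1 else if 0 ≤ b ∧ d < 0 ∧ 1 ≤ a then -1 else 0

/-- Unit steps in coordinates. -/
def unit (a b : ℤ) : Prop := (a = 1 ∧ b = 0) ∨ (a = -1 ∧ b = 0) ∨ (a = 0 ∧ b = 1) ∨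
  (a = 0 ∧ b = -1) ∨ (a = 1 ∧ b = 1) ∨ (a = -1 ∧ b = -1)

set_option maxHeartbeats 4000000 in
lemma cr_cocycle (x y a b c d : ℤ) (h1 : unit a b) (h2 : unit c d) (n1 : ¬ (x = 0 ∧ y = 0))
    (n2 : ¬ (x + a = 0 ∧ y + b = 0)) (n3 : ¬ (x + c = 0 ∧ y + d = 0))
    (n4 : ¬ (x + a + c = 0 ∧ y + b + d = 0)) :
    cr x y (x + a) (y + b) - cr (x + c) (y + d) (x + a + c) (y + b + d)
      = cr x y (x + c) (y + d) - cr (x + a) (y + b) (x + a + c) (y + b + d) := by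
  unfold cr
  rcases h1 with ⟨rfl, rfl⟩ | ⟨rfl, rfl⟩ | ⟨rfl, rfl⟩ | ⟨rfl, rfl⟩ | ⟨rfl, rfl⟩ | ⟨rfl, rfl⟩ <;>
  rcases h2 with ⟨rfl, rfl⟩ | ⟨rfl, rfl⟩ | ⟨rfl, rfl⟩ | ⟨rfl, rfl⟩ | ⟨rfl, rfl⟩ | ⟨rfl, rfl⟩ <;>
  split_ifs <;> omega

lemma unit_of_adj {x y : Fin 2 → ℤ} (h : adj x y) : unit (y 0 - x 0) (y 1 - x 1) :=
  (adj_iff x y).1 h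

/-- Crossing number of a path with a ray from `p`. -/
def Phi (v : ℕ → Fin 2 → ℤ) (n : ℕ) (p : Fin 2 → ℤ) : ℤ :=
  ∑ i ∈ Finset.range n, cr (v i 0 - p 0) (v i 1 - p 1) (v (i + 1) 0 - p 0) (v (i + 1) 1 - p 1)

lemma Phi_step (v : ℕ → Fin 2 → ℤ) (n : ℕ) (p p' : Fin 2 → ℤ)
    (hv : ∀ i < n, adj (v i) (v (i + 1))) (hp : adj p' p)
    (hd : ∀ i ≤ n, v i ≠ p) (hd' : ∀ i ≤ n, v i ≠ p')
    (hb : v 0 1 < p 1) (hb' : v 0 1 < p' 1) (ht : p 1 ≤ v n 1) (ht' : p' 1 ≤ v n 1) :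
    Phi v n p = Phi v n p' := by
  have ne : ∀ x y : Fin 2 → ℤ, x ≠ y → ¬ (x 0 - y 0 = 0 ∧ x 1 - y 1 = 0) := by
    intro x y h h'
    apply h; ext k; fin_cases k <;> simp <;> omega
  let κ : ℕ → ℤ := fun i => cr (v i 0 - p 0) (v i 1 - p 1) (v i 0 - p' 0) (v i 1 - p' 1)
  have h : Phi v n p - Phi v n p' = ∑ i ∈ Finset.range n, (κ i - κ (i + 1)) := by
    unfold Phi
    rw [← Finset.sum_sub_distrib]
    apply Finset.sum_congr rfl
    intro i hi
    have hi := Finset.mem_range.1 hi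
    have := cr_cocycle (v i 0 - p 0) (v i 1 - p 1) (v (i+1) 0 - v i 0) (v (i+1) 1 - v i 1)
      (p 0 - p' 0) (p 1 - p' 1) (unit_of_adj (hv i hi)) (unit_of_adj hp)
      (ne _ _ (hd i hi.le))
      (by have := ne _ _ (hd (i+1) hi); omega)
      (by have := ne _ _ (hd' i hi.le); omega)
      (by have := ne _ _ (hd' (i+1) hi); omega)
    simp only [κ]
    convert this using 2 <;> congr 1 <;> ring
  rw [Finset.sum_range_sub'] at h
  have k0 : κ 0 = 0 := by simp only [κ, cr]; split_ifs <;> omega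
  have kn : κ n = 0 := by simp only [κ, cr]; split_ifs <;> omega
  linarith

lemma Phi_right (v : ℕ → Fin 2 → ℤ) (n : ℕ) (p : Fin 2 → ℤ)
    (hv : ∀ i < n, adj (v i) (v (i + 1)))
    (h : ∀ i ≤ n, v i 1 = p 1 → v i 0 ≤ p 0) : Phi v n p = 0 := by
  apply Finset.sum_eq_zero
  intro i hi
  have hi := Finset.mem_range.1 hi
  have h1 := h i hi.le
  have h2 := h (i + 1) hi
  have h3 := unit_of_adj (hv i hi)
  unfold unit at h3
  unfold cr
  split_ifs <;> omega

lemma Phi_left (v : ℕ → Fin 2 → ℤ) (n : ℕ) (p : Fin 2 → ℤ)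
    (hv : ∀ i < n, adj (v i) (v (i + 1))) (hb : v 0 1 < p 1) (ht : p 1 ≤ v n 1)
    (h : ∀ i ≤ n, v i 1 = p 1 → p 0 < v i 0) : Phi v n p = 1 := by
  have e : Phi v n p = ∑ i ∈ Finset.range n,
      ((if p 1 ≤ v (i + 1) 1 then (1:ℤ) else 0) - (if p 1 ≤ v i 1 then (1:ℤ) else 0)) := by
    apply Finset.sum_congr rfl
    intro i hi
    have hi := Finset.mem_range.1 hi
    have h1 := h i hi.le
    have h2 := h (i + 1) hi
    have h3 := unit_of_adj (hv i hi)
    unfold unit at h3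
    unfold cr
    split_ifs <;> omega
  rw [e, Finset.sum_range_sub (fun i => if p 1 ≤ v i 1 then (1:ℤ) else 0)]
  rw [if_pos ht, if_neg (by omega)]; rfl

lemma exists_seq {α : Type*} {r : α → α → Prop} {a b : α} (h : Relation.ReflTransGen r a b) :
    ∃ (n : ℕ) (v : ℕ → α), v 0 = a ∧ v n = b ∧ ∀ i < n, r (v i) (v (i + 1)) := by
  induction h with
  | refl => exact ⟨0, fun _ => a, rfl, rfl, by simp⟩
  | tail _ hs ih =>
    rename_i b' c _
    obtain ⟨n, v, h0, hn, hv⟩ := ih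
    refine ⟨n + 1, fun i => if i ≤ n then v i else c, by simp [h0], by simp, ?_⟩
    intro i hi
    rcases Nat.lt_succ_iff_lt_or_eq.1 hi with h | h
    · simp only [h.le, if_true, Nat.succ_le_of_lt h]; exact hv i h
    · subst h; simp [hn, hs]

/-- Paths come with bounds. -/
lemma exists_bound {α : Type*} {r : α → α → Prop} {a b : α} (φ : α → ℤ)
    (h : Relation.ReflTransGen r a b) :
    ∃ M : ℤ, Relation.ReflTransGen (fun x y => r x y ∧ |φ x| ≤ M ∧ |φ y| ≤ M) a b := by
  induction h with
  | refl => exact ⟨0, Relation.ReflTransGen.refl⟩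
  | tail _ hs ih =>
    rename_i b' c _
    obtain ⟨M, hM⟩ := ih
    refine ⟨max M (max |φ b'| |φ c|), ?_⟩
    refine Relation.ReflTransGen.tail (b := b') ?_ ⟨hs, by simp, by simp⟩
    refine Relation.ReflTransGen.mono ?_ _ _ hM
    rintro x y ⟨h1, h2, h3⟩
    exact ⟨h1, h2.trans (le_max_left _ _), h3.trans (le_max_left _ _)⟩

lemma iterate_path {r : (Fin 2 → ℤ) → (Fin 2 → ℤ) → Prop} {a z : Fin 2 → ℤ}
    (hr : ∀ (k : ℤ) x y, r x y → r (x + k • z) (y + k • z))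
    (h : Relation.ReflTransGen r a (a + z)) (k : ℤ) (n : ℕ) :
    Relation.ReflTransGen r (a + k • z) (a + (k + n) • z) := by
  have sh : ∀ (k : ℤ), Relation.ReflTransGen r (a + k • z) (a + z + k • z) := by
    intro k
    have : ∀ {b}, Relation.ReflTransGen r a b →
        Relation.ReflTransGen r (a + k • z) (b + k • z) := by
      intro b hb
      induction hb with
      | refl => exact Relation.ReflTransGen.refl
      | tail _ hs ih => exact Relation.ReflTransGen.tail ih (hr k _ _ hs)
    exact this h
  induction n with
  | zero => simpa using Relation.ReflTransGen.refl
  | succ n ih =>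
    refine Relation.ReflTransGen.trans ih ?_
    have := sh (k + n)
    have e : a + z + (k + (n:ℤ)) • z = a + (k + ((n + 1 : ℕ) : ℤ)) • z := by
      push_cast; rw [← add_assoc, add_smul _ (1:ℤ) z, one_smul]; abel
    rwa [e] at this

lemma step_shift {N : ℕ} {ω : Config N} (z : Fin 2 → ℤ) {x y : Fin 2 → ℤ}
    (h : step N ω x y) : step N ω (x + (N : ℤ) • z) (y + (N : ℤ) • z) := by
  refine ⟨?_, ?_, ?_⟩
  · simpa [adj] using h.1
  · unfold siteOpen; rw [proj_shift]; exact h.2.1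
  · unfold siteOpen; rw [proj_shift]; exact h.2.2

/-- Main crossing lemma, normalised signs. -/
lemma cross_aux {N : ℕ} (hN : 0 < N) {ω ω' : Config N}
    (hdis : ∀ v, ω v = true → ω' v = true → False) {a b u w : Fin 2 → ℤ}
    (hu : connected N ω a (a + (N : ℤ) • u)) (hw : connected N ω' b (b + (N : ℤ) • w))
    (hw1 : 0 < w 1) (hD : 0 < w 1 * u 0 - w 0 * u 1) : False := by
  have hN1 : (1 : ℤ) ≤ N := by exact_mod_cast hN
  let φ : (Fin 2 → ℤ) → ℤ := fun x => w 1 * x 0 - w 0 * x 1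
  obtain ⟨M, hM⟩ := exists_bound φ hw
  -- choose k
  set k : ℕ := (M + |φ a| + 1).toNat + 1 with hk
  have hkM : M + |φ a| + 1 ≤ k := by
    rw [hk]; push_cast; have := Int.self_le_toNat (M + |φ a| + 1); linarith
  have hkpos : (1 : ℤ) ≤ k := by rw [hk]; push_cast; omega
  -- open path
  have hopen := iterate_path (r := step N ω) (a := a) (z := (N : ℤ) • u)
    (fun k x y h => by
      have := step_shift (k • u) h
      rwa [smul_comm] at this) hu (-k) (2 * k)
  obtain ⟨Y, hY⟩ := exists_bound (fun x => x 1) hopen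
  obtain ⟨m, q, q0, qm, hq⟩ := exists_seq hY
  -- closed path
  set K : ℕ := (|b 1| + |Y| + 1).toNat + 1 with hK
  have hKY : |b 1| + |Y| + 1 ≤ K := by
    rw [hK]; push_cast; have := Int.self_le_toNat (|b 1| + |Y| + 1); linarith
  have hclosed := iterate_path (a := b) (z := (N : ℤ) • w)
    (r := fun x y => step N ω' x y ∧ |φ x| ≤ M ∧ |φ y| ≤ M)
    (fun k x y h => by
      have h1 := step_shift (k • w) h.1
      rw [smul_comm] at h1
      have e : ∀ x, φ (x + k • (N : ℤ) • w) = φ x := by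
        intro x; simp only [φ, Pi.add_apply, Pi.smul_apply, smul_eq_mul]; ring
      exact ⟨h1, by rw [e]; exact h.2.1, by rw [e]; exact h.2.2⟩) hM (-K) (2 * K)
  obtain ⟨n, v, v0, vn, hv⟩ := exists_seq hclosed
  have hNw : 1 ≤ (N : ℤ) * w 1 := by nlinarith
  have hND : 1 ≤ (N : ℤ) * (w 1 * u 0 - w 0 * u 1) := by nlinarith
  have v0y : v 0 1 < - |Y| := by
    rw [v0]; simp only [Pi.add_apply, Pi.smul_apply, smul_eq_mul]
    nlinarith [le_abs_self (b 1), abs_nonneg Y, abs_nonneg (b 1)]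
  have vny : |Y| < v n 1 := by
    rw [vn]; simp only [Pi.add_apply, Pi.smul_apply, smul_eq_mul]
    push_cast
    nlinarith [neg_abs_le (b 1), abs_nonneg Y, abs_nonneg (b 1)]
  have hn : 0 < n := by
    rcases Nat.eq_zero_or_pos n with h | h
    · subst h; have := abs_nonneg Y; omega
    · exact h
  have hm : 0 < m := by
    rcases Nat.eq_zero_or_pos m with h | h
    · subst h
      rw [q0] at qm
      have := congrArg φ qm
      simp only [φ, Pi.add_apply, Pi.smul_apply, smul_eq_mul] at this
      push_cast at this
      nlinarith
    · exact h
  have hend : ∀ {α : Type} {r : α → α → Prop} {P : α → Prop} {n : ℕ} {v : ℕ → α}, 0 < n →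
      (∀ i < n, r (v i) (v (i+1))) → (∀ x y, r x y → P x ∧ P y) → ∀ i ≤ n, P (v i) := by
    intro α r P n v hn hv hP i hi
    rcases hi.lt_or_eq with h | h
    · exact (hP _ _ (hv i h)).1
    · obtain ⟨j, rfl⟩ := Nat.exists_eq_succ_of_ne_zero hn.ne'
      rw [h]; exact (hP _ _ (hv j (Nat.lt_succ_self j))).2
  have vprop : ∀ i ≤ n, siteOpen N ω' (v i) ∧ |φ (v i)| ≤ M :=
    hend (r := fun x y => step N ω' x y ∧ |φ x| ≤ M ∧ |φ y| ≤ M)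
      (P := fun x => siteOpen N ω' x ∧ |φ x| ≤ M) hn hv
      (fun x y h => ⟨⟨h.1.2.1, h.2.1⟩, ⟨h.1.2.2, h.2.2⟩⟩)
  have qprop : ∀ i ≤ m, siteOpen N ω (q i) ∧ |q i 1| ≤ Y :=
    hend (r := fun x y => step N ω x y ∧ |x 1| ≤ Y ∧ |y 1| ≤ Y)
      (P := fun x => siteOpen N ω x ∧ |x 1| ≤ Y) hm hq
      (fun x y h => ⟨⟨h.1.2.1, h.2.1⟩, ⟨h.1.2.2, h.2.2⟩⟩)
  have hvadj : ∀ i < n, adj (v i) (v (i+1)) := fun i hi => (hv i hi).1.1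
  have hne : ∀ i ≤ n, ∀ j ≤ m, v i ≠ q j := by
    intro i hi j hj e
    have h1 := (vprop i hi).1
    have h2 := (qprop j hj).1
    rw [e] at h1
    exact hdis _ h2 h1
  have qb : ∀ j ≤ m, v 0 1 < q j 1 ∧ q j 1 ≤ v n 1 := by
    intro j hj
    have h1 := abs_le.1 (qprop j hj).2
    have := le_abs_self Y
    omega
  have hconst : ∀ j ≤ m, Phi v n (q j) = Phi v n (q 0) := by
    intro j
    induction j with
    | zero => intro _; rfl
    | succ j ih =>
      intro hj
      rw [← ih (by omega)]
      apply Phi_step v n _ _ hvadj (hq j (by omega)).1.1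
      · exact fun i hi => hne i hi _ hj
      · exact fun i hi => hne i hi _ (by omega)
      · exact (qb _ hj).1
      · exact (qb _ (by omega)).1
      · exact (qb _ hj).2
      · exact (qb _ (by omega)).2
  have hr : Phi v n (q m) = 0 := by
    apply Phi_right v n _ hvadj
    intro i hi hy
    by_contra hx
    push Not at hx
    have h1 := (abs_le.1 (vprop i hi).2).2
    have h2 : φ (q m) = φ a + k * (N * (w 1 * u 0 - w 0 * u 1)) := by
      rw [qm]; simp only [φ, Pi.add_apply, Pi.smul_apply, smul_eq_mul]; push_cast; ring
    have h3 : φ (q m) < φ (v i) := by simp only [φ, hy]; nlinarith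
    have h4 := neg_abs_le (φ a)
    nlinarith
  have hl : Phi v n (q 0) = 1 := by
    apply Phi_left v n _ hvadj (qb 0 (by omega)).1 (qb 0 (by omega)).2
    intro i hi hy
    by_contra hx
    push Not at hx
    have h1 := (abs_le.1 (vprop i hi).2).1
    have h2 : φ (q 0) = φ a - k * (N * (w 1 * u 0 - w 0 * u 1)) := by
      rw [q0]; simp only [φ, Pi.add_apply, Pi.smul_apply, smul_eq_mul]; ring
    have h3 : φ (v i) ≤ φ (q 0) := by simp only [φ, hy]; nlinarith
    have h4 := le_abs_self (φ a)
    nlinarith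
  have := hconst m le_rfl
  omega

lemma winding_neg {N : ℕ} {ω : Config N} {w : Fin 2 → ℤ} (h : w ∈ winding N ω) :
    -w ∈ winding N ω := by
  obtain ⟨x, hx⟩ := h
  refine ⟨x + (N : ℤ) • w, ?_⟩
  have := connected_symm hx
  simpa [add_assoc] using this

lemma cross_aux2 {N : ℕ} (hN : 0 < N) {ω ω' : Config N}
    (hdis : ∀ v, ω v = true → ω' v = true → False) {u w : Fin 2 → ℤ}
    (hu : u ∈ winding N ω) (hw : w ∈ winding N ω')
    (hw1 : w 1 ≠ 0) (hD : w 1 * u 0 - w 0 * u 1 ≠ 0) : False := by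
  have main : ∀ u w : Fin 2 → ℤ, u ∈ winding N ω → w ∈ winding N ω' →
      0 < w 1 → w 1 * u 0 - w 0 * u 1 ≠ 0 → False := by
    intro u w hu hw h1 h2
    obtain ⟨b, hb⟩ := hw
    rcases lt_or_gt_of_ne h2 with h | h
    · obtain ⟨a, ha⟩ := winding_neg hu
      exact cross_aux hN hdis ha hb h1 (by simp only [Pi.neg_apply]; linarith)
    · obtain ⟨a, ha⟩ := hu
      exact cross_aux hN hdis ha hb h1 h
  rcases lt_or_gt_of_ne hw1 with h | h
  · exact main u (-w) hu (winding_neg hw) (by simpa using h)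
      (by simp only [Pi.neg_apply]; intro h; apply hD; linarith)
  · exact main u w hu hw h hD

lemma cross {N : ℕ} (hN : 0 < N) {ω ω' : Config N}
    (hdis : ∀ v, ω v = true → ω' v = true → False) {u w : Fin 2 → ℤ}
    (hu : u ∈ winding N ω) (hw : w ∈ winding N ω')
    (hD : w 1 * u 0 - w 0 * u 1 ≠ 0) : False := by
  by_cases h : w 1 = 0
  · apply cross_aux2 hN (fun v h1 h2 => hdis v h2 h1) hw hu
    · intro h'; apply hD; rw [h, h']; ring
    · intro h'; apply hD; linarith
  · exact cross_aux2 hN hdis hu hw h hD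

end Crossing

end TriSite
namespace TriSite

section Final

open Classical in
/-- Probability of an event on the cube. -/
noncomputable def Pr {V : Type*} [Fintype V] [DecidableEq V] (p : ℝ) (S : Set (V → Bool)) : ℝ :=
  Ex p (fun ω => if ω ∈ S then (1 : ℝ) else 0)

section Abs
variable {V : Type*} [Fintype V] [DecidableEq V]

lemma Pr_mono {p : ℝ} (h0 : 0 ≤ p) (h1 : p ≤ 1) {S T : Set (V → Bool)} (h : S ⊆ T) :
    Pr p S ≤ Pr p T := by
  apply Ex_mono h0 h1
  intro ω
  by_cases hS : ω ∈ S
  · simp [hS, h hS]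
  · simp only [hS, if_false]; split_ifs <;> norm_num

lemma Pr_compl (p : ℝ) (S : Set (V → Bool)) : Pr p Sᶜ = 1 - Pr p S := by
  have h := Ex_const (V := V) p 1
  unfold Pr
  refine Eq.trans ?_ (congrArg (· - _) h)
  rw [← Ex_sub]
  congr 1; ext ω
  by_cases hS : ω ∈ S <;> simp [hS]

lemma Pr_nonneg {p : ℝ} (h0 : 0 ≤ p) (h1 : p ≤ 1) (S : Set (V → Bool)) : 0 ≤ Pr p S :=
  Ex_nonneg h0 h1 (fun ω => by split_ifs <;> norm_num)

lemma Pr_le_one {p : ℝ} (h0 : 0 ≤ p) (h1 : p ≤ 1) (S : Set (V → Bool)) : Pr p S ≤ 1 := by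
  have := Pr_compl p S
  have := Pr_nonneg h0 h1 Sᶜ
  linarith

lemma Pr_inter_union (p : ℝ) (S T : Set (V → Bool)) :
    Pr p (S ∩ T) + Pr p (S ∪ T) = Pr p S + Pr p T := by
  unfold Pr
  rw [← Ex_add, ← Ex_add]
  congr 1; ext ω
  by_cases hS : ω ∈ S <;> by_cases hT : ω ∈ T <;> simp [hS, hT]

lemma ind_mono {S : Set (V → Bool)} (hS : IsUpperSet S) [∀ ω, Decidable (ω ∈ S)] :
    Monotone (fun ω => if ω ∈ S then (1 : ℝ) else 0) := by
  intro a b hab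
  by_cases h : a ∈ S
  · simp [h, hS hab h]
  · simp only [h, if_false]; split_ifs <;> norm_num

lemma harris_union {p : ℝ} (h0 : 0 ≤ p) (h1 : p ≤ 1) {S T : Set (V → Bool)} (hS : IsUpperSet S)
    (hT : IsUpperSet T) : (1 - Pr p S) * (1 - Pr p T) ≤ 1 - Pr p (S ∪ T) := by
  classical
  have h2 : Pr p S * Pr p T ≤ Pr p (S ∩ T) := by
    refine (harris h0 h1 _ _ (fun ω => ?_) (fun ω => ?_) (ind_mono hS) (ind_mono hT)).trans ?_
    · split_ifs <;> norm_num
    · split_ifs <;> norm_num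
    · apply le_of_eq
      unfold Pr
      congr 1; ext ω
      by_cases hS : ω ∈ S <;> by_cases hT : ω ∈ T <;> simp [hS, hT]
  have := Pr_inter_union p S T
  nlinarith

lemma Pr_equiv (p : ℝ) (τ : V ≃ V) (S : Set (V → Bool)) :
    Pr p {ω | (fun v => ω (τ v)) ∈ S} = Pr p S := by
  classical
  exact Ex_equiv p τ (fun ω => if ω ∈ S then (1 : ℝ) else 0)

lemma Pr_cc (p : ℝ) (S : Set (V → Bool)) :
    Pr p {ω | (fun v => !(ω v)) ∈ S} = Pr (1 - p) S := by
  classical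
  exact Ex_compl p (fun ω => if ω ∈ S then (1 : ℝ) else 0)

end Abs

lemma prob_eq (N : ℕ) [NeZero N] (p : ℝ) (S : Set (Config N)) : prob N p S = Pr p S := by
  classical
  unfold prob Pr Ex wt
  have : ∀ ω : Config N, (∏ᶠ v : Fin 2 → ZMod N, (if ω v then p else 1 - p))
      = ∏ v, (if ω v then p else 1 - p) := fun ω => finprod_eq_prod_of_fintype _
  simp only [this]
  rw [finsum_mem_def, finsum_eq_sum_of_fintype]
  apply Finset.sum_congr rfl
  intro ω _
  by_cases h : ω ∈ S <;> simp [h]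

lemma giant_iff {N : ℕ} (hN : 0 < N) (ω : Config N) :
    ω ∈ giantEvent N ↔ ∃ w ∈ winding N ω, w ≠ 0 := by
  constructor
  · rintro ⟨x, y, hne, hp, hc⟩
    have : ∀ i, (N : ℤ) ∣ y i - x i := by
      intro i
      exact (ZMod.intCast_eq_intCast_iff_dvd_sub _ _ _).1 (congrFun hp i)
    choose w hw using this
    have e : x + (N : ℤ) • w = y := by
      ext i; simp only [Pi.add_apply, Pi.smul_apply, smul_eq_mul, ← hw]; ring
    refine ⟨w, ⟨x, by rw [e]; exact hc⟩, ?_⟩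
    rintro rfl
    apply hne; rw [← e]; simp
  · rintro ⟨w, ⟨x, hx⟩, hw⟩
    refine ⟨x, x + (N : ℤ) • w, ?_, (proj_shift N x w).symm, hx⟩
    intro h
    apply hw
    have : (N : ℤ) • w = 0 := by simpa using h
    exact (smul_eq_zero.1 this).resolve_left (by exact_mod_cast hN.ne')

lemma span_of_det {N : ℕ} {ω : Config N} {w w' : Fin 2 → ℤ} (hw : w ∈ winding N ω)
    (hw' : w' ∈ winding N ω) (hd : w 0 * w' 1 - w 1 * w' 0 ≠ 0) : ω ∈ spanEvent N := by
  unfold spanEvent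
  rw [Set.mem_ofPred_eq, eq_top_iff]
  intro v _
  set D : ℚ := (w 0 : ℚ) * w' 1 - w 1 * w' 0 with hD
  have hD0 : D ≠ 0 := by rw [hD]; exact_mod_cast hd
  have e : v = ((v 0 * w' 1 - v 1 * w' 0) / D) • (fun i => (w i : ℚ))
      + ((w 0 * v 1 - w 1 * v 0) / D) • (fun i => (w' i : ℚ)) := by
    ext i
    fin_cases i <;> simp <;> field_simp <;> rw [hD] <;> ring
  rw [e]
  exact Submodule.add_mem _
    (Submodule.smul_mem _ _ (Submodule.subset_span ⟨w, hw, rfl⟩))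
    (Submodule.smul_mem _ _ (Submodule.subset_span ⟨w', hw', rfl⟩))

lemma not_span_of_ker {N : ℕ} {ω : Config N} {l : Fin 2 → ℤ} (hl0 : l ≠ 0)
    (hl : ∀ w ∈ winding N ω, l 0 * w 0 + l 1 * w 1 = 0) : ω ∉ spanEvent N := by
  intro h
  unfold spanEvent at h
  rw [Set.mem_ofPred_eq] at h
  have key : ∀ v ∈ Submodule.span ℚ ((fun w : Fin 2 → ℤ => fun i => (w i : ℚ)) '' winding N ω),
      (l 0 : ℚ) * v 0 + l 1 * v 1 = 0 := by
    intro v hv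
    induction hv using Submodule.span_induction with
    | mem x hx =>
      obtain ⟨w, hw, rfl⟩ := hx
      have := hl w hw
      beta_reduce
      exact_mod_cast this
    | zero => simp
    | add x y _ _ hx hy => simp only [Pi.add_apply]; linarith
    | smul a x _ hx =>
      simp only [Pi.smul_apply, smul_eq_mul]
      linear_combination a * hx
  rw [h] at key
  have h0 := key ![1, 0] trivial
  have h1 := key ![0, 1] trivial
  simp at h0 h1
  apply hl0; ext i; fin_cases i <;> simp [h0, h1]

lemma span_iff {N : ℕ} (ω : Config N) :
    ω ∈ spanEvent N ↔ ∃ w ∈ winding N ω, ∃ w' ∈ winding N ω, w 0 * w' 1 - w 1 * w' 0 ≠ 0 := by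
  constructor
  · intro h
    by_contra! hc
    by_cases hz : ∀ w ∈ winding N ω, w = 0
    · refine not_span_of_ker (l := ![1, 0]) ?_ ?_ h
      · intro e; simpa using congrFun e 0
      · intro w hw; simp [hz w hw]
    · push Not at hz
      obtain ⟨u, hu, hu0⟩ := hz
      refine not_span_of_ker (l := ![-u 1, u 0]) ?_ ?_ h
      · intro e
        apply hu0
        have e0 := congrFun e 0
        have e1 := congrFun e 1
        simp at e0 e1
        ext i; fin_cases i <;> simp [e0, e1]
      · intro w hw
        have := hc u hu w hw
        simp; linarith
  · rintro ⟨w, hw, w', hw', hd⟩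
    exact span_of_det hw hw' hd

lemma giant_of_not_span {N : ℕ} (hN : 0 < N) (ω : Config N) (h : ω ∉ spanEvent N) :
    cc ω ∈ giantEvent N := by
  by_contra hA
  have hd := dual1 N hN ω hA
  apply h
  rw [span_iff]
  by_contra! hc
  by_cases hz : ∀ w ∈ winding N ω, w = 0
  · have := hd ![1, 0] ![0, 1] (fun w hw => by simp [hz w hw])
    simp at this
  · push Not at hz
    obtain ⟨u, hu, hu0⟩ := hz
    have hk : ∀ w ∈ winding N ω, (![-u 1, u 0] : Fin 2 → ℤ) 0 * w 0
        + (![-u 1, u 0] : Fin 2 → ℤ) 1 * w 1 = 0 := by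
      intro w hw
      have := hc u hu w hw
      simp; linarith
    have h1 := hd ![-u 1, u 0] ![1, 0] hk
    have h2 := hd ![-u 1, u 0] ![0, 1] hk
    simp at h1 h2
    apply hu0; ext i; fin_cases i <;> simp [h1, h2]

lemma not_giant_of_span {N : ℕ} (hN : 0 < N) (ω : Config N) (h : ω ∈ spanEvent N) :
    cc ω ∉ giantEvent N := by
  rw [giant_iff hN]
  rintro ⟨z, hz, hz0⟩
  obtain ⟨w, hw, w', hw', hd⟩ := (span_iff ω).1 h
  have hdis : ∀ v, ω v = true → cc ω v = true → False := by
    intro v h1 h2; simp [cc, h1] at h2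
  have c1 : z 1 * w 0 - z 0 * w 1 = 0 := by
    by_contra hne; exact cross hN hdis hw hz hne
  have c2 : z 1 * w' 0 - z 0 * w' 1 = 0 := by
    by_contra hne; exact cross hN hdis hw' hz hne
  have e0 : z 0 * (w 0 * w' 1 - w 1 * w' 0) = 0 := by
    linear_combination w' 0 * c1 - w 0 * c2
  have e1 : z 1 * (w 0 * w' 1 - w 1 * w' 0) = 0 := by
    linear_combination w' 1 * c1 - w 1 * c2
  have f0 := (mul_eq_zero.1 e0).resolve_right hd
  have f1 := (mul_eq_zero.1 e1).resolve_right hd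
  apply hz0; ext i; fin_cases i <;> simp [f0, f1]

lemma winding_mono {N : ℕ} {ω ω' : Config N} (h : ω ≤ ω') : winding N ω ⊆ winding N ω' := by
  rintro w ⟨x, hx⟩
  refine ⟨x, step_map id (fun _ _ h => h) (fun x hx => ?_) hx⟩
  have := h (proj N x)
  unfold siteOpen at *
  rw [hx] at this
  exact this rfl

/-- The event that some winding lies in `C`. -/
def wEvent (N : ℕ) (C : Set (Fin 2 → ℤ)) : Set (Config N) := {ω | ∃ w ∈ winding N ω, w ∈ C}

lemma wEvent_upper (N : ℕ) (C : Set (Fin 2 → ℤ)) : IsUpperSet (wEvent N C) := by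
  rintro a b hab ⟨w, hw, hC⟩
  exact ⟨w, winding_mono hab hw, hC⟩

lemma giant_eq {N : ℕ} (hN : 0 < N) : giantEvent N = wEvent N {w | w ≠ 0} := by
  ext ω; exact giant_iff hN ω

/-- Translations preserve windings. -/
lemma winding_trans {N : ℕ} [NeZero N] (a : Fin 2 → ZMod N) (ω : Config N) :
    winding N (fun v => ω (v + a)) ⊆ winding N ω := by
  rintro w ⟨x, hx⟩
  have hla : ∀ x, proj N (x + fun i => ((a i).val : ℤ)) = proj N x + a := by
    intro x; ext i; simp [proj]
  refine ⟨x + fun i => ((a i).val : ℤ), ?_⟩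
  have := step_map (ω' := ω) (fun x => x + fun i => ((a i).val : ℤ)) (fun x y h => ?_)
    (fun x hx => ?_) hx
  · convert this using 1; exact add_right_comm _ _ _
  · unfold adj at *; simpa using h
  · unfold siteOpen at *; rw [hla]; exact hx

lemma wEvent_trans {N : ℕ} [NeZero N] (a : Fin 2 → ZMod N) (C : Set (Fin 2 → ℤ)) (ω : Config N) :
    (fun v => ω (v + a)) ∈ wEvent N C ↔ ω ∈ wEvent N C := by
  constructor
  · rintro ⟨w, hw, hC⟩; exact ⟨w, winding_trans a ω hw, hC⟩
  · rintro ⟨w, hw, hC⟩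
    refine ⟨w, winding_trans (-a) _ ?_, hC⟩
    simpa using hw

/-- Rotation by sixty degrees. -/
def rot {R : Type*} [AddCommGroup R] : (Fin 2 → R) ≃ (Fin 2 → R) where
  toFun v := ![v 0 - v 1, v 0]
  invFun v := ![v 1, v 1 - v 0]
  left_inv v := by ext i; fin_cases i <;> simp
  right_inv v := by ext i; fin_cases i <;> simp

lemma winding_rot {N : ℕ} (ω : Config N) {w : Fin 2 → ℤ}
    (h : w ∈ winding N (fun v => ω (rot v))) : rot w ∈ winding N ω := by
  obtain ⟨x, hx⟩ := h
  refine ⟨rot x, ?_⟩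
  have := step_map (ω' := ω) (fun x => rot x) (fun x y h => ?_) (fun x hx => ?_) hx
  · convert this using 1
    ext i; fin_cases i <;> simp [rot] <;> ring
  · rw [adj_iff] at *; simp only [rot, Equiv.coe_fn_mk]; simp; omega
  · unfold siteOpen at *
    have e : proj N (rot x) = rot (proj N x) := by
      ext i; fin_cases i <;> simp [rot, proj]
    rw [e]; exact hx

lemma Pr_rot {N : ℕ} [NeZero N] {p : ℝ} (h0 : 0 ≤ p) (h1 : p ≤ 1) {C C' : Set (Fin 2 → ℤ)}
    (h : ∀ w ∈ C, rot w ∈ C') : Pr p (wEvent N C) ≤ Pr p (wEvent N C') := by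
  rw [← Pr_equiv p rot (wEvent N C)]
  apply Pr_mono h0 h1
  rintro ω ⟨w, hw, hC⟩
  exact ⟨rot w, winding_rot ω hw, h w hC⟩

/-- First sector. -/
def C0 : Set (Fin 2 → ℤ) := {w | (w 1 < w 0 ∧ 0 ≤ w 1) ∨ (w 0 < w 1 ∧ w 1 ≤ 0)}
/-- Second sector. -/
def C1 : Set (Fin 2 → ℤ) := {w | (w 0 ≤ w 1 ∧ 0 < w 0) ∨ (w 1 ≤ w 0 ∧ w 0 < 0)}
/-- Third sector. -/
def C2 : Set (Fin 2 → ℤ) := {w | (0 < w 1 ∧ w 0 ≤ 0) ∨ (w 1 < 0 ∧ 0 ≤ w 0)}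

lemma det01 {w w' : Fin 2 → ℤ} (h : w ∈ C0) (h' : w' ∈ C1) : w 0 * w' 1 - w 1 * w' 0 ≠ 0 := by
  rcases h with ⟨h1, h2⟩ | ⟨h1, h2⟩ <;> rcases h' with ⟨h3, h4⟩ | ⟨h3, h4⟩ <;> intro e
  · nlinarith
  · nlinarith
  · nlinarith
  · nlinarith

lemma span_lower {N : ℕ} [NeZero N] {p : ℝ} (h0 : 0 ≤ p) (h1 : p ≤ 1) {η : ℝ} (hη : 0 ≤ η)
    (hA : 1 - η ^ 3 ≤ Pr p (giantEvent N)) : 1 - 2 * η ≤ Pr p (spanEvent N) := by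
  have r01 : Pr p (wEvent N C0) ≤ Pr p (wEvent N C1) := Pr_rot h0 h1 (by
    intro w hw; simp [C0, C1, rot] at *; omega)
  have r12 : Pr p (wEvent N C1) ≤ Pr p (wEvent N C2) := Pr_rot h0 h1 (by
    intro w hw; simp [C2, C1, rot] at *; omega)
  have r20 : Pr p (wEvent N C2) ≤ Pr p (wEvent N C0) := Pr_rot h0 h1 (by
    intro w hw; simp [C0, C2, rot] at *; omega)
  have u1 := harris_union h0 h1 (wEvent_upper N C0) (wEvent_upper N C1)
  have u2 := harris_union h0 h1 ((wEvent_upper N C0).union (wEvent_upper N C1)) (wEvent_upper N C2)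
  have sub : giantEvent N ⊆ wEvent N C0 ∪ wEvent N C1 ∪ wEvent N C2 := by
    rw [giant_eq (NeZero.pos N)]
    rintro ω ⟨w, hw, hw0⟩
    have : w ∈ C0 ∨ w ∈ C1 ∨ w ∈ C2 := by
      have : ¬ (w 0 = 0 ∧ w 1 = 0) := by
        rintro ⟨a, b⟩; apply hw0; ext i; fin_cases i <;> simp [a, b]
      simp only [C0, C1, C2, Set.mem_ofPred_eq]; omega
    rcases this with h | h | h
    · exact Or.inl (Or.inl ⟨w, hw, h⟩)
    · exact Or.inl (Or.inr ⟨w, hw, h⟩)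
    · exact Or.inr ⟨w, hw, h⟩
  have m := Pr_mono h0 h1 sub
  have sub2 : wEvent N C0 ∩ wEvent N C1 ⊆ spanEvent N := by
    rintro ω ⟨⟨w, hw, hC⟩, ⟨w', hw', hC'⟩⟩
    exact span_of_det hw hw' (det01 hC hC')
  have m2 := Pr_mono h0 h1 sub2
  have iu := Pr_inter_union p (wEvent N C0) (wEvent N C1)
  have le1 := Pr_le_one h0 h1 (wEvent N C0 ∪ wEvent N C1)
  have le2 := Pr_le_one h0 h1 (wEvent N C0)
  have e1 : Pr p (wEvent N C1) = Pr p (wEvent N C0) := by linarith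
  have e2 : Pr p (wEvent N C2) = Pr p (wEvent N C0) := by linarith
  rw [e1] at u1 iu
  rw [e2] at u2
  set q := 1 - Pr p (wEvent N C0) with hq
  have hq0 : 0 ≤ q := by linarith
  have h3 : q ^ 3 ≤ η ^ 3 := by
    have : q * q * q ≤ (1 - Pr p (wEvent N C0 ∪ wEvent N C1)) * q :=
      mul_le_mul_of_nonneg_right u1 hq0
    nlinarith
  have : q ≤ η := le_of_pow_le_pow_left₀ (by norm_num) hη h3
  linarith

lemma giant_half {N : ℕ} [NeZero N] : 1 / 2 ≤ Pr (1 / 2) (giantEvent N) := by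
  have hN := NeZero.pos N
  have sub1 : spanEvent N ⊆ giantEvent N := by
    intro ω h
    rw [giant_iff hN]
    obtain ⟨w, hw, w', hw', hd⟩ := (span_iff ω).1 h
    refine ⟨w, hw, ?_⟩
    rintro rfl
    simp at hd
  have sub2 : (spanEvent N)ᶜ ⊆ {ω : Config N | (fun v => !(ω v)) ∈ giantEvent N} :=
    fun ω h => giant_of_not_span hN ω h
  have a := Pr_mono (p := 1 / 2) (by norm_num) (by norm_num) sub1
  have b := Pr_mono (p := 1 / 2) (by norm_num) (by norm_num) sub2
  rw [Pr_compl, Pr_cc] at b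
  norm_num at a b ⊢
  linarith

lemma giant_sharp (ε δ : ℝ) (hε : 0 < ε) (hδ : 0 < δ) : ∃ n0 : ℕ, ∀ N : ℕ, n0 ≤ N →
    ∀ [NeZero N], ∀ p, 1 / 2 + δ ≤ p → p ≤ 1 → 1 - ε ≤ Pr p (giantEvent N) := by
  obtain ⟨n0, h⟩ := sharp ε δ hε hδ
  refine ⟨n0, fun N hN _ p hp hp1 => ?_⟩
  have hN0 := NeZero.pos N
  classical
  refine h (Fin 2 → ZMod N) ?_ (fun ω => if ω ∈ giantEvent N then (1 : ℝ) else 0) ?_ ?_ ?_ ?_ p hp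
    hp1 |>.trans (le_of_eq ?_)
  · simp only [Fintype.card_fun, ZMod.card, Fintype.card_fin]; nlinarith
  · apply ind_mono; rw [giant_eq hN0]; exact wEvent_upper _ _
  · intro ω; by_cases h : ω ∈ giantEvent N <;> simp [h]
  · intro p u v
    have := Dv_equiv p (Equiv.addRight (v - u))
      (fun ω : Config N => if ω ∈ giantEvent N then (1 : ℝ) else 0) (fun ω => ?_) u
    · simpa using this
    · have := wEvent_trans (v - u) {w | w ≠ 0} ω
      rw [← giant_eq hN0] at this
      simp only [Equiv.coe_addRight, this]
  · refine (giant_half (N := N)).trans (le_of_eq ?_)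
    unfold Pr; congr 1
  · unfold Pr; congr 1

lemma span_sharp (ε δ : ℝ) (hε : 0 < ε) (hδ : 0 < δ) : ∃ n0 : ℕ, ∀ N : ℕ, n0 ≤ N →
    ∀ [NeZero N], ∀ p, 1 / 2 + δ ≤ p → p ≤ 1 → 1 - ε ≤ Pr p (spanEvent N) := by
  obtain ⟨n0, h⟩ := giant_sharp ((ε / 2) ^ 3) δ (by positivity) hδ
  refine ⟨n0, fun N hN _ p hp hp1 => ?_⟩
  have := span_lower (by linarith) hp1 (η := ε / 2) (by positivity) (h N hN p hp hp1)
  linarith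

end Final

end TriSite

/-- Kesten's theorem for site percolation on the triangular torus: if `p < 1/2` then
`ℙ_p(A^△) → 0` as `N → ∞`, and if `p > 1/2` then `ℙ_p(S^△) → 1` as `N → ∞`. -/
theorem triangular_site_half_threshold (p : ℝ) :
    (0 ≤ p → p < 1 / 2 →
      Filter.Tendsto (fun N : ℕ => TriSite.prob N p (TriSite.giantEvent N))
        Filter.atTop (nhds 0)) ∧
    (1 / 2 < p → p ≤ 1 →
      Filter.Tendsto (fun N : ℕ => TriSite.prob N p (TriSite.spanEvent N))
        Filter.atTop (nhds 1)) := by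
  constructor
  · intro h0 h1
    rw [Metric.tendsto_atTop]
    intro ε hε
    obtain ⟨n0, h⟩ := TriSite.span_sharp (ε / 2) (1 / 2 - p) (by positivity) (by linarith)
    refine ⟨n0 + 1, fun N hN => ?_⟩
    have : NeZero N := ⟨by omega⟩
    rw [TriSite.prob_eq, Real.dist_eq, sub_zero,
      abs_of_nonneg (TriSite.Pr_nonneg h0 (by linarith) _)]
    have hs := h N (by omega) (1 - p) (by linarith) (by linarith)
    have e := TriSite.Pr_cc (1 - p) (TriSite.giantEvent N)
    rw [sub_sub_cancel] at e
    rw [← e]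
    have sub : {ω : TriSite.Config N | (fun v => !(ω v)) ∈ TriSite.giantEvent N}
        ⊆ (TriSite.spanEvent N)ᶜ :=
      fun ω hω hS => TriSite.not_giant_of_span (NeZero.pos N) ω hS hω
    have m := TriSite.Pr_mono (p := 1 - p) (by linarith) (by linarith) sub
    rw [TriSite.Pr_compl] at m
    linarith
  · intro h0 h1
    rw [Metric.tendsto_atTop]
    intro ε hε
    obtain ⟨n0, h⟩ := TriSite.span_sharp (ε / 2) (p - 1 / 2) (by positivity) (by linarith)
    refine ⟨n0 + 1, fun N hN => ?_⟩
    have : NeZero N := ⟨by omega⟩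
    rw [TriSite.prob_eq, Real.dist_eq, abs_sub_lt_iff]
    have hs := h N (by omega) p (by linarith) h1
    have hl := TriSite.Pr_le_one (p := p) (by linarith) h1 (TriSite.spanEvent N)
    constructor <;> linarith
end

section
/- For every integer d ≥ 3, the critical probability of Bernoulli bond percolation on ℤ^d is strictly smaller than that on ℤ^{d−1}: p̂_c(d) < p̂_c(d−1). -/
/-!
Bond percolation on the torus `T^d_N`.  A configuration assigns `true`/`false`
(open/closed) to each edge of the graph on `(ℤ/Nℤ)^d` in which a vertex is joined
to its translates by standard basis vectors; edges are indexed by a vertex together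
with a direction.  A configuration lifts `N`-periodically to `ℤ^d`, and the
giant-cycle event `A^□` asks for two distinct points of `ℤ^d`, congruent mod `N`,
joined by a path of open edges of the periodic lift.
-/

namespace TorusPerc

/-- The standard basis vector `e i` of `ℤ^d`. -/
def stdVec (d : ℕ) (i : Fin d) : Fin d → ℤ := fun j => if j = i then 1 else 0

/-- An edge of the cubical torus: a vertex of `(ℤ/Nℤ)^d` together with a direction. -/
abbrev Edge (d N : ℕ) := (Fin d → ZMod N) × Fin d

/-- A bond configuration on the torus. -/
abbrev Config (d N : ℕ) := Edge d N → Bool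

/-- Reduction of a point of `ℤ^d` modulo `N`. -/
def proj (d N : ℕ) (x : Fin d → ℤ) : Fin d → ZMod N := fun i => (x i : ZMod N)

/-- The edge of the periodic lift going from `x` in direction `i` is open. -/
def liftOpen (d N : ℕ) (ω : Config d N) (x : Fin d → ℤ) (i : Fin d) : Prop :=
  ω (proj d N x, i) = true

/-- One step along an open edge of the periodic lift. -/
def step (d N : ℕ) (ω : Config d N) (x y : Fin d → ℤ) : Prop :=
  (∃ i, y = x + stdVec d i ∧ liftOpen d N ω x i) ∨
  (∃ i, x = y + stdVec d i ∧ liftOpen d N ω y i)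

/-- Connectivity by paths of open edges in the periodic lift. -/
def connected (d N : ℕ) (ω : Config d N) : (Fin d → ℤ) → (Fin d → ℤ) → Prop :=
  Relation.ReflTransGen (step d N ω)

/-- The giant-cycle event `A^□`: some two distinct points of `ℤ^d` which are congruent
modulo `N` are joined by an open path of the periodic lift. -/
def giantEvent (d N : ℕ) : Set (Config d N) :=
  {ω | ∃ x y : Fin d → ℤ, x ≠ y ∧ proj d N x = proj d N y ∧ connected d N ω x y}

/-- The set of winding vectors realized by a configuration. -/
def winding (d N : ℕ) (ω : Config d N) : Set (Fin d → ℤ) :=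
  {w | ∃ x : Fin d → ℤ, connected d N ω x (x + (N : ℤ) • w)}

/-- The realized winding vectors, regarded as vectors in `ℚ^d`. -/
def windingQ (d N : ℕ) (ω : Config d N) : Set (Fin d → ℚ) :=
  (fun w : Fin d → ℤ => fun i => (w i : ℚ)) '' winding d N ω

/-- The spanning event `S^□`: the realized winding vectors span `ℚ^d`. -/
def spanEvent (d N : ℕ) : Set (Config d N) :=
  {ω | Submodule.span ℚ (windingQ d N ω) = ⊤}

/-- The probability of an event under Bernoulli(`p`) bond percolation on the torus:
each edge is open independently with probability `p`. -/
noncomputable def prob (d N : ℕ) (p : ℝ) (S : Set (Config d N)) : ℝ :=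
  ∑ᶠ ω ∈ S, ∏ᶠ e : Edge d N, (if ω e then p else 1 - p)

end TorusPerc


/-!
Bond percolation on `ℤ^d` and its critical probability `p̂_c(d)`.
The event that the origin lies in an infinite open cluster has probability
`θ(p) = inf_M ℙ_p(0 ↔ ∂[-M,M]^d)`, where the connection event depends only on the
(finitely many) edges with both endpoints in the box `[-M,M]^d`, so that its
probability is a finite Bernoulli sum.  `p̂_c(d)` is the supremum of the `p ∈ [0,1]`
with `θ(p) = 0`.
-/

namespace ZLattice

/-- The edge of `ℤ^d` from `e.1` in direction `e.2` has both endpoints in `[-M,M]^d`. -/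
def inBox (d M : ℕ) (e : (Fin d → ℤ) × Fin d) : Prop :=
  (∀ j, |e.1 j| ≤ (M : ℤ)) ∧ (∀ j, |(e.1 + TorusPerc.stdVec d e.2) j| ≤ (M : ℤ))

/-- A bond configuration on the edges of the box `[-M,M]^d`. -/
abbrev BoxConfig (d M : ℕ) := {e : (Fin d → ℤ) × Fin d // inBox d M e} → Bool

/-- The edge from `x` in direction `i` lies in the box and is open. -/
def edgeOpen (d M : ℕ) (η : BoxConfig d M) (x : Fin d → ℤ) (i : Fin d) : Prop :=
  ∃ h : inBox d M (x, i), η ⟨(x, i), h⟩ = true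

/-- One step along an open edge of the box. -/
def step (d M : ℕ) (η : BoxConfig d M) (x y : Fin d → ℤ) : Prop :=
  (∃ i, y = x + TorusPerc.stdVec d i ∧ edgeOpen d M η x i) ∨
  (∃ i, x = y + TorusPerc.stdVec d i ∧ edgeOpen d M η y i)

/-- Connectivity by open paths inside the box. -/
def connected (d M : ℕ) (η : BoxConfig d M) : (Fin d → ℤ) → (Fin d → ℤ) → Prop :=
  Relation.ReflTransGen (step d M η)

/-- The origin is joined to the boundary of the box `[-M,M]^d` by an open path. -/
def reachBoundary (d M : ℕ) : Set (BoxConfig d M) :=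
  {η | ∃ y : Fin d → ℤ, (∃ j, |y j| = (M : ℤ)) ∧ connected d M η 0 y}

/-- Probability of an event for Bernoulli(`p`) bond percolation on the box. -/
noncomputable def prob (d M : ℕ) (p : ℝ) (S : Set (BoxConfig d M)) : ℝ :=
  ∑ᶠ η ∈ S, ∏ᶠ e : {e : (Fin d → ℤ) × Fin d // inBox d M e}, (if η e then p else 1 - p)

/-- `θ(p)`: the probability that the origin of `ℤ^d` lies in an infinite open cluster. -/
noncomputable def theta (d : ℕ) (p : ℝ) : ℝ := ⨅ M : ℕ, prob d M p (reachBoundary d M)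

/-- The critical probability `p̂_c(d)` of Bernoulli bond percolation on `ℤ^d`. -/
noncomputable def hatPc (d : ℕ) : ℝ := sSup {p : ℝ | p ∈ Set.Icc (0 : ℝ) 1 ∧ theta d p = 0}

end ZLattice


set_option linter.unusedSectionVars false

namespace PercAux

/-- Bernoulli weight of a configuration. -/
noncomputable def bw {α : Type*} [Fintype α] (p : ℝ) (η : α → Bool) : ℝ :=
  ∏ e, (if η e then p else 1 - p)

/-- Bernoulli probability of an event. -/
noncomputable def bp {α : Type*} [Fintype α] [DecidableEq α] (p : ℝ) (S : Set (α → Bool)) : ℝ :=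
  ∑ η, S.indicator (bw p) η

section bern
variable {α : Type*} [Fintype α] [DecidableEq α]

lemma bw_nonneg {p : ℝ} (h0 : 0 ≤ p) (h1 : p ≤ 1) (η : α → Bool) : 0 ≤ bw p η := by
  refine Finset.prod_nonneg fun e _ => ?_
  split_ifs <;> linarith

lemma ind_nonneg {p : ℝ} (h0 : 0 ≤ p) (h1 : p ≤ 1) (S : Set (α → Bool)) (η : α → Bool) :
    0 ≤ S.indicator (bw p) η :=
  Set.indicator_nonneg (fun η _ => bw_nonneg h0 h1 η) η

lemma bp_nonneg {p : ℝ} (h0 : 0 ≤ p) (h1 : p ≤ 1) (S : Set (α → Bool)) : 0 ≤ bp p S :=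
  Finset.sum_nonneg fun η _ => ind_nonneg h0 h1 S η

lemma bp_mono {p : ℝ} (h0 : 0 ≤ p) (h1 : p ≤ 1) {S T : Set (α → Bool)} (h : S ⊆ T) :
    bp p S ≤ bp p T :=
  Finset.sum_le_sum fun η _ =>
    Set.indicator_le_indicator_of_subset h (fun η => bw_nonneg h0 h1 η) η

lemma sum_prod_bool (g : α → Bool → ℝ) :
    ∑ η : α → Bool, ∏ e, g e (η e) = ∏ e, (g e true + g e false) := by
  have := Finset.prod_univ_sum (fun _ : α => (Finset.univ : Finset Bool)) g
  rw [Fintype.piFinset_univ] at this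
  rw [← this]
  simp

lemma sum_bw (p : ℝ) : ∑ η : α → Bool, bw p η = 1 := by
  unfold bw
  rw [sum_prod_bool (fun _ b => if b then p else 1 - p)]
  simp

lemma bp_univ (p : ℝ) : bp p (Set.univ : Set (α → Bool)) = 1 := by
  unfold bp
  simp [sum_bw]

lemma bp_le_one {p : ℝ} (h0 : 0 ≤ p) (h1 : p ≤ 1) (S : Set (α → Bool)) : bp p S ≤ 1 := by
  rw [← bp_univ (α := α) p]
  exact bp_mono h0 h1 (Set.subset_univ S)

lemma bp_compl (p : ℝ) (S : Set (α → Bool)) : bp p S = 1 - bp p Sᶜ := by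
  rw [← bp_univ (α := α) p]
  unfold bp
  rw [← Finset.sum_sub_distrib]
  refine Finset.sum_congr rfl fun η _ => ?_
  by_cases h : η ∈ S <;> simp [h]

/-- union bound -/
lemma bp_le_sum {p : ℝ} (h0 : 0 ≤ p) (h1 : p ≤ 1) {ι : Type*} (F : Finset ι)
    (S : Set (α → Bool)) (T : ι → Set (α → Bool)) (h : ∀ η ∈ S, ∃ i ∈ F, η ∈ T i) :
    bp p S ≤ ∑ i ∈ F, bp p (T i) := by
  unfold bp
  rw [Finset.sum_comm]
  refine Finset.sum_le_sum fun η _ => ?_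
  by_cases hη : η ∈ S
  · obtain ⟨i, hi, hT⟩ := h η hη
    refine le_trans ?_ (Finset.single_le_sum (fun i _ => ind_nonneg h0 h1 (T i) η) hi)
    simp [hη, hT]
  · rw [Set.indicator_of_notMem hη]
    exact Finset.sum_nonneg fun i _ => ind_nonneg h0 h1 (T i) η

lemma bp_cyl (p : ℝ) (T : Finset α) (b : Bool) :
    bp p {η : α → Bool | ∀ e ∈ T, η e = b} = (if b then p else 1 - p) ^ T.card := by
  have key : ∀ η : α → Bool, Set.indicator {η : α → Bool | ∀ e ∈ T, η e = b} (bw p) η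
      = ∏ e, (if e ∈ T then (if η e = b then (if b then p else 1 - p) else 0)
          else (if η e then p else 1 - p)) := by
    intro η
    by_cases h : ∀ e ∈ T, η e = b
    · rw [Set.indicator_of_mem (by exact h)]
      refine Finset.prod_congr rfl fun e _ => ?_
      by_cases he : e ∈ T
      · simp [he, h e he]
      · simp [he]
    · rw [Set.indicator_of_notMem (by exact h)]
      push Not at h
      obtain ⟨e, he, hb⟩ := h
      symm
      apply Finset.prod_eq_zero (Finset.mem_univ e)
      simp [he, hb]
  unfold bp
  simp_rw [key]
  rw [sum_prod_bool (fun e c => if e ∈ T then (if c = b then (if b then p else 1 - p) else 0)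
          else (if c then p else 1 - p))]
  have : ∀ e : α, ((if e ∈ T then (if true = b then (if b then p else 1 - p) else 0)
          else (if true then p else 1 - p)) + (if e ∈ T then (if false = b then (if b then p else 1 - p) else 0)
          else (if false then p else 1 - p))) = if e ∈ T then (if b then p else 1 - p) else 1 := by
    intro e
    by_cases he : e ∈ T <;> cases b <;> simp [he]
  rw [Finset.prod_congr rfl fun e _ => this e]
  simp [Finset.prod_ite_mem]

/-! ### stochastic domination -/

lemma sum_pair (e : α) (F : (α → Bool) → ℝ) :
    2 * ∑ w, F w = ∑ w, (F (Function.update w e true) + F (Function.update w e false)) := by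
  have h1 : ∀ w : α → Bool, F (Function.update w e true) + F (Function.update w e false)
      = F w + F (Function.update w e (!(w e))) := by
    intro w
    cases h : w e
    · rw [show Function.update w e false = w from by rw [← h]; simp]; simp [add_comm]
    · rw [show Function.update w e true = w from by rw [← h]; simp]; simp
  have h2 : ∑ w, F (Function.update w e (!(w e))) = ∑ w, F w := by
    have hinv : Function.Involutive (fun w : α → Bool => Function.update w e (!(w e))) := by
      intro w
      simp
    exact Equiv.sum_comp hinv.toPerm F
  rw [Finset.sum_congr rfl fun w _ => h1 w, Finset.sum_add_distrib, h2]
  ring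

/-- averaging over a coordinate -/
noncomputable def av (q : ℝ) (e : α) (f : (α → Bool) → ℝ) (w : α → Bool) : ℝ :=
  q * f (Function.update w e true) + (1 - q) * f (Function.update w e false)

lemma av_diff (q : ℝ) (e : α) (f ν : (α → Bool) → ℝ) :
    2 * (∑ w, ν w * f w - ∑ w, ν w * av q e f w) =
    ∑ w, ((1 - q) * ν (Function.update w e true) - q * ν (Function.update w e false)) *
      (f (Function.update w e true) - f (Function.update w e false)) := by
  rw [← Finset.sum_sub_distrib, sum_pair e]
  refine Finset.sum_congr rfl fun w _ => ?_
  simp only [av, Function.update_idem]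
  ring

lemma bw_update (q : ℝ) (e : α) (w : α → Bool) (b : Bool) :
    bw q (Function.update w e b) = (if b then q else 1 - q) *
      ∏ x ∈ Finset.univ.erase e, (if w x then q else 1 - q) := by
  unfold bw
  rw [← Finset.mul_prod_erase _ _ (Finset.mem_univ e)]
  congr 1
  · simp
  · refine Finset.prod_congr rfl fun x hx => ?_
    rw [Function.update_of_ne (Finset.ne_of_mem_erase hx)]

lemma bw_pair (q : ℝ) (e : α) (w : α → Bool) :
    (1 - q) * bw q (Function.update w e true) - q * bw q (Function.update w e false) = 0 := by
  rw [bw_update, bw_update]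
  simp
  ring

lemma av_exists {q : ℝ} (h0 : 0 ≤ q) (h1 : q ≤ 1) (ν : (α → Bool) → ℝ)
    (hν : ∀ e w, q * ν (Function.update w e false) ≤ (1 - q) * ν (Function.update w e true))
    (f : (α → Bool) → ℝ) (hf : Monotone f) (s : Finset α) :
    ∃ g : (α → Bool) → ℝ, Monotone g ∧ (∀ e ∈ s, ∀ w b, g (Function.update w e b) = g w) ∧
      ∑ w, ν w * g w ≤ ∑ w, ν w * f w ∧ ∑ w, bw q w * g w = ∑ w, bw q w * f w := by
  induction s using Finset.induction_on with
  | empty => exact ⟨f, hf, by simp, le_rfl, rfl⟩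
  | insert a s ha ih =>
    obtain ⟨g, hg, hs, hle, heq⟩ := ih
    refine ⟨av q a g, ?_, ?_, ?_, ?_⟩
    · intro w w' hw
      unfold av
      have A := hg (update_le_update_iff.2 ⟨le_refl true, fun x _ => hw x⟩ :
        Function.update w a true ≤ Function.update w' a true)
      have B := hg (update_le_update_iff.2 ⟨le_refl false, fun x _ => hw x⟩ :
        Function.update w a false ≤ Function.update w' a false)
      have := mul_le_mul_of_nonneg_left A h0
      have := mul_le_mul_of_nonneg_left B (sub_nonneg.2 h1)
      linarith
    · intro e he w b
      unfold av
      by_cases hea : e = a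
      · subst hea; simp
      · have hes : e ∈ s := by
          rcases Finset.mem_insert.1 he with h | h
          · exact absurd h hea
          · exact h
        rw [Function.update_comm hea, Function.update_comm hea, hs e hes, hs e hes]
    · refine le_trans ?_ hle
      have := av_diff q a g ν
      have h2 : 0 ≤ ∑ w, ((1 - q) * ν (Function.update w a true) - q * ν (Function.update w a false)) *
        (g (Function.update w a true) - g (Function.update w a false)) := by
        refine Finset.sum_nonneg fun w _ => mul_nonneg ?_ ?_
        · linarith [hν a w]
        · have := hg (update_le_update_iff.2 ⟨Bool.false_le true, fun x _ => le_refl (w x)⟩ :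
            Function.update w a false ≤ Function.update w a true)
          linarith
      linarith
    · rw [← heq]
      have := av_diff q a g (bw q)
      simp only [bw_pair, zero_mul, Finset.sum_const_zero] at this
      linarith

lemma domination {q : ℝ} (h0 : 0 ≤ q) (h1 : q ≤ 1) (ν : (α → Bool) → ℝ)
    (hν : ∀ e w, q * ν (Function.update w e false) ≤ (1 - q) * ν (Function.update w e true))
    (htot : ∑ w, ν w = 1)
    (f : (α → Bool) → ℝ) (hf : Monotone f) :
    ∑ w, bw q w * f w ≤ ∑ w, ν w * f w := by
  obtain ⟨g, -, hs, hle, heq⟩ := av_exists h0 h1 ν hν f hf Finset.univ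
  have hc : ∀ w, g w = g (fun _ => false) := by
    have : ∀ (s : Finset α) (w : α → Bool), (∀ e, e ∉ s → w e = false) → g w = g (fun _ => false) := by
      intro s
      induction s using Finset.induction_on with
      | empty => intro w hw; congr 1; funext e; exact hw e (by simp)
      | insert a s ha ih =>
        intro w hw
        rw [← hs a (Finset.mem_univ a) w false]
        apply ih
        intro e he
        by_cases hea : e = a
        · subst hea; simp
        · rw [Function.update_of_ne hea]; exact hw e (by simp [hea, he])
    intro w
    exact this Finset.univ w (by simp)
  rw [← heq]
  refine le_trans (le_of_eq ?_) hle
  simp_rw [hc]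
  rw [← Finset.sum_mul, ← Finset.sum_mul, htot, sum_bw]

end bern

section dom2
variable {α β : Type*} [Fintype α] [DecidableEq α] [Fintype β] [DecidableEq β]

/-- Domination for the image of a Bernoulli field. -/
lemma domination_map {p q : ℝ} (h0 : 0 ≤ q) (h1 : q ≤ 1)
    (W : (β → Bool) → (α → Bool))
    (hW : ∀ (e : α) (w : α → Bool),
      q * bp p {ω | ∀ f, f ≠ e → W ω f = w f} ≤
        bp p {ω | (∀ f, f ≠ e → W ω f = w f) ∧ W ω e = true})
    (A : Set (α → Bool)) (hA : ∀ w w', w ≤ w' → w ∈ A → w' ∈ A) :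
    bp q A ≤ bp p (W ⁻¹' A) := by
  set ν : (α → Bool) → ℝ := fun w => bp p {ω | W ω = w} with hνdef
  have hup : ∀ (e : α) (w : α → Bool) (b : Bool) (ω : β → Bool), W ω = Function.update w e b ↔
      (∀ f, f ≠ e → W ω f = w f) ∧ W ω e = b := by
    intro e w b ω
    constructor
    · intro h
      rw [h]
      refine ⟨fun f hf => by simp [hf], by simp⟩
    · rintro ⟨h, h'⟩
      funext f
      by_cases hf : f = e
      · subst hf; simp [h']
      · simp [hf, h f hf]
  have hsum : ∀ f : (α → Bool) → ℝ, ∑ w, ν w * f w = ∑ ω, bw p ω * f (W ω) := by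
    intro f
    simp only [hνdef, bp, Finset.sum_mul]
    rw [Finset.sum_comm]
    refine Finset.sum_congr rfl fun ω _ => ?_
    rw [Finset.sum_eq_single (W ω)]
    · rw [Set.indicator_of_mem (by simp)]
    · intro w _ hw
      rw [Set.indicator_of_notMem (by simpa using hw.symm)]
      simp
    · simp
  have hν : ∀ e w, q * ν (Function.update w e false) ≤ (1 - q) * ν (Function.update w e true) := by
    intro e w
    have h := hW e w
    have hs : bp p {ω | ∀ f, f ≠ e → W ω f = w f} =
        ν (Function.update w e true) + ν (Function.update w e false) := by
      simp only [hνdef, bp]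
      rw [← Finset.sum_add_distrib]
      refine Finset.sum_congr rfl fun ω _ => ?_
      simp only [Set.indicator, Set.mem_ofPred_eq, hup]
      by_cases h1 : ∀ f, f ≠ e → W ω f = w f <;> cases h2 : W ω e <;> simp [h1]
    have ht : bp p {ω | (∀ f, f ≠ e → W ω f = w f) ∧ W ω e = true} =
        ν (Function.update w e true) := by
      simp only [hνdef, hup]
    rw [hs, ht] at h
    linarith
  have htot : ∑ w, ν w = 1 := by
    have := hsum (fun _ => 1)
    simpa [sum_bw] using this
  have := domination h0 h1 ν hν htot (A.indicator 1) (by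
    intro w w' hw
    by_cases h : w ∈ A
    · simp [h, hA w w' hw h]
    · rw [Set.indicator_of_notMem h]
      exact Set.indicator_nonneg (fun _ _ => zero_le_one) _)
  rw [hsum] at this
  refine le_trans (le_of_eq ?_) (le_trans this (le_of_eq ?_))
  · unfold bp
    refine Finset.sum_congr rfl fun w _ => ?_
    by_cases h : w ∈ A <;> simp [h]
  · unfold bp
    refine Finset.sum_congr rfl fun w _ => ?_
    by_cases h : W w ∈ A <;> simp [h]

/-- an event which does not depend on the coordinate `e` -/
lemma bp_indep_coord (p : ℝ) (e : α) (D : Set (α → Bool))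
    (hD : ∀ ω b, Function.update ω e b ∈ D ↔ ω ∈ D) :
    bp p (D ∩ {ω | ω e = true}) = p * bp p D := by
  have h1 := sum_pair e (fun ω => (D ∩ {ω | ω e = true}).indicator (bw p) ω)
  have h2 := sum_pair e (fun ω => D.indicator (bw p) ω)
  have : 2 * bp p (D ∩ {ω | ω e = true}) = 2 * (p * bp p D) := by
    unfold bp
    rw [h1, mul_left_comm, h2, Finset.mul_sum]
    refine Finset.sum_congr rfl fun ω _ => ?_
    have u0 : Function.update ω e false ∉ D ∩ {ω | ω e = true} := by
      rintro ⟨-, h⟩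
      simp at h
    rw [Set.indicator_of_notMem u0]
    by_cases h : ω ∈ D
    · have a1 : Function.update ω e true ∈ D := (hD ω true).2 h
      have a0 : Function.update ω e false ∈ D := (hD ω false).2 h
      have u1 : Function.update ω e true ∈ D ∩ {ω | ω e = true} := ⟨a1, by simp⟩
      rw [Set.indicator_of_mem u1, Set.indicator_of_mem a1, Set.indicator_of_mem a0,
        bw_update, bw_update]
      simp
      left
      ring
    · have a1 : Function.update ω e true ∉ D := fun h' => h ((hD ω true).1 h')
      have a0 : Function.update ω e false ∉ D := fun h' => h ((hD ω false).1 h')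
      have u1 : Function.update ω e true ∉ D ∩ {ω | ω e = true} := fun h' => a1 h'.1
      rw [Set.indicator_of_notMem u1, Set.indicator_of_notMem a1, Set.indicator_of_notMem a0]
      simp
  linarith

lemma bp_mono_p {p q : ℝ} (h0 : 0 ≤ q) (hpq : q ≤ p) (h1 : p ≤ 1)
    (A : Set (α → Bool)) (hA : ∀ w w', w ≤ w' → w ∈ A → w' ∈ A) :
    bp q A ≤ bp p A := by
  refine domination_map h0 (hpq.trans h1) (fun ω => ω) ?_ A hA
  intro e w
  have := bp_indep_coord p e {ω : α → Bool | ∀ f, f ≠ e → ω f = w f} (by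
    intro ω b
    simp only [Set.mem_ofPred_eq]
    refine forall_congr' fun f => forall_congr' fun hf => ?_
    rw [Function.update_of_ne hf])
  have h2 : {ω : α → Bool | (∀ f, f ≠ e → ω f = w f) ∧ ω e = true} =
    {ω : α → Bool | ∀ f, f ≠ e → ω f = w f} ∩ {ω | ω e = true} := rfl
  rw [h2, this]
  exact mul_le_mul_of_nonneg_right hpq (bp_nonneg (h0.trans hpq) h1 _)

/-- local modification lemma -/
lemma bp_modify {p m : ℝ} (hm : 0 < m) (hmp : m ≤ p) (hm1 : p ≤ 1 - m) (C : Finset β) (K : ℕ)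
    (hK : C.card ≤ K) (φ : (β → Bool) → (β → Bool)) (hφ : ∀ ω, ∀ e ∉ C, φ ω e = ω e)
    (D S : Set (β → Bool)) (hDS : ∀ ω ∈ D, φ ω ∈ S) :
    (m / 2) ^ K * bp p D ≤ bp p S := by
  have p0 : 0 ≤ p := by linarith
  have p1 : p ≤ 1 := by linarith
  have hm2 : m / 2 ≤ 1 := by linarith
  have hb : ∀ ω, m ^ C.card * bw p ω ≤ bw p (φ ω) := by
    intro ω
    unfold bw
    rw [← Finset.prod_mul_prod_compl C, ← Finset.prod_mul_prod_compl C (fun e => if φ ω e then p else 1 - p)]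
    have e1 : ∏ e ∈ Cᶜ, (if φ ω e then p else 1 - p) = ∏ e ∈ Cᶜ, (if ω e then p else 1 - p) := by
      refine Finset.prod_congr rfl fun e he => ?_
      rw [hφ ω e (by simpa using he)]
    have e2 : m ^ C.card ≤ ∏ e ∈ C, (if φ ω e then p else 1 - p) := by
      rw [← Finset.prod_const]
      refine Finset.prod_le_prod (fun _ _ => hm.le) fun e _ => ?_
      split_ifs <;> linarith
    have e3 : ∏ e ∈ C, (if ω e then p else 1 - p) ≤ 1 := by
      refine Finset.prod_le_one (fun e _ => ?_) fun e _ => ?_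
      · split_ifs <;> linarith
      · split_ifs <;> linarith
    have e4 : 0 ≤ ∏ e ∈ Cᶜ, (if ω e then p else 1 - p) := by
      refine Finset.prod_nonneg fun e _ => ?_
      split_ifs <;> linarith
    have e5 : 0 ≤ ∏ e ∈ C, (if ω e then p else 1 - p) := by
      refine Finset.prod_nonneg fun e _ => ?_
      split_ifs <;> linarith
    rw [e1]
    rw [← mul_assoc]
    refine mul_le_mul_of_nonneg_right ?_ e4
    have := mul_le_mul e2 e3 e5 (le_trans (pow_nonneg hm.le _) e2)
    simpa using this
  have hfib : ∀ ω', ((Finset.univ.filter fun ω => φ ω = ω').card : ℝ) ≤ 2 ^ C.card := by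
    intro ω'
    have : (Finset.univ.filter fun ω => φ ω = ω').card ≤
        (Finset.univ : Finset (C → Bool)).card := by
      refine Finset.card_le_card_of_injOn (fun ω x => ω x.1) (by simp) ?_
      intro ω hω τ hτ h
      simp only [Finset.coe_filter, Finset.mem_univ, true_and, Set.mem_ofPred_eq] at hω hτ
      funext e
      by_cases he : e ∈ C
      · exact congrFun h ⟨e, he⟩
      · rw [← hφ ω e he, ← hφ τ e he, hω, hτ]
    have h2 : (Finset.univ : Finset (C → Bool)).card = 2 ^ C.card := by simp
    rw [h2] at this
    exact_mod_cast this
  have hmain : m ^ C.card * bp p D ≤ 2 ^ C.card * bp p S := by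
    calc m ^ C.card * bp p D ≤ ∑ ω, S.indicator (bw p) (φ ω) := by
          unfold bp
          rw [Finset.mul_sum]
          refine Finset.sum_le_sum fun ω _ => ?_
          by_cases h : ω ∈ D
          · rw [Set.indicator_of_mem h, Set.indicator_of_mem (hDS ω h)]; exact hb ω
          · rw [Set.indicator_of_notMem h, mul_zero]; exact ind_nonneg p0 p1 _ _
      _ = ∑ ω', ∑ ω with φ ω = ω', S.indicator (bw p) (φ ω) := by
          rw [Finset.sum_fiberwise]
      _ = ∑ ω', ((Finset.univ.filter fun ω => φ ω = ω').card : ℝ) * S.indicator (bw p) ω' := by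
          refine Finset.sum_congr rfl fun ω' _ => ?_
          rw [← nsmul_eq_mul, ← Finset.sum_const]
          refine Finset.sum_congr rfl fun ω hω => ?_
          rw [(Finset.mem_filter.1 hω).2]
      _ ≤ 2 ^ C.card * bp p S := by
          unfold bp
          rw [Finset.mul_sum]
          refine Finset.sum_le_sum fun ω' _ => ?_
          exact mul_le_mul_of_nonneg_right (hfib ω') (ind_nonneg p0 p1 _ _)
  have h3 : (m / 2) ^ C.card * bp p D ≤ bp p S := by
    rw [div_pow, div_mul_eq_mul_div, div_le_iff₀ (by positivity)]
    linarith
  refine le_trans (mul_le_mul_of_nonneg_right ?_ (bp_nonneg p0 p1 D)) h3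
  exact pow_le_pow_of_le_one (by positivity) hm2 hK

end dom2

end PercAux


namespace PercAux
open TorusPerc ZLattice

instance boxFinite (d M : ℕ) : Finite {e : (Fin d → ℤ) × Fin d // inBox d M e} := by
  have : Set.Finite {e : (Fin d → ℤ) × Fin d | inBox d M e} := by
    refine Set.Finite.subset
      (Finset.finite_toSet ((Finset.Icc (fun _ => -(M : ℤ)) (fun _ => (M : ℤ))) ×ˢ
        (Finset.univ : Finset (Fin d)))) ?_
    intro e he
    have h1 := he.1
    simp only [Finset.coe_product, Finset.coe_univ, Set.mem_prod, Finset.mem_coe, Finset.mem_Icc,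
      Set.mem_univ, and_true]
    exact ⟨fun j => (abs_le.1 (h1 j)).1, fun j => (abs_le.1 (h1 j)).2⟩
  exact this.to_subtype

noncomputable instance boxFintype (d M : ℕ) : Fintype {e : (Fin d → ℤ) × Fin d // inBox d M e} :=
  Fintype.ofFinite _

lemma prob_eq (d M : ℕ) (p : ℝ) (S : Set (BoxConfig d M)) : ZLattice.prob d M p S = bp p S := by
  unfold ZLattice.prob bp
  rw [finsum_mem_def, finsum_eq_sum_of_fintype]
  refine Finset.sum_congr rfl fun η _ => ?_
  congr 1
  funext η
  unfold bw
  rw [finprod_eq_prod_of_fintype]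

lemma rtg_symm {α : Type*} {r : α → α → Prop} (h : ∀ a b, r a b → r b a) {a b : α}
    (hab : Relation.ReflTransGen r a b) : Relation.ReflTransGen r b a := by
  induction hab with
  | refl => exact Relation.ReflTransGen.refl
  | tail _ hs ih => exact Relation.ReflTransGen.head (h _ _ hs) ih

lemma connected_mono {d M : ℕ} {η η' : BoxConfig d M} (h : η ≤ η') {x y : Fin d → ℤ}
    (hc : connected d M η x y) : connected d M η' x y := by
  have key : ∀ x i, edgeOpen d M η x i → edgeOpen d M η' x i := by
    rintro x i ⟨hb, ho⟩
    refine ⟨hb, ?_⟩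
    have := h ⟨(x, i), hb⟩
    rw [ho] at this
    exact Bool.eq_true_of_true_le this
  refine Relation.ReflTransGen.mono (r := step d M η) ?_ _ _ hc
  rintro a b (⟨i, h1, h2⟩ | ⟨i, h1, h2⟩)
  · exact Or.inl ⟨i, h1, key _ _ h2⟩
  · exact Or.inr ⟨i, h1, key _ _ h2⟩

lemma reach_mono (d M : ℕ) (w w' : BoxConfig d M) (h : w ≤ w') (hw : w ∈ reachBoundary d M) :
    w' ∈ reachBoundary d M := by
  obtain ⟨y, hy, hc⟩ := hw
  exact ⟨y, hy, connected_mono h hc⟩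

/-- lift to level `t` -/
def lv {n : ℕ} (t : ℤ) (x : Fin n → ℤ) : Fin (n + 1) → ℤ := Fin.cons t x

@[simp] lemma lv_zero {n : ℕ} (t : ℤ) (x : Fin n → ℤ) : lv t x 0 = t := rfl
@[simp] lemma lv_succ {n : ℕ} (t : ℤ) (x : Fin n → ℤ) (j : Fin n) : lv t x j.succ = x j := rfl
@[simp] lemma lv_tail {n : ℕ} (t : ℤ) (x : Fin n → ℤ) : Fin.tail (lv t x) = x := rfl

lemma lv_inj {n : ℕ} {t t' : ℤ} {x x' : Fin n → ℤ} : lv t x = lv t' x' ↔ t = t' ∧ x = x' := by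
  unfold lv
  exact Fin.cons_inj

lemma lv_add {n : ℕ} (t t' : ℤ) (x x' : Fin n → ℤ) : lv t x + lv t' x' = lv (t + t') (x + x') := by
  funext j
  refine Fin.cases ?_ (fun j => ?_) j <;> simp

lemma stdVec_succ {n : ℕ} (i : Fin n) : stdVec (n + 1) i.succ = lv 0 (stdVec n i) := by
  funext j
  refine Fin.cases ?_ (fun j => ?_) j
  · simp [stdVec, (Fin.succ_ne_zero i).symm]
  · simp [stdVec]

lemma stdVec_vert {n : ℕ} : stdVec (n + 1) 0 = lv 1 0 := by
  funext j
  refine Fin.cases ?_ (fun j => ?_) j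
  · simp [stdVec]
  · simp [stdVec]

lemma inBox_hor {n M : ℕ} {t : ℤ} {x : Fin n → ℤ} {i : Fin n} (ht : |t| ≤ (M : ℤ))
    (h : inBox n M (x, i)) : inBox (n + 1) M (lv t x, i.succ) := by
  refine ⟨fun j => ?_, fun j => ?_⟩
  · refine Fin.cases ?_ (fun j => ?_) j
    · simpa using ht
    · simpa using h.1 j
  · simp only [stdVec_succ, lv_add]
    refine Fin.cases ?_ (fun j => ?_) j
    · simpa using ht
    · simpa using h.2 j

lemma inBox_vert {n M : ℕ} {x : Fin n → ℤ} (hM : 1 ≤ M)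
    (h : ∀ j, |x j| ≤ (M : ℤ)) : inBox (n + 1) M (lv 0 x, 0) := by
  refine ⟨fun j => ?_, fun j => ?_⟩
  · refine Fin.cases ?_ (fun j => ?_) j
    · simp
    · simpa using h j
  · simp only [stdVec_vert, lv_add]
    refine Fin.cases ?_ (fun j => ?_) j
    · simpa using hM
    · simpa using h j

open Classical in
/-- extension of a box configuration by closed edges -/
noncomputable def ex {d M : ℕ} (ω : BoxConfig d M) (e : (Fin d → ℤ) × Fin d) : Bool :=
  if h : inBox d M e then ω ⟨e, h⟩ else false

lemma ex_of {d M : ℕ} (ω : BoxConfig d M) {e : (Fin d → ℤ) × Fin d} (h : inBox d M e) :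
    ex ω e = ω ⟨e, h⟩ := by
  unfold ex
  rw [dif_pos h]

lemma edgeOpen_iff {d M : ℕ} (ω : BoxConfig d M) (x : Fin d → ℤ) (i : Fin d) :
    edgeOpen d M ω x i ↔ ex ω (x, i) = true := by
  unfold edgeOpen ex
  by_cases h : inBox d M (x, i) <;> simp [h]

/-- enhanced configuration on `ℤ^n` -/
def Wt {n : ℕ} (g : (Fin (n + 1) → ℤ) × Fin (n + 1) → Bool) (f : (Fin n → ℤ) × Fin n) : Bool :=
  g (lv 0 f.1, f.2.succ) ||
    (g (lv 0 f.1, 0) && g (lv 1 f.1, f.2.succ) && g (lv 0 (f.1 + stdVec n f.2), 0))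

/-- being within sup-distance one -/
def near {n : ℕ} (x z : Fin n → ℤ) : Prop := ∀ k, |z k - x k| ≤ 1

open Classical in
/-- local modification around the edge `(x,i)` -/
noncomputable def phit {n : ℕ} (x : Fin n → ℤ) (i : Fin n)
    (g : (Fin (n + 1) → ℤ) × Fin (n + 1) → Bool) (e : (Fin (n + 1) → ℤ) × Fin (n + 1)) : Bool :=
  Fin.cases (motive := fun _ => Bool)
    (if e.1 = lv 0 x ∨ e.1 = lv 0 (x + stdVec n i) then true else g e)
    (fun j => if near x (Fin.tail e.1) then
        (if e.1 0 = 0 then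
          (if (Fin.tail e.1, j) = (x, i) then false else Wt g (Fin.tail e.1, j))
        else if e.1 0 = 1 then (if (Fin.tail e.1, j) = (x, i) then true else false)
        else g e) else g e) e.2

section det
variable {n : ℕ} (x : Fin n → ℤ) (i : Fin n) (g : (Fin (n + 1) → ℤ) × Fin (n + 1) → Bool)

open Classical in
lemma phit_0 (z : Fin n → ℤ) (j : Fin n) : phit x i g (lv 0 z, j.succ) =
    if near x z then (if (z, j) = (x, i) then false else Wt g (z, j)) else g (lv 0 z, j.succ) := by
  simp [phit]

open Classical in
lemma phit_1 (z : Fin n → ℤ) (j : Fin n) : phit x i g (lv 1 z, j.succ) =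
    if near x z then (if (z, j) = (x, i) then true else false) else g (lv 1 z, j.succ) := by
  simp [phit]

open Classical in
lemma phit_v (z : Fin n → ℤ) : phit x i g (lv 0 z, 0) =
    if z = x ∨ z = x + stdVec n i then true else g (lv 0 z, 0) := by
  simp [phit, lv_inj]

lemma std_cases (i k : Fin n) : stdVec n i k = 0 ∨ stdVec n i k = 1 := by
  unfold stdVec
  split_ifs <;> simp

lemma near_self : near x x := by intro k; simp

lemma near_add : near x (x + stdVec n i) := by
  intro k
  rcases std_cases i k with h | h <;> simp [h]

lemma Wt_phit_ne (z : Fin n → ℤ) (j : Fin n) (h : (z, j) ≠ (x, i)) :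
    Wt (phit x i g) (z, j) = Wt g (z, j) := by
  by_cases hz : near x z
  · rw [Wt]
    simp only [phit_0, phit_1, hz, h]
    simp
  · have h1 : ¬ (z = x ∨ z = x + stdVec n i) := by
      rintro (rfl | rfl)
      · exact hz (near_self z)
      · exact hz (near_add x i)
    have h2 : ¬ (z + stdVec n j = x ∨ z + stdVec n j = x + stdVec n i) := by
      rintro (h | h)
      · apply hz
        intro k
        have := congrFun h k
        simp only [Pi.add_apply] at this
        rw [abs_le]
        rcases std_cases j k with h | h <;> constructor <;> omega
      · apply hz
        intro k
        have := congrFun h k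
        simp only [Pi.add_apply] at this
        rw [abs_le]
        rcases std_cases j k with h | h <;> rcases std_cases i k with h' | h' <;> constructor <;> omega
    rw [Wt, Wt]
    simp only [phit_0, phit_1, phit_v, hz, h1, h2]
    simp

lemma Wt_phit_self : Wt (phit x i g) (x, i) = true := by
  rw [Wt]
  simp only [phit_0, phit_1, phit_v, near_self]
  simp

lemma phit_base : phit x i g (lv 0 x, i.succ) = false := by
  simp [phit_0, near_self]

lemma phit_off (e : (Fin (n + 1) → ℤ) × Fin (n + 1)) (he : ¬ near (lv 0 x) e.1) :
    phit x i g e = g e := by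
  obtain ⟨v, k⟩ := e
  revert he
  refine Fin.cases ?_ (fun j => ?_) k
  · intro he
    have : ¬ (v = lv 0 x ∨ v = lv 0 (x + stdVec n i)) := by
      rintro (rfl | rfl)
      · exact he (near_self _)
      · apply he
        have := near_add (lv 0 x) i.succ
        rw [stdVec_succ, lv_add] at this
        simpa using this
    simp [phit, this]
  · intro he
    by_cases h1 : near x (Fin.tail v)
    · have h0 : v 0 ≠ 0 := by
        intro h0
        apply he
        intro k
        refine Fin.cases ?_ (fun k => ?_) k
        · simp [h0]
        · exact h1 k
      have h0' : v 0 ≠ 1 := by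
        intro h0
        apply he
        intro k
        refine Fin.cases ?_ (fun k => ?_) k
        · simp [h0]
        · exact h1 k
      simp [phit, h0, h0']
    · simp [phit, h1]

end det

/-- the enhanced configuration in the box -/
noncomputable def Wb {n M : ℕ} (ω : BoxConfig (n + 1) M) : BoxConfig n M := fun f => Wt (ex ω) f.1

lemma Wt_congr {n M : ℕ} (hM : 1 ≤ M) (g g' : (Fin (n + 1) → ℤ) × Fin (n + 1) → Bool)
    (h : ∀ e, inBox (n + 1) M e → g e = g' e) (f : (Fin n → ℤ) × Fin n) (hf : inBox n M f) :
    Wt g f = Wt g' f := by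
  obtain ⟨x, i⟩ := f
  have hM' : (1 : ℤ) ≤ M := by exact_mod_cast hM
  unfold Wt
  rw [h _ (inBox_hor (by simp) hf), h _ (inBox_hor (by simpa using hM') hf),
    h _ (inBox_vert hM hf.1), h _ (inBox_vert hM hf.2)]

lemma reach_lift {n M : ℕ} (ω : BoxConfig (n + 1) M) (h : Wb ω ∈ reachBoundary n M) :
    ω ∈ reachBoundary (n + 1) M := by
  have hsym : ∀ a b, step (n + 1) M ω a b → step (n + 1) M ω b a := by
    rintro a b (h | h)
    · exact Or.inr h
    · exact Or.inl h
  have key : ∀ (x : Fin n → ℤ) i, edgeOpen n M (Wb ω) x i →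
      connected (n + 1) M ω (lv 0 x) (lv 0 (x + stdVec n i)) := by
    rintro x i ⟨hb, ho⟩
    simp only [Wb, Wt, Bool.or_eq_true, Bool.and_eq_true, ← edgeOpen_iff] at ho
    rcases ho with ho | ⟨⟨h1, h2⟩, h3⟩
    · exact Relation.ReflTransGen.single (Or.inl ⟨i.succ, by simp [stdVec_succ, lv_add], ho⟩)
    · have s1 : step (n + 1) M ω (lv 0 x) (lv 1 x) :=
        Or.inl ⟨0, by simp [stdVec_vert, lv_add], h1⟩
      have s2 : step (n + 1) M ω (lv 1 x) (lv 1 (x + stdVec n i)) :=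
        Or.inl ⟨i.succ, by simp [stdVec_succ, lv_add], h2⟩
      have s3 : step (n + 1) M ω (lv 1 (x + stdVec n i)) (lv 0 (x + stdVec n i)) :=
        Or.inr ⟨0, by simp [stdVec_vert, lv_add], h3⟩
      exact ((Relation.ReflTransGen.single s1).tail s2).tail s3
  have hcs : ∀ a b, connected (n + 1) M ω a b → connected (n + 1) M ω b a := by
    intro a b hab
    exact rtg_symm hsym hab
  obtain ⟨y, ⟨j, hj⟩, hc⟩ := h
  refine ⟨lv 0 y, ⟨j.succ, by simpa using hj⟩, ?_⟩
  have h0 : (0 : Fin (n + 1) → ℤ) = lv 0 0 := by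
    funext j
    refine Fin.cases ?_ (fun j => ?_) j <;> simp
  rw [h0]
  clear hj
  induction hc with
  | refl => exact Relation.ReflTransGen.refl
  | tail _ hstep ih =>
    rcases hstep with ⟨i, rfl, ho⟩ | ⟨i, rfl, ho⟩
    · exact Relation.ReflTransGen.trans ih (key _ _ ho)
    · exact Relation.ReflTransGen.trans ih (hcs _ _ (key _ _ ho))

lemma near_card {d M : ℕ} (a : Fin d → ℤ) (C : Finset {e : (Fin d → ℤ) × Fin d // inBox d M e})
    (hC : ∀ e ∈ C, near a e.1.1) : C.card ≤ 3 ^ d * d := by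
  have h1 : C.card ≤ ((Finset.Icc (fun k => a k - 1) (fun k => a k + 1)) ×ˢ
      (Finset.univ : Finset (Fin d))).card := by
    refine Finset.card_le_card_of_injOn (fun e => e.1) ?_ (fun e _ e' _ h => Subtype.ext h)
    intro e he
    have := hC e he
    simp only [Finset.coe_product, Finset.coe_univ, Set.mem_prod, Finset.mem_coe, Finset.mem_Icc,
      Set.mem_univ, and_true]
    refine ⟨fun k => ?_, fun k => ?_⟩
    · have := (abs_le.1 (this k)).1; simp only; omega
    · have := (abs_le.1 (this k)).2; simp only; omega
  refine h1.trans (le_of_eq ?_)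
  rw [Finset.card_product, Pi.card_Icc]
  simp only [Int.card_Icc, Finset.card_univ, Fintype.card_fin]
  congr 1
  have : ∀ k, (a k + 1 + 1 - (a k - 1)).toNat = 3 := by intro k; omega
  simp [this]

lemma enh_ineq {n M : ℕ} (hM : 1 ≤ M) {p q m : ℝ} (hm : 0 < m) (hmp : m ≤ p) (hm1 : p ≤ 1 - m)
    (hq0 : 0 ≤ q) (hq1 : q ≤ 1) (hq : q ≤ p + (m / 2) ^ (3 ^ (n + 1) * (n + 1))) :
    bp q (reachBoundary n M) ≤ bp p (reachBoundary (n + 1) M) := by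
  classical
  have p0 : 0 ≤ p := by linarith
  have p1 : p ≤ 1 := by linarith
  refine le_trans (domination_map (p := p) hq0 hq1 Wb ?_ _ (reach_mono n M))
    (bp_mono p0 p1 (fun ω h => reach_lift ω h))
  rintro ⟨⟨x, i⟩, hxi⟩ w
  have hbase : inBox (n + 1) M (lv 0 x, i.succ) := inBox_hor (by simp) hxi
  set D : Set (BoxConfig (n + 1) M) := {ω | ∀ f, f ≠ ⟨(x, i), hxi⟩ → Wb ω f = w f} with hD
  set eb : {e : (Fin (n + 1) → ℤ) × Fin (n + 1) // inBox (n + 1) M e} :=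
    ⟨(lv 0 x, i.succ), hbase⟩ with heb
  have hupd : ∀ (ω : BoxConfig (n + 1) M) b f, f ≠ ⟨(x, i), hxi⟩ →
      Wb (Function.update ω eb b) f = Wb ω f := by
    rintro ω b ⟨⟨z, j⟩, hf⟩ hne
    have hne' : ¬ (z = x ∧ j = i) := by
      rintro ⟨rfl, rfl⟩
      exact hne rfl
    have hex : ∀ e, e ≠ (lv 0 x, i.succ) → ex (Function.update ω eb b) e = ex ω e := by
      intro e he
      unfold ex
      split_ifs with h
      · rw [Function.update_of_ne]
        intro h'
        exact he (congrArg Subtype.val h')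
      · rfl
    have hs : (0 : Fin (n + 1)) ≠ i.succ := (Fin.succ_ne_zero i).symm
    simp only [Wb, Wt]
    rw [hex _ (by simpa [lv_inj] using hne'), hex (lv 0 z, 0) (by simp [hs]),
      hex (lv 1 z, _) (by simp [lv_inj]), hex (lv 0 (z + stdVec n j), 0) (by simp [hs])]
  have h1 : bp p (D ∩ {ω | ω eb = true}) = p * bp p D := by
    apply bp_indep_coord
    intro ω b
    simp only [hD, Set.mem_ofPred_eq]
    refine forall_congr' fun f => forall_congr' fun hf => ?_
    rw [hupd ω b f hf]
  set φ : BoxConfig (n + 1) M → BoxConfig (n + 1) M := fun ω e => phit x i (ex ω) e.1 with hφ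
  have hWφ : ∀ ω (f : {e : (Fin n → ℤ) × Fin n // inBox n M e}), Wb (φ ω) f = Wt (phit x i (ex ω)) f.1 := by
    intro ω f
    unfold Wb
    apply Wt_congr hM _ _ _ _ f.2
    intro e he
    rw [ex_of _ he]
  have h2 : (m / 2) ^ (3 ^ (n + 1) * (n + 1)) * bp p D ≤
      bp p {ω | (ω ∈ D ∧ Wb ω ⟨(x, i), hxi⟩ = true) ∧ ω eb = false} := by
    refine bp_modify hm hmp hm1 (Finset.univ.filter fun e => near (lv 0 x) e.1.1) _
      (near_card (lv 0 x) _ (by simp)) φ ?_ D _ ?_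
    · intro ω e he
      simp only [Finset.mem_filter, Finset.mem_univ, true_and] at he
      simp only [hφ]
      rw [phit_off x i _ _ he, ex_of _ e.2]
    · intro ω hω
      refine ⟨⟨?_, ?_⟩, ?_⟩
      · intro f hf
        rw [hWφ, ← hω f hf]
        obtain ⟨⟨z, j⟩, hf'⟩ := f
        rw [Wt_phit_ne]
        · rfl
        · intro h
          apply hf
          exact Subtype.ext h
      · rw [hWφ]
        exact Wt_phit_self x i _
      · exact phit_base x i _
  have h3 : bp p (D ∩ {ω | ω eb = true}) +
      bp p {ω | (ω ∈ D ∧ Wb ω ⟨(x, i), hxi⟩ = true) ∧ ω eb = false} ≤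
      bp p {ω | (∀ f, f ≠ ⟨(x, i), hxi⟩ → Wb ω f = w f) ∧ Wb ω ⟨(x, i), hxi⟩ = true} := by
    unfold bp
    rw [← Finset.sum_add_distrib]
    refine Finset.sum_le_sum fun ω _ => ?_
    have hb := bw_nonneg p0 p1 ω
    by_cases hωD : ω ∈ D
    · cases hc : ω eb
      · rw [Set.indicator_of_notMem (by intro h; have := h.2; simp [hc] at this), zero_add]
        refine Set.indicator_le_indicator_of_subset ?_ (fun η => bw_nonneg p0 p1 η) ω
        intro η h
        exact h.1
      · rw [Set.indicator_of_notMem (s := {ω | (ω ∈ D ∧ Wb ω ⟨(x, i), hxi⟩ = true) ∧ ω eb = false})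
          (by intro h; have := h.2; simp [hc] at this), add_zero]
        rw [Set.indicator_of_mem (s := {ω | (∀ f, f ≠ ⟨(x, i), hxi⟩ → Wb ω f = w f) ∧
          Wb ω ⟨(x, i), hxi⟩ = true})]
        · exact Set.indicator_le_self' (fun _ _ => hb) ω
        · refine ⟨hωD, ?_⟩
          simp only [Wb, Wt]
          rw [ex_of ω hbase]
          have : ω ⟨(lv 0 x, i.succ), hbase⟩ = true := hc
          rw [this]
          simp
    · rw [Set.indicator_of_notMem (fun h => hωD h.1), Set.indicator_of_notMem (fun h => hωD h.1.1)]
      rw [add_zero]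
      exact ind_nonneg p0 p1 _ _
  have h4 := bp_nonneg p0 p1 D
  have h5 := mul_le_mul_of_nonneg_right hq h4
  rw [h1] at h3
  have : q * bp p D ≤ p * bp p D + (m / 2) ^ (3 ^ (n + 1) * (n + 1)) * bp p D := by
    rw [← add_mul]; exact h5
  linarith

end PercAux


namespace PercAux
open TorusPerc ZLattice

lemma bp_cyl_box {d M : ℕ} {p : ℝ} (h0 : 0 ≤ p) (h1 : p ≤ 1) (T : Finset ((Fin d → ℤ) × Fin d))
    (b : Bool) :
    bp p {η : BoxConfig d M | ∀ e ∈ T, ∃ h : inBox d M e, η ⟨e, h⟩ = b} ≤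
      (if b then p else 1 - p) ^ T.card := by
  classical
  by_cases hT : ∀ e ∈ T, inBox d M e
  · have hc : (T.subtype (inBox d M)).card = T.card := by
      rw [Finset.card_subtype, Finset.filter_true_of_mem hT]
    rw [← hc, ← bp_cyl]
    refine bp_mono h0 h1 ?_
    rintro η hη ⟨e, he⟩ heT
    obtain ⟨h, h'⟩ := hη e (by simpa using heT)
    exact h'
  · have : {η : BoxConfig d M | ∀ e ∈ T, ∃ h : inBox d M e, η ⟨e, h⟩ = b} = ∅ := by
      rw [Set.eq_empty_iff_forall_notMem]
      intro η hη
      exact hT fun e he => (hη e he).1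
    rw [this]
    have h2 : bp p (∅ : Set (BoxConfig d M)) = 0 := by simp [bp]
    rw [h2]
    apply pow_nonneg
    split_ifs <;> linarith

/-- edges traversed by a list of moves -/
def mvEdges {n : ℕ} : (Fin n → ℤ) → List (Fin n × Bool) → List ((Fin n → ℤ) × Fin n)
  | _, [] => []
  | x, (i, true) :: ms => (x, i) :: mvEdges (x + stdVec n i) ms
  | x, (i, false) :: ms => (x - stdVec n i, i) :: mvEdges (x - stdVec n i) ms

lemma mvEdges_length {n : ℕ} (ms : List (Fin n × Bool)) : ∀ x, (mvEdges x ms).length = ms.length := by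
  induction ms with
  | nil => intro x; rfl
  | cons a ms ih =>
    intro x
    obtain ⟨i, b⟩ := a
    cases b <;> simp [mvEdges, ih]

lemma mvEdges_take {n : ℕ} (k : ℕ) (ms : List (Fin n × Bool)) :
    ∀ x, mvEdges x (ms.take k) = (mvEdges x ms).take k := by
  induction ms generalizing k with
  | nil => intro x; simp [mvEdges]
  | cons a ms ih =>
    intro x
    cases k with
    | zero => simp [mvEdges]
    | succ k =>
      obtain ⟨i, b⟩ := a
      cases b <;> simp [mvEdges, ih]

lemma stdVec_ne {n : ℕ} (i : Fin n) : stdVec n i ≠ 0 := by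
  intro h
  have := congrFun h i
  simp [stdVec] at this

/-- the open graph -/
def opG {n M : ℕ} (η : BoxConfig n M) : SimpleGraph (Fin n → ℤ) where
  Adj := step n M η
  symm := by
    constructor
    rintro a b (h | h)
    · exact Or.inr h
    · exact Or.inl h
  loopless := by
    constructor
    rintro a (⟨i, h, -⟩ | ⟨i, h, -⟩)
    · exact stdVec_ne i (by simpa using h)
    · exact stdVec_ne i (by simpa using h)

lemma walk_moves {n M : ℕ} (η : BoxConfig n M) {x y : Fin n → ℤ} (w : (opG η).Walk x y) :
    ∃ ms : List (Fin n × Bool), ms.length = w.length ∧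
      (mvEdges x ms).map (fun e => s(e.1, e.1 + stdVec n e.2)) = w.edges ∧
      ∀ e ∈ mvEdges x ms, edgeOpen n M η e.1 e.2 := by
  induction w with
  | nil => exact ⟨[], by simp [mvEdges]⟩
  | cons h w ih =>
    obtain ⟨ms, h1, h2, h3⟩ := ih
    rw [SimpleGraph.Walk.length_cons, SimpleGraph.Walk.edges_cons]
    rcases h with ⟨i, rfl, ho⟩ | ⟨i, hi, ho⟩
    · refine ⟨(i, true) :: ms, by simp [h1], ?_, ?_⟩
      · simp only [mvEdges, List.map_cons, h2]
      · intro e he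
        simp only [mvEdges, List.mem_cons] at he
        rcases he with rfl | he
        · exact ho
        · exact h3 e he
    · rename_i u v _
      have hv : u - stdVec n i = v := by rw [hi]; simp
      refine ⟨(i, false) :: ms, by simp [h1], ?_, ?_⟩
      · simp only [mvEdges, List.map_cons, hv, h2]
        rw [← hi, Sym2.eq_swap]
      · intro e he
        simp only [mvEdges, hv, List.mem_cons] at he
        rcases he with rfl | he
        · exact ho
        · exact h3 e he

lemma walk_len {n M : ℕ} (η : BoxConfig n M) {x y : Fin n → ℤ} (w : (opG η).Walk x y) (j : Fin n) :
    |y j - x j| ≤ (w.length : ℤ) := by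
  induction w with
  | nil => simp
  | cons h w ih =>
    rw [SimpleGraph.Walk.length_cons]
    push_cast
    rw [abs_le] at ih ⊢
    rcases h with ⟨i, rfl, ho⟩ | ⟨i, rfl, ho⟩ <;> simp only [Pi.add_apply] at ih ⊢ <;>
    rcases std_cases i j with h | h <;> constructor <;> omega

lemma reach_moves {n M : ℕ} (η : BoxConfig n M) (h : η ∈ reachBoundary n M) :
    ∃ ms : List (Fin n × Bool), ms.length = M ∧ (mvEdges 0 ms).Nodup ∧
      ∀ e ∈ mvEdges 0 ms, edgeOpen n M η e.1 e.2 := by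
  classical
  obtain ⟨y, ⟨j, hj⟩, hc⟩ := h
  have hr : (opG η).Reachable 0 y := by
    rw [SimpleGraph.reachable_iff_reflTransGen]
    exact hc
  obtain ⟨w, hw⟩ := hr.exists_isPath
  obtain ⟨ms, h1, h2, h3⟩ := walk_moves η w
  have hlen : M ≤ w.length := by
    have := walk_len η w j
    simp only [Pi.zero_apply, sub_zero, hj] at this
    exact_mod_cast this
  refine ⟨ms.take M, by simp [h1, hlen], ?_, ?_⟩
  · rw [mvEdges_take]
    refine List.Nodup.sublist (List.take_sublist _ _) ?_
    apply List.Nodup.of_map (fun e => s(e.1, e.1 + stdVec n e.2))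
    rw [h2]
    exact hw.isTrail.edges_nodup
  · intro e he
    rw [mvEdges_take] at he
    exact h3 e (List.mem_of_mem_take he)

lemma reach_small {n M : ℕ} {p : ℝ} (h0 : 0 ≤ p) (h1 : p ≤ 1) :
    bp p (reachBoundary n M) ≤ (2 * n * p) ^ M := by
  classical
  have h := bp_le_sum h0 h1 (Finset.univ : Finset (List.Vector (Fin n × Bool) M))
    (reachBoundary n M)
    (fun ms => {η | (mvEdges 0 ms.1).Nodup ∧ ∀ e ∈ mvEdges 0 ms.1, edgeOpen n M η e.1 e.2}) (by
      intro η hη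
      obtain ⟨ms, hl, hm⟩ := reach_moves η hη
      exact ⟨⟨ms, hl⟩, Finset.mem_univ _, hm⟩)
  refine h.trans ?_
  have hb : ∀ ms ∈ (Finset.univ : Finset (List.Vector (Fin n × Bool) M)),
      bp p {η : BoxConfig n M | (mvEdges 0 ms.1).Nodup ∧
        ∀ e ∈ mvEdges 0 ms.1, edgeOpen n M η e.1 e.2} ≤ p ^ M := by
    intro ms _
    by_cases hnd : (mvEdges 0 ms.1).Nodup
    · have hcard : (mvEdges 0 ms.1).toFinset.card = M := by
        rw [List.toFinset_card_of_nodup hnd, mvEdges_length, ms.2]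
      have := bp_cyl_box (M := M) h0 h1 (mvEdges 0 ms.1).toFinset true
      rw [hcard] at this
      refine le_trans (bp_mono h0 h1 ?_) this
      intro η hη e he
      exact hη.2 e (by simpa using he)
    · have : {η : BoxConfig n M | (mvEdges 0 ms.1).Nodup ∧
        ∀ e ∈ mvEdges 0 ms.1, edgeOpen n M η e.1 e.2} = ∅ := by
        rw [Set.eq_empty_iff_forall_notMem]
        intro η hη
        exact hnd hη.1
      rw [this]
      simp only [bp, Set.indicator_empty, Finset.sum_const_zero]
      positivity
  refine (Finset.sum_le_card_nsmul _ _ _ hb).trans (le_of_eq ?_)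
  rw [Finset.card_univ, card_vector, nsmul_eq_mul]
  simp only [Fintype.card_prod, Fintype.card_fin, Fintype.card_bool]
  push_cast
  rw [← mul_pow]
  ring

end PercAux


namespace PercAux
open TorusPerc ZLattice

/-- parent block -/
def par (u : Fin 2 → ℤ) : Fin 2 → ℤ := fun j => (u j + 1) / 3

/-- coarse graining: a block is good if at most one of its sites is bad -/
def coarse (s : (Fin 2 → ℤ) → Prop) (z : Fin 2 → ℤ) : Prop :=
  ∀ u v, par u = z → par v = z → ¬ s u → ¬ s v → u = v

/-- adjacency -/
def adj (x y : Fin 2 → ℤ) : Prop := (∃ i, y = x + stdVec 2 i) ∨ (∃ i, x = y + stdVec 2 i)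

/-- open site path connection -/
def Conn (s : (Fin 2 → ℤ) → Prop) : (Fin 2 → ℤ) → (Fin 2 → ℤ) → Prop :=
  Relation.ReflTransGen (fun x y => adj x y ∧ s x ∧ s y)

lemma adj_symm {x y : Fin 2 → ℤ} (h : adj x y) : adj y x := by
  rcases h with h | h
  · exact Or.inr h
  · exact Or.inl h

lemma Conn.symm {s : (Fin 2 → ℤ) → Prop} {x y : Fin 2 → ℤ} (h : Conn s x y) : Conn s y x :=
  rtg_symm (fun _ _ h => ⟨adj_symm h.1, h.2.2, h.2.1⟩) h

lemma Conn.trans {s : (Fin 2 → ℤ) → Prop} {x y z : Fin 2 → ℤ} (h : Conn s x y) (h' : Conn s y z) :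
    Conn s x z := Relation.ReflTransGen.trans h h'

lemma Conn.of {s : (Fin 2 → ℤ) → Prop} {x y : Fin 2 → ℤ} (h : adj x y) (hx : s x) (hy : s y) :
    Conn s x y := Relation.ReflTransGen.single ⟨h, hx, hy⟩

lemma adj_h {a b a' b' : ℤ} (h : a' = a + 1) (h' : b' = b) : adj ![a, b] ![a', b'] := by
  left
  refine ⟨0, ?_⟩
  funext j
  fin_cases j <;> simp [stdVec, h, h']

lemma adj_v {a b a' b' : ℤ} (h : a' = a) (h' : b' = b + 1) : adj ![a, b] ![a', b'] := by
  left
  refine ⟨1, ?_⟩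
  funext j
  fin_cases j <;> simp [stdVec, h, h']

lemma par_mk {a b : ℤ} {z : Fin 2 → ℤ} : par ![a, b] = z ↔ (a + 1) / 3 = z 0 ∧ (b + 1) / 3 = z 1 := by
  constructor
  · rintro rfl
    simp [par]
  · rintro ⟨h, h'⟩
    funext j
    fin_cases j <;> simp [par, h, h']

lemma eq_mk (u : Fin 2 → ℤ) : u = ![u 0, u 1] := by
  funext j
  fin_cases j <;> rfl

/-- inside a good block all good sites are connected -/
lemma block_conn {s : (Fin 2 → ℤ) → Prop} {z : Fin 2 → ℤ} (hz : coarse s z) :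
    ∃ c, ∀ u, par u = z → s u → Conn s u c := by
  obtain ⟨A, hA⟩ : ∃ A, A = 3 * z 0 := ⟨_, rfl⟩
  obtain ⟨B, hB⟩ : ∃ B, B = 3 * z 1 := ⟨_, rfl⟩
  have hpar : ∀ a b : ℤ, |a - A| ≤ 1 → |b - B| ≤ 1 → par ![a, b] = z := by
    intro a b ha hb
    rw [abs_le] at ha hb
    rw [par_mk]
    omega
  have two : ∀ a b a' b' : ℤ, |a - A| ≤ 1 → |b - B| ≤ 1 → |a' - A| ≤ 1 → |b' - B| ≤ 1 →
      (a ≠ a' ∨ b ≠ b') → s ![a, b] ∨ s ![a', b'] := by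
    intro a b a' b' h1 h2 h3 h4 h5
    by_contra hcon
    push Not at hcon
    have := hz _ _ (hpar a b h1 h2) (hpar a' b' h3 h4) hcon.1 hcon.2
    have e0 := congrFun this 0
    have e1 := congrFun this 1
    simp at e0 e1
    tauto
  have hcoord : ∀ u, par u = z → (u 0 = A - 1 ∨ u 0 = A ∨ u 0 = A + 1) ∧
      (u 1 = B - 1 ∨ u 1 = B ∨ u 1 = B + 1) := by
    intro u hu
    rw [eq_mk u, par_mk] at hu
    omega
  have hcoord' : ∀ u, par u = z → ∃ a b, u = ![a, b] ∧ (a = A - 1 ∨ a = A ∨ a = A + 1) ∧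
      (b = B - 1 ∨ b = B ∨ b = B + 1) := fun u hu => ⟨u 0, u 1, eq_mk u, hcoord u hu⟩
  by_cases hc : s ![A, B]
  · refine ⟨![A, B], fun u hu hs => ?_⟩
    obtain ⟨a, b, rfl, ha, hb⟩ := hcoord' u hu
    have hH : ∀ a', (a' = A - 1 ∨ a' = A ∨ a' = A + 1) → s ![a', B] → Conn s ![a', B] ![A, B] := by
      rintro a' (rfl | rfl | rfl) h
      · exact Conn.of (adj_h (by ring) rfl) h hc
      · exact Relation.ReflTransGen.refl
      · exact Conn.of (adj_symm (adj_h (by ring) rfl)) h hc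
    have hV : ∀ b', (b' = B - 1 ∨ b' = B ∨ b' = B + 1) → s ![A, b'] → Conn s ![A, b'] ![A, B] := by
      rintro b' (rfl | rfl | rfl) h
      · exact Conn.of (adj_v rfl (by ring)) h hc
      · exact Relation.ReflTransGen.refl
      · exact Conn.of (adj_symm (adj_v rfl (by ring))) h hc
    have hH' : ∀ a' b', (a' = A - 1 ∨ a' = A ∨ a' = A + 1) → s ![A, b'] → s ![a', b'] →
        Conn s ![a', b'] ![A, b'] := by
      rintro a' b' (rfl | rfl | rfl) h h'
      · exact Conn.of (adj_h (by ring) rfl) h' h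
      · exact Relation.ReflTransGen.refl
      · exact Conn.of (adj_symm (adj_h (by ring) rfl)) h' h
    have hV' : ∀ a' b', (b' = B - 1 ∨ b' = B ∨ b' = B + 1) → s ![a', B] → s ![a', b'] →
        Conn s ![a', b'] ![a', B] := by
      rintro a' b' (rfl | rfl | rfl) h h'
      · exact Conn.of (adj_v rfl (by ring)) h' h
      · exact Relation.ReflTransGen.refl
      · exact Conn.of (adj_symm (adj_v rfl (by ring))) h' h
    have hor : s ![a, B] ∨ s ![A, b] := by
      by_cases hab : a = A ∧ b = B
      · rw [hab.1]; exact Or.inl hc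
      · refine two _ _ _ _ ?_ ?_ ?_ ?_ ?_
        · rw [abs_le]; omega
        · simp
        · simp
        · rw [abs_le]; omega
        · by_contra hcon; push Not at hcon; exact hab ⟨hcon.1, hcon.2.symm⟩
    rcases hor with h | h
    · exact (hV' a b hb h hs).trans (hH a ha h)
    · exact (hH' a b ha h hs).trans (hV b hb h)
  · have hall : ∀ a b : ℤ, (a = A - 1 ∨ a = A ∨ a = A + 1) → (b = B - 1 ∨ b = B ∨ b = B + 1) →
        (a ≠ A ∨ b ≠ B) → s ![a, b] := by
      intro a b ha hb hab
      refine (two a b A B ?_ ?_ (by simp) (by simp) hab).resolve_right hc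
      · rw [abs_le]; omega
      · rw [abs_le]; omega
    have s1 : s ![A - 1, B - 1] := hall _ _ (by omega) (by omega) (by omega)
    have s2 : s ![A, B - 1] := hall _ _ (by omega) (by omega) (by omega)
    have s3 : s ![A + 1, B - 1] := hall _ _ (by omega) (by omega) (by omega)
    have s4 : s ![A + 1, B] := hall _ _ (by omega) (by omega) (by omega)
    have s5 : s ![A + 1, B + 1] := hall _ _ (by omega) (by omega) (by omega)
    have s6 : s ![A, B + 1] := hall _ _ (by omega) (by omega) (by omega)
    have s7 : s ![A - 1, B + 1] := hall _ _ (by omega) (by omega) (by omega)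
    have s8 : s ![A - 1, B] := hall _ _ (by omega) (by omega) (by omega)
    have c2 : Conn s ![A, B - 1] ![A - 1, B - 1] := Conn.of (adj_symm (adj_h (by ring) rfl)) s2 s1
    have c3 : Conn s ![A + 1, B - 1] ![A - 1, B - 1] :=
      (Conn.of (adj_symm (adj_h (by ring) rfl)) s3 s2).trans c2
    have c4 : Conn s ![A + 1, B] ![A - 1, B - 1] :=
      (Conn.of (adj_symm (adj_v rfl (by ring))) s4 s3).trans c3
    have c5 : Conn s ![A + 1, B + 1] ![A - 1, B - 1] :=
      (Conn.of (adj_symm (adj_v rfl (by ring))) s5 s4).trans c4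
    have c8 : Conn s ![A - 1, B] ![A - 1, B - 1] :=
      (Conn.of (adj_symm (adj_v rfl (by ring))) s8 s1)
    have c7 : Conn s ![A - 1, B + 1] ![A - 1, B - 1] :=
      (Conn.of (adj_symm (adj_v rfl (by ring))) s7 s8).trans c8
    have c6 : Conn s ![A, B + 1] ![A - 1, B - 1] :=
      (Conn.of (adj_symm (adj_h (by ring) rfl)) s6 s7).trans c7
    refine ⟨![A - 1, B - 1], fun u hu hs => ?_⟩
    obtain ⟨a, b, rfl, ha, hb⟩ := hcoord' u hu
    rcases ha with rfl | rfl | rfl <;> rcases hb with rfl | rfl | rfl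
    · exact Relation.ReflTransGen.refl
    · exact c8
    · exact c7
    · exact c2
    · exact absurd hs hc
    · exact c6
    · exact c3
    · exact c4
    · exact c5

lemma block_conn' {s : (Fin 2 → ℤ) → Prop} {z u u' : Fin 2 → ℤ} (hz : coarse s z)
    (hu : par u = z) (hu' : par u' = z) (h : s u) (h' : s u') : Conn s u u' := by
  obtain ⟨c, hc⟩ := block_conn hz
  exact (hc u hu h).trans (hc u' hu' h').symm

lemma facing {s : (Fin 2 → ℤ) → Prop} {z z' : Fin 2 → ℤ} (hz : coarse s z) (hz' : coarse s z')
    (a b : Fin 3 → Fin 2 → ℤ) (ha : ∀ k, par (a k) = z) (hb : ∀ k, par (b k) = z')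
    (hai : Function.Injective a) (hbi : Function.Injective b) : ∃ k, s (a k) ∧ s (b k) := by
  by_contra hcon
  push Not at hcon
  have A : ∀ k l, ¬ s (a k) → ¬ s (a l) → k = l := fun k l h h' => hai (hz _ _ (ha k) (ha l) h h')
  have B : ∀ k l, ¬ s (b k) → ¬ s (b l) → k = l := fun k l h h' => hbi (hz' _ _ (hb k) (hb l) h h')
  have h0 := hcon 0
  have h1 := hcon 1
  have h2 := hcon 2
  have a01 := A 0 1
  have a02 := A 0 2
  have a12 := A 1 2
  have b01 := B 0 1
  have b02 := B 0 2
  have b12 := B 1 2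
  simp at a01 a02 a12 b01 b02 b12
  tauto

lemma adj_blocks {s : (Fin 2 → ℤ) → Prop} {z : Fin 2 → ℤ} (i : Fin 2) (hz : coarse s z)
    (hz' : coarse s (z + stdVec 2 i)) :
    ∃ u u', par u = z ∧ par u' = z + stdVec 2 i ∧ s u ∧ s u' ∧ adj u u' := by
  have inj3 : ∀ B : ℤ, ∀ k l : Fin 3, B - 1 + (k : ℕ) = B - 1 + ((l : ℕ) : ℤ) → k = l := by
    intro B k l h
    ext
    omega
  fin_cases i
  · obtain ⟨k, h1, h2⟩ := facing hz hz' (fun k => ![3 * z 0 + 1, 3 * z 1 - 1 + (k : ℕ)])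
      (fun k => ![3 * z 0 + 2, 3 * z 1 - 1 + (k : ℕ)])
      (fun k => by rw [par_mk]; have := k.2; omega)
      (fun k => by rw [par_mk]; have := k.2; simp [stdVec]; omega)
      (fun k l h => inj3 (3 * z 1) k l (by have := congrFun h 1; simpa using this))
      (fun k l h => inj3 (3 * z 1) k l (by have := congrFun h 1; simpa using this))
    refine ⟨_, _, ?_, ?_, h1, h2, ?_⟩
    · rw [par_mk]; have := k.2; omega
    · rw [par_mk]; have := k.2; simp [stdVec]; omega
    · exact adj_h (by ring) rfl
  · obtain ⟨k, h1, h2⟩ := facing hz hz' (fun k => ![3 * z 0 - 1 + (k : ℕ), 3 * z 1 + 1])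
      (fun k => ![3 * z 0 - 1 + (k : ℕ), 3 * z 1 + 2])
      (fun k => by rw [par_mk]; have := k.2; omega)
      (fun k => by rw [par_mk]; have := k.2; simp [stdVec]; omega)
      (fun k l h => inj3 (3 * z 0) k l (by have := congrFun h 0; simpa using this))
      (fun k l h => inj3 (3 * z 0) k l (by have := congrFun h 0; simpa using this))
    refine ⟨_, _, ?_, ?_, h1, h2, ?_⟩
    · rw [par_mk]; have := k.2; omega
    · rw [par_mk]; have := k.2; simp [stdVec]; omega
    · exact adj_v rfl (by ring)

lemma adj_conn {s : (Fin 2 → ℤ) → Prop} {z z' u u' : Fin 2 → ℤ} (hz : coarse s z)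
    (hz' : coarse s z') (ha : adj z z') (hu : par u = z) (hu' : par u' = z') (h : s u) (h' : s u') :
    Conn s u u' := by
  rcases ha with ⟨i, rfl⟩ | ⟨i, rfl⟩
  · obtain ⟨v, v', p1, p2, s1, s2, hv⟩ := adj_blocks i hz hz'
    exact ((block_conn' hz hu p1 h s1).trans (Conn.of hv s1 s2)).trans (block_conn' hz' p2 hu' s2 h')
  · obtain ⟨v, v', p1, p2, s1, s2, hv⟩ := adj_blocks i hz' hz
    exact ((block_conn' hz hu p2 h s2).trans (Conn.of (adj_symm hv) s2 s1)).trans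
      (block_conn' hz' p1 hu' s1 h')

lemma good_child {s : (Fin 2 → ℤ) → Prop} {z : Fin 2 → ℤ} (hz : coarse s z) :
    ∃ u, par u = z ∧ s u ∧ u 0 = 3 * z 0 + 1 := by
  have p1 : par ![3 * z 0 + 1, 3 * z 1] = z := by rw [par_mk]; omega
  have p2 : par ![3 * z 0 + 1, 3 * z 1 + 1] = z := by rw [par_mk]; omega
  by_cases h : s ![3 * z 0 + 1, 3 * z 1]
  · exact ⟨_, p1, h, rfl⟩
  · refine ⟨_, p2, ?_, rfl⟩
    by_contra h'
    have := congrFun (hz _ _ p1 p2 h h') 1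
    simp at this

lemma conn_refine {s : (Fin 2 → ℤ) → Prop} {z z' u u' : Fin 2 → ℤ} (hz : coarse s z)
    (hc : Conn (coarse s) z z') (hu : par u = z) (hu' : par u' = z') (h : s u) (h' : s u') :
    Conn s u u' := by
  induction hc generalizing u' with
  | refl => exact block_conn' hz hu hu' h h'
  | tail _ hs ih =>
    obtain ⟨v, hv, sv, -⟩ := good_child hs.2.1
    exact (ih hv sv).trans (adj_conn hs.2.1 hs.2.2 hs.1 hv hu' sv h')

lemma conn_iter {s : (Fin 2 → ℤ) → Prop} (m : ℕ) {x y : Fin 2 → ℤ}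
    (hx : ∀ k ≤ m, coarse^[k] s (par^[k] x)) (hy : ∀ k ≤ m, coarse^[k] s (par^[k] y))
    (hc : Conn (coarse^[m] s) (par^[m] x) (par^[m] y)) : Conn s x y := by
  induction m with
  | zero => exact hc
  | succ m ih =>
    apply ih (fun k hk => hx k (by omega)) (fun k hk => hy k (by omega))
    have h1 := hx (m + 1) le_rfl
    rw [Function.iterate_succ_apply', Function.iterate_succ_apply'] at h1
    rw [Function.iterate_succ_apply', Function.iterate_succ_apply',
      Function.iterate_succ_apply'] at hc
    exact conn_refine h1 hc rfl rfl (hx m (by omega)) (hy m (by omega))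

lemma far_point {s : (Fin 2 → ℤ) → Prop} (m : ℕ) : ∀ {z : Fin 2 → ℤ}, coarse^[m] s z → 0 ≤ z 0 →
    ∃ y, par^[m] y = z ∧ (∀ k ≤ m, coarse^[k] s (par^[k] y)) ∧ z 0 + m ≤ y 0 := by
  induction m with
  | zero =>
    intro z hz _
    refine ⟨z, rfl, ?_, by simp⟩
    intro k hk
    obtain rfl : k = 0 := by omega
    exact hz
  | succ m ih =>
    intro z hz h0
    have hz' := hz
    rw [Function.iterate_succ_apply'] at hz'
    obtain ⟨u, hu, su, hu0⟩ := good_child hz'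
    obtain ⟨y, hy, hg, hy0⟩ := ih su (by omega)
    have hy' : par^[m + 1] y = z := by rw [Function.iterate_succ_apply', hy, hu]
    refine ⟨y, hy', ?_, ?_⟩
    · intro k hk
      rcases Nat.lt_or_ge m k with h | h
      · obtain rfl : k = m + 1 := by omega
        rw [hy']; exact hz
      · exact hg k h
    · push_cast; omega

lemma par_zero (k : ℕ) : par^[k] 0 = 0 := by
  apply Function.iterate_fixed
  funext j
  simp [par]

lemma conn_far {s : (Fin 2 → ℤ) → Prop} (m : ℕ) (h : ∀ k ≤ m, coarse^[k] s 0) :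
    ∃ y : Fin 2 → ℤ, (m : ℤ) ≤ y 0 ∧ Conn s 0 y := by
  obtain ⟨y, hy, hg, hy0⟩ := far_point m (h m le_rfl) (by simp)
  refine ⟨y, by simpa using hy0, conn_iter m ?_ hg ?_⟩
  · intro k hk; rw [par_zero]; exact h k hk
  · rw [par_zero, hy]; exact Relation.ReflTransGen.refl

end PercAux


namespace PercAux
open TorusPerc ZLattice

open Classical in
/-- extension of a box configuration by open edges -/
noncomputable def exo {d M : ℕ} (η : BoxConfig d M) (e : (Fin d → ℤ) × Fin d) : Bool :=
  if h : inBox d M e then η ⟨e, h⟩ else true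

/-- open sites -/
def site {M : ℕ} (η : BoxConfig 2 M) (x : Fin 2 → ℤ) : Prop := ∀ i, exo η (x, i) = true

lemma exo_open {d M : ℕ} (η : BoxConfig d M) {x : Fin d → ℤ} {i : Fin d} (h : inBox d M (x, i))
    (ho : exo η (x, i) = true) : edgeOpen d M η x i := by
  unfold exo at ho
  rw [dif_pos h] at ho
  exact ⟨h, ho⟩

lemma exo_false {d M : ℕ} (η : BoxConfig d M) {e : (Fin d → ℤ) × Fin d}
    (ho : exo η e = false) : ∃ h : inBox d M e, η ⟨e, h⟩ = false := by
  unfold exo at ho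
  by_cases h : inBox d M e
  · rw [dif_pos h] at ho
    exact ⟨h, ho⟩
  · rw [dif_neg h] at ho
    simp at ho

lemma reach_of_conn {M : ℕ} (η : BoxConfig 2 M) {y : Fin 2 → ℤ} (hc : Conn (site η) 0 y) :
    η ∈ reachBoundary 2 M ∨ (connected 2 M η 0 y ∧ ∀ j, |y j| < (M : ℤ)) := by
  induction hc with
  | refl =>
    rcases Nat.eq_zero_or_pos M with h | h
    · left
      refine ⟨0, ⟨0, by simp [h]⟩, Relation.ReflTransGen.refl⟩
    · right
      exact ⟨Relation.ReflTransGen.refl, fun j => by simpa using h⟩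
  | tail _ hs ih =>
    rename_i b c _
    rcases ih with ih | ⟨hcon, hlt⟩
    · exact Or.inl ih
    · obtain ⟨ha, hb, hc⟩ := hs
      have hle : ∀ j, |c j| ≤ (M : ℤ) := by
        intro j
        have h1 := hlt j
        rw [abs_lt] at h1
        rw [abs_le]
        rcases ha with ⟨i, rfl⟩ | ⟨i, rfl⟩ <;> simp only [Pi.add_apply] at h1 ⊢ <;>
        rcases std_cases i j with h | h <;> constructor <;> omega
      have hstep : step 2 M η b c := by
        rcases ha with ⟨i, rfl⟩ | ⟨i, rfl⟩
        · exact Or.inl ⟨i, rfl, exo_open η ⟨fun j => (hlt j).le, hle⟩ (hb i)⟩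
        · exact Or.inr ⟨i, rfl, exo_open η ⟨hle, fun j => (hlt j).le⟩ (hc i)⟩
      have hcon' : connected 2 M η 0 c := Relation.ReflTransGen.tail hcon hstep
      by_cases hM : ∃ j, |c j| = (M : ℤ)
      · exact Or.inl ⟨c, hM, hcon'⟩
      · right
        push Not at hM
        exact ⟨hcon', fun j => lt_of_le_of_ne (hle j) (hM j)⟩

lemma reach_of_good {M : ℕ} (η : BoxConfig 2 M) (h : ∀ k ≤ M, coarse^[k] (site η) 0) :
    η ∈ reachBoundary 2 M := by
  obtain ⟨y, hy, hc⟩ := conn_far M h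
  rcases reach_of_conn η hc with h | ⟨-, h⟩
  · exact h
  · have := (abs_lt.1 (h 0)).2
    omega

lemma witness (M m : ℕ) : ∀ z : Fin 2 → ℤ, ∃ F : Finset (Finset ((Fin 2 → ℤ) × Fin 2)),
    81 * F.card ≤ 162 ^ (2 ^ m) ∧ (∀ T ∈ F, T.card = 2 ^ m ∧ ∀ e ∈ T, par^[m] e.1 = z) ∧
    ∀ η : BoxConfig 2 M, ¬ coarse^[m] (site η) z → ∃ T ∈ F, ∀ e ∈ T, exo η e = false := by
  classical
  induction m with
  | zero =>
    intro z
    refine ⟨{{(z, 0)}, {(z, 1)}}, ?_, ?_, ?_⟩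
    · have := Finset.card_le_two (a := ({(z, 0)} : Finset ((Fin 2 → ℤ) × Fin 2))) (b := {(z, 1)})
      simp only [pow_zero, pow_one]
      omega
    · intro T hT
      simp only [Finset.mem_insert, Finset.mem_singleton] at hT
      rcases hT with rfl | rfl <;> simp
    · intro η hη
      simp only [Function.iterate_zero, id_eq, site, not_forall] at hη
      obtain ⟨i, hi⟩ := hη
      have hi' : exo η (z, i) = false := by simpa using hi
      fin_cases i
      · exact ⟨{(z, 0)}, by simp, by simpa using hi'⟩
      · exact ⟨{(z, 1)}, by simp, by simpa using hi'⟩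
  | succ m ih =>
    intro z
    choose F hF1 hF2 hF3 using ih
    set ch : Finset (Fin 2 → ℤ) := Finset.Icc (fun j => 3 * z j - 1) (fun j => 3 * z j + 1) with hch
    have hmem : ∀ u, u ∈ ch ↔ par u = z := by
      intro u
      rw [hch, Finset.mem_Icc]
      constructor
      · rintro ⟨h1, h2⟩
        funext j
        have := h1 j
        have := h2 j
        simp only [par] at *
        omega
      · rintro rfl
        constructor <;> intro j <;> simp only [par] <;> omega
    have hcard : ch.card = 9 := by
      rw [hch, Pi.card_Icc]
      have : ∀ j, (Finset.Icc (3 * z j - 1) (3 * z j + 1)).card = 3 := by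
        intro j
        rw [Int.card_Icc]
        omega
      simp [this]
    refine ⟨((ch ×ˢ ch).filter fun u => u.1 ≠ u.2).biUnion
      fun u => Finset.image₂ (fun A B => A ∪ B) (F u.1) (F u.2), ?_, ?_, ?_⟩
    · have h1 := Finset.card_biUnion_le_card_mul ((ch ×ˢ ch).filter fun u => u.1 ≠ u.2)
        (fun u => Finset.image₂ (fun A B => A ∪ B) (F u.1) (F u.2))
        ((162 ^ (2 ^ m) / 81) * (162 ^ (2 ^ m) / 81)) (by
          intro u _
          refine (Finset.card_image₂_le _ _ _).trans ?_
          refine Nat.mul_le_mul ?_ ?_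
          · rw [Nat.le_div_iff_mul_le (by norm_num), mul_comm]; exact hF1 _
          · rw [Nat.le_div_iff_mul_le (by norm_num), mul_comm]; exact hF1 _)
      have h2 : ((ch ×ˢ ch).filter fun u => u.1 ≠ u.2).card ≤ 81 := by
        refine (Finset.card_filter_le _ _).trans ?_
        rw [Finset.card_product, hcard]
      have h3 : 81 * (162 ^ (2 ^ m) / 81) ≤ 162 ^ (2 ^ m) := Nat.mul_div_le _ _
      calc _ ≤ 81 * (81 * ((162 ^ (2 ^ m) / 81) * (162 ^ (2 ^ m) / 81))) :=
            Nat.mul_le_mul le_rfl (h1.trans (Nat.mul_le_mul h2 le_rfl))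
        _ = (81 * (162 ^ (2 ^ m) / 81)) * (81 * (162 ^ (2 ^ m) / 81)) := by ring
        _ ≤ 162 ^ (2 ^ m) * 162 ^ (2 ^ m) := Nat.mul_le_mul h3 h3
        _ = 162 ^ (2 ^ (m + 1)) := by rw [← pow_add]; congr 1; ring
    · intro T hT
      simp only [Finset.mem_biUnion, Finset.mem_filter, Finset.mem_product, Finset.mem_image₂] at hT
      obtain ⟨⟨u, u'⟩, ⟨⟨hu, hu'⟩, hne⟩, A, hA, B, hB, rfl⟩ := hT
      simp only at hu hu' hne hA hB
      obtain ⟨hA1, hA2⟩ := hF2 u A hA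
      obtain ⟨hB1, hB2⟩ := hF2 u' B hB
      constructor
      · rw [Finset.card_union_of_disjoint, hA1, hB1]
        · ring
        · rw [Finset.disjoint_left]
          intro e h h'
          exact hne ((hA2 e h).symm.trans (hB2 e h'))
      · intro e he
        rw [Function.iterate_succ_apply']
        rcases Finset.mem_union.1 he with h | h
        · rw [hA2 e h]; exact (hmem u).1 hu
        · rw [hB2 e h]; exact (hmem u').1 hu'
    · intro η hη
      rw [Function.iterate_succ_apply'] at hη
      unfold coarse at hη
      push Not at hη
      obtain ⟨u, u', hu, hu', hb, hb', hne⟩ := hη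
      obtain ⟨A, hA, hA'⟩ := hF3 u η hb
      obtain ⟨B, hB, hB'⟩ := hF3 u' η hb'
      refine ⟨A ∪ B, ?_, ?_⟩
      · simp only [Finset.mem_biUnion, Finset.mem_filter, Finset.mem_product, Finset.mem_image₂]
        exact ⟨(u, u'), ⟨⟨(hmem u).2 hu, (hmem u').2 hu'⟩, hne⟩, A, hA, B, hB, rfl⟩
      · intro e he
        rcases Finset.mem_union.1 he with h | h
        · exact hA' e h
        · exact hB' e h

lemma bad_prob {M : ℕ} {p : ℝ} (h0 : 0 ≤ p) (h1 : p ≤ 1) (m : ℕ) (z : Fin 2 → ℤ) :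
    bp p {η : BoxConfig 2 M | ¬ coarse^[m] (site η) z} ≤ (162 * (1 - p)) ^ (2 ^ m) := by
  obtain ⟨F, hF1, hF2, hF3⟩ := witness M m z
  have h := bp_le_sum h0 h1 F {η : BoxConfig 2 M | ¬ coarse^[m] (site η) z}
    (fun T => {η | ∀ e ∈ T, ∃ h : inBox 2 M e, η ⟨e, h⟩ = false}) (by
      intro η hη
      obtain ⟨T, hT, hT'⟩ := hF3 η hη
      exact ⟨T, hT, fun e he => exo_false η (hT' e he)⟩)
  refine h.trans ?_
  have hb : ∀ T ∈ F, bp p {η : BoxConfig 2 M | ∀ e ∈ T, ∃ h : inBox 2 M e, η ⟨e, h⟩ = false} ≤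
      (1 - p) ^ (2 ^ m) := by
    intro T hT
    have := bp_cyl_box (M := M) h0 h1 T false
    rw [(hF2 T hT).1] at this
    simpa using this
  refine (Finset.sum_le_card_nsmul _ _ _ hb).trans ?_
  rw [nsmul_eq_mul, mul_pow]
  refine mul_le_mul_of_nonneg_right ?_ (pow_nonneg (by linarith) _)
  have : F.card ≤ 162 ^ (2 ^ m) := by omega
  exact_mod_cast this

lemma reach_two (M : ℕ) : (1 / 2 : ℝ) ≤ bp (1 - 1 / 648 : ℝ) (reachBoundary 2 M) := by
  have h0 : (0 : ℝ) ≤ 1 - 1 / 648 := by norm_num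
  have h1 : (1 - 1 / 648 : ℝ) ≤ 1 := by norm_num
  rw [bp_compl]
  have h := bp_le_sum h0 h1 (Finset.range (M + 1)) (reachBoundary 2 M)ᶜ
    (fun k => {η : BoxConfig 2 M | ¬ coarse^[k] (site η) 0}) (by
      intro η hη
      by_contra hcon
      push Not at hcon
      apply hη
      apply reach_of_good
      intro k hk
      have := hcon k (by simpa using Nat.lt_succ_of_le hk)
      by_contra h'
      exact this h')
  have h2 : ∀ k ∈ Finset.range (M + 1),
      bp (1 - 1 / 648 : ℝ) {η : BoxConfig 2 M | ¬ coarse^[k] (site η) 0} ≤ (1 / 4 : ℝ) ^ (k + 1) := by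
    intro k _
    refine (bad_prob h0 h1 k 0).trans ?_
    have : (162 * (1 - (1 - 1 / 648 : ℝ))) = 1 / 4 := by norm_num
    rw [this]
    exact pow_le_pow_of_le_one (by norm_num) (by norm_num) Nat.lt_two_pow_self
  have h3 : ∀ K : ℕ, ∑ k ∈ Finset.range K, (1 / 4 : ℝ) ^ (k + 1) = (1 - (1 / 4) ^ K) / 3 := by
    intro K
    induction K with
    | zero => simp
    | succ K ih => rw [Finset.sum_range_succ, ih]; ring
  have h4 := Finset.sum_le_sum h2
  rw [h3] at h4
  have h5 : (0 : ℝ) ≤ (1 / 4) ^ (M + 1) := by positivity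
  linarith

/-! ### the critical probability -/

lemma theta_eq (d : ℕ) (p : ℝ) : theta d p = ⨅ M : ℕ, bp p (reachBoundary d M) := by
  unfold theta
  simp_rw [prob_eq]

lemma theta_le {d : ℕ} {p : ℝ} (h0 : 0 ≤ p) (h1 : p ≤ 1) (M : ℕ) :
    theta d p ≤ bp p (reachBoundary d M) := by
  rw [theta_eq]
  refine ciInf_le ⟨0, ?_⟩ M
  rintro _ ⟨M, rfl⟩
  exact bp_nonneg h0 h1 _

lemma theta_nonneg {d : ℕ} {p : ℝ} (h0 : 0 ≤ p) (h1 : p ≤ 1) : 0 ≤ theta d p := by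
  rw [theta_eq]
  exact le_ciInf fun M => bp_nonneg h0 h1 _

lemma theta_mono {d : ℕ} {p q : ℝ} (h0 : 0 ≤ q) (hpq : q ≤ p) (h1 : p ≤ 1) :
    theta d q ≤ theta d p := by
  rw [theta_eq d p]
  refine le_ciInf fun M => (theta_le h0 (hpq.trans h1) M).trans ?_
  exact bp_mono_p h0 hpq h1 _ (reach_mono d M)

lemma theta_enh {n : ℕ} {p q m : ℝ} (hm : 0 < m) (hmp : m ≤ p) (hm1 : p ≤ 1 - m)
    (hq0 : 0 ≤ q) (hq1 : q ≤ 1) (hq : q ≤ p + (m / 2) ^ (3 ^ (n + 1) * (n + 1))) :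
    theta n q ≤ theta (n + 1) p := by
  rw [theta_eq (n + 1) p]
  refine le_ciInf fun M => (theta_le hq0 hq1 M).trans ?_
  rcases Nat.eq_zero_or_pos M with rfl | hM
  · have : reachBoundary (n + 1) 0 = Set.univ := by
      rw [Set.eq_univ_iff_forall]
      intro η
      exact ⟨0, ⟨0, by simp⟩, Relation.ReflTransGen.refl⟩
    rw [this, bp_univ]
    exact bp_le_one hq0 hq1 _
  · exact enh_ineq hM hm hmp hm1 hq0 hq1 hq

lemma hatPc_le {d : ℕ} {p : ℝ} (h0 : 0 ≤ p) (_h1 : p ≤ 1) (h : 0 < theta d p) : hatPc d ≤ p := by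
  refine Real.sSup_le ?_ h0
  rintro x ⟨⟨hx0, hx1⟩, hx⟩
  by_contra hcon
  have := theta_mono (d := d) h0 (not_le.1 hcon).le hx1
  linarith

lemma le_hatPc {d : ℕ} {p : ℝ} (h0 : 0 ≤ p) (h1 : p ≤ 1) (h : theta d p = 0) : p ≤ hatPc d := by
  refine le_csSup ⟨1, ?_⟩ ⟨⟨h0, h1⟩, h⟩
  rintro x ⟨⟨_, hx1⟩, _⟩
  exact hx1

lemma hatPc_pos {n : ℕ} (hn : 1 ≤ n) : 0 < hatPc n := by
  have hn' : (1 : ℝ) ≤ n := by exact_mod_cast hn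
  have h0 : (0 : ℝ) < 1 / (4 * n) := by positivity
  have h1 : (1 : ℝ) / (4 * n) ≤ 1 := by
    rw [div_le_one (by positivity)]
    linarith
  refine lt_of_lt_of_le h0 (le_hatPc h0.le h1 ?_)
  refine le_antisymm ?_ (theta_nonneg h0.le h1)
  have hb : ∀ M : ℕ, theta n (1 / (4 * n)) ≤ (1 / 2 : ℝ) ^ M := by
    intro M
    have := (theta_le (d := n) h0.le h1 M).trans (reach_small h0.le h1)
    have e : (2 * n * (1 / (4 * n)) : ℝ) = 1 / 2 := by field_simp; norm_num
    rwa [e] at this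
  exact ge_of_tendsto' (tendsto_pow_atTop_nhds_zero_of_lt_one (by norm_num) (by norm_num)) hb

lemma theta_pos (n : ℕ) (hn : 2 ≤ n) : 0 < theta n (1 - 1 / 648) := by
  induction n, hn using Nat.le_induction with
  | base =>
    rw [theta_eq]
    exact lt_of_lt_of_le (by norm_num : (0 : ℝ) < 1 / 2) (le_ciInf reach_two)
  | succ n _ ih =>
    refine lt_of_lt_of_le ih (theta_enh (m := 1 / 648) (by norm_num) (by norm_num) (by norm_num)
      (by norm_num) (by norm_num) ?_)
    have : (0 : ℝ) ≤ (1 / 648 / 2) ^ (3 ^ (n + 1) * (n + 1)) := by positivity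
    linarith

lemma hatPc_succ_lt (n : ℕ) (hn : 2 ≤ n) : hatPc (n + 1) < hatPc n := by
  have hP0 : 0 < hatPc n := hatPc_pos (by omega)
  have hP1 : hatPc n < 1 :=
    lt_of_le_of_lt (hatPc_le (by norm_num) (by norm_num) (theta_pos n hn)) (by norm_num)
  set P := hatPc n with hP
  obtain ⟨m, hm, hm1, hm2⟩ : ∃ m : ℝ, 0 < m ∧ m ≤ P / 2 ∧ m ≤ 1 - P :=
    ⟨min (P / 2) (1 - P), lt_min (by linarith) (by linarith), min_le_left _ _, min_le_right _ _⟩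
  obtain ⟨c, hc⟩ : ∃ c, c = (m / 2) ^ (3 ^ (n + 1) * (n + 1)) := ⟨_, rfl⟩
  have hc0 : 0 < c := by rw [hc]; positivity
  obtain ⟨t, ht, ht1, ht2⟩ : ∃ t : ℝ, 0 < t ∧ t ≤ c / 2 ∧ t ≤ P / 2 :=
    ⟨min (c / 2) (P / 2), lt_min (by linarith) (by linarith), min_le_left _ _, min_le_right _ _⟩
  obtain ⟨q, hq1, hq2, hq3⟩ : ∃ q : ℝ, q ≤ P - t + c ∧ q ≤ 1 ∧ P < q :=
    ⟨min (P - t + c) 1, min_le_left _ _, min_le_right _ _, lt_min (by linarith) hP1⟩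
  have hq0 : 0 ≤ q := by linarith
  have hpos : 0 < theta n q := by
    refine lt_of_le_of_ne (theta_nonneg hq0 hq2) fun h => ?_
    have := le_hatPc hq0 hq2 h.symm
    linarith
  have h2 : theta n q ≤ theta (n + 1) (P - t) :=
    theta_enh hm (by linarith) (by linarith) hq0 hq2 (by rw [← hc]; exact hq1)
  have := hatPc_le (d := n + 1) (p := P - t) (by linarith) (by linarith) (by linarith)
  linarith

end PercAux

/-- For every integer `d ≥ 3`, the critical probability of Bernoulli bond percolation
on `ℤ^d` is strictly smaller than that on `ℤ^{d−1}`: `p̂_c(d) < p̂_c(d−1)`. -/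
theorem hatPc_strict_anti (d : ℕ) (hd : 3 ≤ d) :
    ZLattice.hatPc d < ZLattice.hatPc (d - 1) := by
  obtain ⟨n, rfl⟩ : ∃ n, d = n + 1 := ⟨d - 1, by omega⟩
  exact PercAux.hatPc_succ_lt n (by omega)
end
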